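/- arXiv:2102.07029 — 6 statements merged into one kernel-verified Lean document; each statement's English description precedes it below -/
import Mathlib

section
/- Let G be a finite group. If σ₁(G) < 2 + 11/|G|, then G is supersolvable. -/
noncomputable def sigma1 (G : Type*) [Group G] : ℚ :=
  (∑ᶠ H : Subgroup G, (Nat.card H : ℚ)) / Nat.card G

def IsSupersolvable (G : Type*) [Group G] : Prop :=
  ∃ (n : ℕ) (H : Fin (n + 1) → Subgroup G) (hnorm : ∀ i, (H i).Normal),
    H 0 = ⊥ ∧ H (Fin.last n) = ⊤ ∧
    ∀ i : Fin n,
      H i.castSucc ≤ H i.succ ∧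
      letI := hnorm i.castSucc
      IsCyclic ((H i.succ).map (QuotientGroup.mk' (H i.castSucc)))

open scoped Pointwise

/-- If `g ∈ K` generates `K` modulo the normal subgroup `H`, then the image of `K` in `G ⧸ H`
is cyclic. -/
lemma isCyclic_map_mk'_of_generator {G : Type*} [Group G] {H K : Subgroup G} [H.Normal]
    (g : G) (hg : g ∈ K) (h : ∀ k ∈ K, ∃ n : ℤ, (g ^ n)⁻¹ * k ∈ H) :
    IsCyclic (K.map (QuotientGroup.mk' H)) := by
  refine ⟨⟨QuotientGroup.mk' H g, Subgroup.mem_map_of_mem _ hg⟩, ?_⟩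
  rintro ⟨_, k, hk, rfl⟩
  obtain ⟨n, hn⟩ := h k hk
  refine ⟨n, Subtype.ext ?_⟩
  have := (QuotientGroup.eq (s := H)).2 hn
  simpa using this

lemma exists_generator_of_isCyclic_map_mk' {G : Type*} [Group G] {H K : Subgroup G} [H.Normal]
    (h : IsCyclic (K.map (QuotientGroup.mk' H))) :
    ∃ g ∈ K, ∀ k ∈ K, ∃ n : ℤ, (g ^ n)⁻¹ * k ∈ H := by
  obtain ⟨⟨_, g, hg, rfl⟩, hgen⟩ := h
  refine ⟨g, hg, fun k hk => ?_⟩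
  obtain ⟨n, hn⟩ := hgen ⟨_, Subgroup.mem_map_of_mem _ hk⟩
  refine ⟨n, (QuotientGroup.eq (s := H)).1 ?_⟩
  simpa using congrArg Subtype.val hn

theorem IsSupersolvable.of_quotient {G : Type*} [Group G] (N : Subgroup G) [hN : N.Normal]
    [hc : IsCyclic N] (h : IsSupersolvable (G ⧸ N)) : IsSupersolvable G := by
  obtain ⟨n, H, hnorm, h0, hl, hstep⟩ := h
  let π := QuotientGroup.mk' N
  let K : Fin (n + 2) → Subgroup G := Fin.cons ⊥ (fun i => (H i).comap π)
  have hK : ∀ i, (K i).Normal := by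
    intro i
    refine Fin.cases ?_ (fun i => ?_) i
    · exact (inferInstance : (⊥ : Subgroup G).Normal)
    · exact (hnorm i).comap π
  refine ⟨n + 1, K, hK, rfl, ?_, fun i => ?_⟩
  · change (H (Fin.last n)).comap π = ⊤
    rw [hl, Subgroup.comap_top]
  · have key : K i.castSucc ≤ K i.succ ∧
        ∃ g ∈ K i.succ, ∀ k ∈ K i.succ, ∃ n : ℤ, (g ^ n)⁻¹ * k ∈ K i.castSucc := by
      refine Fin.cases ?_ (fun i => ?_) i
      · refine ⟨bot_le, ?_⟩
        obtain ⟨⟨g, hg⟩, hgen⟩ := hc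
        have hK1 : K (Fin.succ 0) = N := by
          change (H 0).comap π = N
          rw [h0]
          exact QuotientGroup.ker_mk' N
        rw [hK1]
        refine ⟨g, hg, fun k hk => ?_⟩
        obtain ⟨m, hm⟩ := hgen ⟨k, hk⟩
        refine ⟨m, ?_⟩
        have : g ^ m = k := by simpa using congrArg Subtype.val hm
        rw [this, inv_mul_cancel]
        exact one_mem _
      · obtain ⟨hle, hcyc⟩ := hstep i
        have := hnorm i.castSucc
        obtain ⟨g, hg, hgen⟩ := exists_generator_of_isCyclic_map_mk' hcyc
        obtain ⟨g, rfl⟩ := QuotientGroup.mk'_surjective N g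
        have h1 : K i.succ.castSucc = (H i.castSucc).comap π := rfl
        have h2 : K i.succ.succ = (H i.succ).comap π := rfl
        rw [h1, h2]
        refine ⟨Subgroup.comap_mono hle, g, hg, fun k hk => ?_⟩
        obtain ⟨m, hm⟩ := hgen _ hk
        refine ⟨m, ?_⟩
        rw [Subgroup.mem_comap]
        simpa [π] using hm
    refine ⟨key.1, ?_⟩
    obtain ⟨g, hg, hgen⟩ := key.2
    have := hK i.castSucc
    exact isCyclic_map_mk'_of_generator g hg hgen

theorem IsSupersolvable.of_subsingleton {G : Type*} [Group G] [Subsingleton G] :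
    IsSupersolvable G :=
  ⟨0, fun _ => ⊥, fun _ => inferInstance, rfl, Subsingleton.elim _ _, fun i => i.elim0⟩

theorem IsSupersolvable.of_isCyclic {G : Type*} [Group G] [IsCyclic G] : IsSupersolvable G := by
  have : IsCyclic (⊤ : Subgroup G) := isCyclic_of_surjective Subgroup.topEquiv.symm
    Subgroup.topEquiv.symm.surjective
  have : Subsingleton (G ⧸ (⊤ : Subgroup G)) := QuotientGroup.subsingleton_quotient_top
  exact .of_quotient ⊤ .of_subsingleton

theorem IsSupersolvable.of_isNilpotent (G : Type*) [Group G] [Finite G]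
    [hG : Group.IsNilpotent G] : IsSupersolvable G := by
  induction hn : Nat.card G using Nat.strong_induction_on generalizing G with
  | _ n ih =>
    subst hn
    cases subsingleton_or_nontrivial G with
    | inl _ => exact .of_subsingleton
    | inr _ =>
      obtain ⟨z, hz1⟩ := Subgroup.ne_bot_iff_exists_ne_one.1
        (Group.IsNilpotent.center_ne_bot (G := G))
      have hle : Subgroup.zpowers (z : G) ≤ Subgroup.center G :=
        Subgroup.zpowers_le.2 z.2
      have hnorm : (Subgroup.zpowers (z : G)).Normal :=
        ⟨fun x hx g => by
          rwa [Subgroup.mem_center_iff.1 (hle hx) g, mul_inv_cancel_right]⟩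
      refine .of_quotient (Subgroup.zpowers (z : G)) (ih _ ?_ _ rfl)
      have h1 : 1 < Nat.card (Subgroup.zpowers (z : G)) := by
        rw [Subgroup.one_lt_card_iff_ne_bot, Subgroup.zpowers_ne_bot]
        simpa using hz1
      have h2 := Subgroup.card_eq_card_quotient_mul_card_subgroup (Subgroup.zpowers (z : G))
      have h3 : 0 < Nat.card (G ⧸ Subgroup.zpowers (z : G)) := Nat.card_pos
      nlinarith

/-- A group with a cyclic normal maximal subgroup is supersolvable. -/
theorem IsSupersolvable.of_isCoatom {G : Type*} [Group G] (L : Subgroup G) [L.Normal]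
    (hL : IsCoatom L) [IsCyclic L] : IsSupersolvable G := by
  obtain ⟨g, hg⟩ : ∃ g, g ∉ L := by
    by_contra! h
    exact hL.1 ((Subgroup.eq_top_iff' L).2 h)
  have htop : Subgroup.zpowers g ⊔ L = ⊤ := by
    refine hL.2 _ (lt_of_le_of_ne le_sup_right fun h => hg ?_)
    rw [h]
    exact Subgroup.mem_sup_left (Subgroup.mem_zpowers g)
  have : IsCyclic (G ⧸ L) := by
    refine ⟨(g : G ⧸ L), fun x => ?_⟩
    obtain ⟨k, rfl⟩ := QuotientGroup.mk_surjective x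
    have hk : k ∈ Subgroup.zpowers g ⊔ L := htop ▸ Subgroup.mem_top k
    obtain ⟨_, ⟨m, rfl⟩, l, hl, rfl⟩ := Subgroup.mem_sup_of_normal_right.1 hk
    refine ⟨m, ?_⟩
    change (g : G ⧸ L) ^ m = _
    rw [← QuotientGroup.mk_zpow]
    exact QuotientGroup.eq.2 (by simpa using hl)
  exact .of_quotient L .of_isCyclic

theorem IsSupersolvable.of_card_two_mul_prime {G : Type*} [Group G] {p : ℕ} [hp : Fact p.Prime]
    (hG : Nat.card G = 2 * p) : IsSupersolvable G := by
  have : Finite G := Nat.finite_of_card_ne_zero (by rw [hG]; have := hp.out.pos; omega)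
  obtain ⟨x, hx⟩ := exists_prime_orderOf_dvd_card' (G := G) p (hG ▸ dvd_mul_left p 2)
  have hi : (Subgroup.zpowers x).index = 2 := by
    have := (Subgroup.zpowers x).index_mul_card
    rw [Nat.card_zpowers, hx, hG] at this
    exact Nat.eq_of_mul_eq_mul_right hp.out.pos this
  have := Subgroup.normal_of_index_eq_two hi
  have hq : Nat.card (G ⧸ Subgroup.zpowers x) = 2 := hi
  have : IsCyclic (G ⧸ Subgroup.zpowers x) := isCyclic_of_prime_card (p := 2) hq
  exact .of_quotient (Subgroup.zpowers x) .of_isCyclic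

theorem IsSupersolvable.of_card_le_ten {G : Type*} [Group G] [Finite G]
    (hG : Nat.card G ≤ 10) : IsSupersolvable G := by
  have hpos : 0 < Nat.card G := Nat.card_pos
  have hpow : ∀ p k : ℕ, p.Prime → Nat.card G = p ^ k → IsSupersolvable G := by
    intro p k hp hk
    have : Fact p.Prime := ⟨hp⟩
    have : Group.IsNilpotent G := (IsPGroup.of_card hk).isNilpotent
    exact .of_isNilpotent G
  generalize hn : Nat.card G = n at *
  interval_cases n
  · exact hpow 2 0 (by norm_num) rfl
  · exact hpow 2 1 (by norm_num) rfl
  · exact hpow 3 1 (by norm_num) rfl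
  · exact hpow 2 2 (by norm_num) rfl
  · exact hpow 5 1 (by norm_num) rfl
  · have : Fact (Nat.Prime 3) := ⟨by norm_num⟩
    exact .of_card_two_mul_prime (p := 3) hn
  · exact hpow 7 1 (by norm_num) rfl
  · exact hpow 2 3 (by norm_num) rfl
  · exact hpow 3 2 (by norm_num) rfl
  · have : Fact (Nat.Prime 5) := ⟨by norm_num⟩
    exact .of_card_two_mul_prime (p := 5) hn

/-- In a group that is not cyclic, the cyclic proper subgroups have orders summing to at least
`|G|`, and so the orders of all subgroups sum to at least `2 |G|`. -/
theorem two_mul_card_le_sum_card_subgroup {G : Type*} [Group G] [Finite G] [Fintype (Subgroup G)]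
    (hG : ¬ IsCyclic G) : 2 * Nat.card G ≤ ∑ H : Subgroup G, Nat.card H := by
  classical
  have := Fintype.ofFinite G
  let S : Finset (Subgroup G) := Finset.univ.image Subgroup.zpowers
  have htop : (⊤ : Subgroup G) ∉ S := by
    intro h
    obtain ⟨x, -, hx⟩ := Finset.mem_image.1 h
    exact hG ⟨x, fun y => (hx ▸ Subgroup.mem_top y : y ∈ Subgroup.zpowers x)⟩
  have hS : Nat.card G ≤ ∑ H ∈ S, Nat.card H := by
    rw [Nat.card_eq_fintype_card, ← Finset.card_univ,
      Finset.card_eq_sum_card_image Subgroup.zpowers]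
    refine Finset.sum_le_sum fun H _ => ?_
    rw [← SetLike.coe_sort_coe, Nat.card_coe_set_eq, Set.ncard_eq_toFinset_card']
    refine Finset.card_le_card fun x hx => ?_
    simp only [Finset.mem_filter, Finset.mem_univ, true_and] at hx
    simp [← hx]
  calc 2 * Nat.card G ≤ Nat.card (⊤ : Subgroup G) + ∑ H ∈ S, Nat.card H := by
        rw [Subgroup.card_top]; omega
    _ = ∑ H ∈ insert ⊤ S, Nat.card H := by
        rw [Finset.sum_insert htop]
    _ ≤ _ := Finset.sum_le_sum_of_subset (Finset.subset_univ _)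

theorem eleven_le_sum_card_subgroup_of_card_eq_four {G : Type*} [Group G] [Fintype (Subgroup G)]
    (h4 : Nat.card G = 4) (hG : ¬ IsCyclic G) : 11 ≤ ∑ H : Subgroup G, Nat.card H := by
  classical
  have : Finite G := Nat.finite_of_card_ne_zero (by omega)
  have := Fintype.ofFinite G
  have hord : ∀ x : G, x ≠ 1 → orderOf x = 2 := by
    intro x hx
    have h1 : orderOf x ∣ 4 := h4 ▸ orderOf_dvd_natCard x
    have h2 : orderOf x ≠ 4 := fun h => hG (isCyclic_of_orderOf_eq_card x (h.trans h4.symm))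
    have h3 : orderOf x ≠ 1 := fun h => hx (orderOf_eq_one_iff.1 h)
    have h5 : orderOf x ≤ 4 := Nat.le_of_dvd (by norm_num) h1
    interval_cases h : orderOf x <;> simp_all
  have hsq : ∀ x : G, x ^ 2 = 1 := by
    intro x
    by_cases hx : x = 1
    · simp [hx]
    · rw [← hord x hx, pow_orderOf_eq_one]
  have hmem : ∀ x y : G, x ∈ Subgroup.zpowers y → x = 1 ∨ x = y := by
    rintro x y ⟨n, rfl⟩
    have hy : y ^ (2 : ℤ) = 1 := by exact_mod_cast hsq y
    rcases Int.even_or_odd' n with ⟨k, rfl | rfl⟩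
    · left; simp [zpow_mul, hy]
    · right; simp [zpow_add, zpow_mul, hy]
  have hinj : Function.Injective (Subgroup.zpowers : G → Subgroup G) := by
    intro x y hxy
    rcases hmem x y (hxy ▸ Subgroup.mem_zpowers x) with rfl | h
    · rw [Subgroup.zpowers_one_eq_bot] at hxy
      exact (Subgroup.zpowers_eq_bot.1 hxy.symm).symm
    · exact h
  let S : Finset (Subgroup G) := Finset.univ.image Subgroup.zpowers
  have htop : (⊤ : Subgroup G) ∉ S := by
    intro h
    obtain ⟨x, -, hx⟩ := Finset.mem_image.1 h
    exact hG ⟨x, fun y => (hx ▸ Subgroup.mem_top y : y ∈ Subgroup.zpowers x)⟩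
  have hS : ∑ H ∈ S, Nat.card H = 7 := by
    rw [Finset.sum_image hinj.injOn, ← Finset.add_sum_erase _ _ (Finset.mem_univ (1 : G)),
      Finset.sum_congr rfl (g := fun _ => 2)]
    · rw [Finset.sum_const, Finset.card_erase_of_mem (Finset.mem_univ _), Finset.card_univ,
        ← Nat.card_eq_fintype_card, h4]
      simp
    · intro x hx
      rw [Nat.card_zpowers, hord x (Finset.ne_of_mem_erase hx)]
  calc 11 = Nat.card (⊤ : Subgroup G) + ∑ H ∈ S, Nat.card H := by
        rw [Subgroup.card_top, hS, h4]
    _ = ∑ H ∈ insert ⊤ S, Nat.card H := by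
        rw [Finset.sum_insert htop]
    _ ≤ _ := Finset.sum_le_sum_of_subset (Finset.subset_univ _)

theorem isCyclic_of_sum_card_subgroup_le_ten {G : Type*} [Group G] [Finite G]
    [Fintype (Subgroup G)] (h : ∑ H : Subgroup G, Nat.card H ≤ 10) : IsCyclic G := by
  by_contra hG
  have h2 := two_mul_card_le_sum_card_subgroup hG
  have hpos : 0 < Nat.card G := Nat.card_pos
  have hprime : ∀ p : ℕ, p.Prime → Nat.card G ≠ p := fun p hp hc =>
    have : Fact p.Prime := ⟨hp⟩
    hG (isCyclic_of_prime_card hc)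
  have h4 : Nat.card G ≠ 4 := fun h4 => by
    have := eleven_le_sum_card_subgroup_of_card_eq_four h4 hG
    omega
  have h1 : Nat.card G ≠ 1 := fun h1 => by
    have := (Nat.card_eq_one_iff_unique.1 h1).1
    exact hG inferInstance
  have := hprime 2 (by norm_num)
  have := hprime 3 (by norm_num)
  have := hprime 5 (by norm_num)
  omega

/-- The conjugates of a non-normal maximal subgroup have orders summing to `|G|`. -/
theorem sum_card_conj_of_isCoatom {G : Type*} [Group G] [Finite G] [Fintype (Subgroup G)]
    (M : Subgroup G) (hM : IsCoatom M) (hn : ¬ M.Normal)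
    [DecidablePred (· ∈ MulAction.orbit (ConjAct G) M)] :
    ∑ H : Subgroup G with H ∈ MulAction.orbit (ConjAct G) M, Nat.card H = Nat.card G := by
  have hnorm : Subgroup.normalizer (M : Set G) = M := by
    by_contra h
    exact hn (Subgroup.normalizer_eq_top_iff.1
      (hM.2 _ (lt_of_le_of_ne Subgroup.le_normalizer (Ne.symm h))))
  have hstab : MulAction.stabilizer (ConjAct G) M
      = M.map (ConjAct.toConjAct (G := G)).toMonoidHom := by
    ext g
    obtain ⟨g, rfl⟩ := ConjAct.toConjAct.surjective g
    rw [MulAction.mem_stabilizer_iff, Subgroup.conjAct_pointwise_smul_iff, hnorm]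
    simp
  have hidx : (MulAction.stabilizer (ConjAct G) M).index = M.index := by
    rw [hstab]
    exact Subgroup.index_map_equiv M ConjAct.toConjAct
  have hcard : ∀ H ∈ Finset.univ.filter (· ∈ MulAction.orbit (ConjAct G) M),
      Nat.card H = Nat.card M := by
    intro H hH
    obtain ⟨g, rfl⟩ := (Finset.mem_filter.1 hH).2
    exact Nat.card_congr (Subgroup.equivSMul g M).symm.toEquiv
  rw [Finset.sum_congr rfl hcard, Finset.sum_const, smul_eq_mul, ← M.index_mul_card, ← hidx,
    MulAction.index_stabilizer, Set.ncard_eq_toFinset_card _ (Set.toFinite _)]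
  congr 2
  ext H
  simp

/-- In a finite group with a non-normal maximal subgroup `M` there is a maximal subgroup of
order different from that of `M`. -/
theorem exists_isCoatom_card_ne {G : Type*} [Group G] [Finite G] (M : Subgroup G)
    (hM : IsCoatom M) (hn : ¬ M.Normal) :
    ∃ L : Subgroup G, IsCoatom L ∧ Nat.card L ≠ Nat.card M := by
  obtain ⟨p, hp, hpM⟩ := Nat.exists_prime_and_dvd (fun h => hM.1 (Subgroup.index_eq_one.1 h))
  have : Fact p.Prime := ⟨hp⟩
  obtain ⟨P⟩ := (inferInstance : Nonempty (Sylow p G))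
  have hP : (P : Subgroup G) ≠ ⊤ := by
    intro h
    have hpG : IsPGroup p G := by
      have := P.isPGroup'
      rw [h] at this
      exact this.of_equiv Subgroup.topEquiv
    have := hpG.isNilpotent
    exact hn (((Group.isNilpotent_of_finite_tfae (G := G)).out 0 2 rfl rfl).1 this M hM)
  obtain ⟨L, hL, hPL⟩ := (eq_top_or_exists_le_coatom (P : Subgroup G)).resolve_left hP
  refine ⟨L, hL, fun h => P.not_dvd_index ?_⟩
  have hLM : L.index = M.index :=
    Nat.eq_of_mul_eq_mul_right (Nat.card_pos (α := M))
      (by rw [M.index_mul_card, ← h, L.index_mul_card])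
  exact (hLM ▸ hpM).trans (Subgroup.index_dvd_of_le hPL)

theorem sum_card_subgroup_le_sum_filter {G : Type*} [Group G] [Fintype (Subgroup G)]
    (L : Subgroup G) [Fintype (Subgroup L)] [DecidablePred (· ≤ L)] :
    ∑ H : Subgroup L, Nat.card H ≤ ∑ H : Subgroup G with H ≤ L, Nat.card H := by
  classical
  have hinj : Function.Injective (Subgroup.map L.subtype) :=
    Subgroup.map_injective L.subtype_injective
  calc ∑ H : Subgroup L, Nat.card H
      = ∑ H ∈ Finset.univ.image (Subgroup.map L.subtype), Nat.card H := by
        rw [Finset.sum_image hinj.injOn]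
        refine Finset.sum_congr rfl fun H _ => ?_
        exact (Subgroup.card_map_of_injective L.subtype_injective).symm
    _ ≤ _ := by
        refine Finset.sum_le_sum_of_subset fun H hH => ?_
        obtain ⟨K, -, rfl⟩ := Finset.mem_image.1 hH
        simpa using Subgroup.map_subtype_le K

theorem isSupersolvable_of_sum_card_subgroup_lt {G : Type*} [Group G] [Finite G]
    [Fintype (Subgroup G)] (h : ∑ H : Subgroup G, Nat.card H < 2 * Nat.card G + 11) :
    IsSupersolvable G := by
  classical
  by_cases hmax : ∀ M : Subgroup G, IsCoatom M → M.Normal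
  · have : Group.IsNilpotent G :=
      ((Group.isNilpotent_of_finite_tfae (G := G)).out 0 2 rfl rfl).2 hmax
    exact .of_isNilpotent G
  push Not at hmax
  obtain ⟨M, hM, hMn⟩ := hmax
  obtain ⟨L, hL, hLM⟩ := exists_isCoatom_card_ne M hM hMn
  have hcard : ∀ {K H : Subgroup G}, H ∈ MulAction.orbit (ConjAct G) K →
      Nat.card H = Nat.card K := by
    rintro K _ ⟨g, rfl⟩
    exact Nat.card_congr (Subgroup.equivSMul g K).symm.toEquiv
  have htop : ∀ {K : Subgroup G}, IsCoatom K → ⊤ ∉ MulAction.orbit (ConjAct G) K :=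
    fun hK hmem => hK.1 (Subgroup.eq_top_of_card_eq _ (by
      rw [← hcard hmem, Subgroup.card_top]))
  let S : Finset (Subgroup G) := {H | H ∈ MulAction.orbit (ConjAct G) M}
  have hS : ∑ H ∈ S, Nat.card H = Nat.card G := sum_card_conj_of_isCoatom M hM hMn
  have bound : ∀ T : Finset (Subgroup G), Disjoint S T → ⊤ ∉ T →
      ∑ H ∈ T, Nat.card H ≤ 10 := by
    intro T hST hT
    have h1 : ⊤ ∉ S ∪ T := by
      simp only [Finset.mem_union, not_or]
      exact ⟨fun hm => htop hM (Finset.mem_filter.1 hm).2, hT⟩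
    have h2 : ∑ H ∈ insert ⊤ (S ∪ T), Nat.card H ≤ ∑ H : Subgroup G, Nat.card H :=
      Finset.sum_le_sum_of_subset (Finset.subset_univ _)
    rw [Finset.sum_insert h1, Finset.sum_union hST, hS, Subgroup.card_top] at h2
    omega
  by_cases hLn : L.Normal
  · have hle : ∑ H : Subgroup G with H ≤ L, Nat.card H ≤ 10 := by
      refine bound _ (Finset.disjoint_left.2 fun H hHM hHL => ?_) ?_
      · obtain ⟨g, rfl⟩ := (Finset.mem_filter.1 hHM).2
        have hgL : g • M ≤ L := (Finset.mem_filter.1 hHL).2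
        have hgg : g • L = L := (Subgroup.conjAct_pointwise_smul_iff (g := ConjAct.ofConjAct g)).2
          (by rw [Subgroup.normalizer_eq_top]; exact Subgroup.mem_top _)
        rw [← hgg, Subgroup.pointwise_smul_le_pointwise_smul_iff] at hgL
        rcases hM.le_iff.1 hgL with h | h
        · exact hL.1 h
        · exact hLM (by rw [h])
      · simpa using hL.1
    have := Fintype.ofFinite (Subgroup L)
    have : IsCyclic L :=
      isCyclic_of_sum_card_subgroup_le_ten ((sum_card_subgroup_le_sum_filter L).trans hle)
    exact .of_isCoatom L hL
  · refine .of_card_le_ten ?_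
    rw [← sum_card_conj_of_isCoatom L hL hLn]
    refine bound _ (Finset.disjoint_left.2 fun H hHM hHL => ?_) ?_
    · exact hLM ((hcard (Finset.mem_filter.1 hHL).2).symm.trans
        (hcard (Finset.mem_filter.1 hHM).2))
    · exact fun hm => htop hL (Finset.mem_filter.1 hm).2

theorem stmt_0 (G : Type*) [Group G] [Finite G]
    (h : sigma1 G < 2 + 11 / (Nat.card G : ℚ)) :
    IsSupersolvable G := by
  have := Fintype.ofFinite (Subgroup G)
  apply isSupersolvable_of_sum_card_subgroup_lt
  have hpos : (0 : ℚ) < Nat.card G := by exact_mod_cast Nat.card_pos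
  rw [sigma1, finsum_eq_sum_of_fintype, div_lt_iff₀ hpos, add_mul,
    div_mul_cancel₀ _ hpos.ne'] at h
  exact_mod_cast h
end

section
/- Let G be a finite non-cyclic group. If σ₁(G) = 2 + 11/|G|, then G is isomorphic to ℤ/2 × ℤ/4 or to the alternating group A₄. -/
theorem Nat.totient_mul_prime_le {q : ℕ} (hq : q.Prime) (n : ℕ) (h : q ∣ n) :
    n.totient * q ≤ (q - 1) * n := by
  induction n using Nat.strong_induction_on with
  | _ n ih =>
    obtain ⟨k, rfl⟩ := h
    rcases Nat.eq_zero_or_pos k with rfl | hk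
    · simp
    by_cases hqk : q ∣ k
    · rw [Nat.totient_mul_of_prime_of_dvd hq hqk]
      have := Nat.mul_le_mul_left q (ih k (by nlinarith [hq.two_le]) hqk)
      linarith
    · rw [Nat.totient_mul_of_prime_of_not_dvd hq hqk]
      have := Nat.mul_le_mul_left ((q - 1) * q) (Nat.totient_le k)
      linarith

theorem Nat.totient_le_mul_sub_totient {q n : ℕ} (hq : q.Prime) (h : q ∣ n) :
    n.totient ≤ (q - 1) * (n - n.totient) := by
  have h1 := Nat.totient_mul_prime_le hq n h
  obtain ⟨w, hw⟩ := Nat.exists_eq_add_of_le (Nat.totient_le n)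
  obtain ⟨r, rfl⟩ : ∃ r, q = r + 1 := ⟨q - 1, by have := hq.two_le; omega⟩
  have : n - n.totient = w := by omega
  rw [this]
  generalize n.totient = t at *
  subst hw
  simp only [Nat.add_sub_cancel] at *
  nlinarith

theorem Nat.totient_prime_pow_eq_mul_sub_totient {p k : ℕ} (hp : p.Prime) (hk : 0 < k) :
    (p ^ k).totient = (p - 1) * (p ^ k - (p ^ k).totient) := by
  obtain ⟨j, rfl⟩ : ∃ j, k = j + 1 := ⟨k - 1, by omega⟩
  obtain ⟨r, rfl⟩ : ∃ r, p = r + 1 := ⟨p - 1, by have := hp.two_le; omega⟩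
  rw [Nat.totient_prime_pow_succ hp]
  have : (r + 1) ^ (j + 1) - (r + 1) ^ j * (r + 1 - 1) = (r + 1) ^ j := by
    rw [pow_succ, Nat.add_sub_cancel, Nat.mul_add, Nat.mul_one, Nat.add_sub_cancel_left]
  rw [this, mul_comm]

namespace Subgroup

open scoped Classical in
/-- The number of generators of a subgroup as a cyclic group. -/
noncomputable def numGenerators {G : Type*} [Group G] (H : Subgroup G) : ℕ :=
  if IsCyclic H then (Nat.card H).totient else 0

/-- The number of elements of a subgroup that do not generate it. -/
noncomputable def numNongenerators {G : Type*} [Group G] (H : Subgroup G) : ℕ :=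
  Nat.card H - H.numGenerators

variable {G : Type*} [Group G]

theorem numGenerators_add_numNongenerators (H : Subgroup G) :
    H.numGenerators + H.numNongenerators = Nat.card H := by
  have : H.numGenerators ≤ Nat.card H := by
    unfold numGenerators
    split_ifs
    · exact Nat.totient_le _
    · exact Nat.zero_le _
  unfold numNongenerators
  omega

theorem numNongenerators_of_not_isCyclic {H : Subgroup G} (h : ¬IsCyclic H) :
    H.numNongenerators = Nat.card H := by
  simp [numNongenerators, numGenerators, h]

theorem numGenerators_of_not_isCyclic {H : Subgroup G} (h : ¬IsCyclic H) :
    H.numGenerators = 0 := by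
  simp [numGenerators, h]

theorem numGenerators_of_isCyclic {H : Subgroup G} (h : IsCyclic H) :
    H.numGenerators = (Nat.card H).totient := by
  simp [numGenerators, h]

theorem numNongenerators_of_isCyclic {H : Subgroup G} (h : IsCyclic H) :
    H.numNongenerators = Nat.card H - (Nat.card H).totient := by
  simp [numNongenerators, numGenerators, h]

theorem zpowers_eq_iff_mem_and_orderOf [Finite G] {K : Subgroup G} {g : G} :
    zpowers g = K ↔ g ∈ K ∧ orderOf g = Nat.card K := by
  constructor
  · rintro rfl
    exact ⟨mem_zpowers g, (Nat.card_zpowers g).symm⟩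
  · rintro ⟨h1, h2⟩
    exact eq_of_le_of_card_ge (zpowers_le.2 h1) (by rw [Nat.card_zpowers, h2])

open scoped Classical in
theorem card_filter_zpowers_eq [Fintype G] (K : Subgroup G) :
    (Finset.univ.filter fun g : G => zpowers g = K).card = K.numGenerators := by
  by_cases hK : IsCyclic K
  · rw [numGenerators_of_isCyclic hK]
    have := IsCyclic.card_orderOf_eq_totient (α := K) (d := Nat.card K)
      (by rw [Nat.card_eq_fintype_card])
    rw [← this]
    symm
    refine Finset.card_bij (fun x _ => (x : G)) ?_ ?_ ?_
    · intro a ha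
      simp only [Finset.mem_filter, Finset.mem_univ, true_and] at ha ⊢
      exact zpowers_eq_iff_mem_and_orderOf.2 ⟨a.2, by rw [← ha, orderOf_coe]⟩
    · intro a _ b _ hab
      exact Subtype.ext hab
    · intro b hb
      simp only [Finset.mem_filter, Finset.mem_univ, true_and] at hb
      obtain ⟨h1, h2⟩ := zpowers_eq_iff_mem_and_orderOf.1 hb
      refine ⟨⟨b, h1⟩, ?_, rfl⟩
      simp only [Finset.mem_filter, Finset.mem_univ, true_and]
      rw [← h2, orderOf_mk]
  · rw [numGenerators_of_not_isCyclic hK, Finset.card_eq_zero, Finset.filter_eq_empty_iff]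
    rintro g - rfl
    exact hK inferInstance

open scoped Classical in
theorem sum_numGenerators_le [Finite G] [Fintype (Subgroup G)] (H : Subgroup G) :
    ∑ K with K ≤ H, K.numGenerators = Nat.card H := by
  have := Fintype.ofFinite G
  have h1 : Nat.card H = (Finset.univ.filter fun g : G => g ∈ H).card := by
    rw [Nat.card_eq_fintype_card]
    exact Fintype.card_subtype _
  rw [h1, Finset.card_eq_sum_card_fiberwise (f := fun g => zpowers g)
    (t := Finset.univ.filter fun K => K ≤ H)]
  · refine Finset.sum_congr rfl fun K hK => ?_
    rw [← card_filter_zpowers_eq, Finset.filter_filter]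
    congr 1
    ext g
    simp only [Finset.mem_filter, Finset.mem_univ, true_and] at hK ⊢
    constructor
    · intro h
      exact ⟨hK (h ▸ mem_zpowers g), h⟩
    · exact fun h => h.2
  · intro g hg
    simpa using hg

theorem numGenerators_le_mul [Finite G] {K : Subgroup G} (hK : K ≠ ⊥) {P : ℕ}
    (hP : ∀ q, q.Prime → q ∣ Nat.card K → q ≤ P) :
    K.numGenerators ≤ (P - 1) * K.numNongenerators := by
  by_cases h : IsCyclic K
  · rw [numGenerators_of_isCyclic h, numNongenerators_of_isCyclic h]
    obtain ⟨q, hq, hqK⟩ := Nat.exists_prime_and_dvd (mt card_eq_one.1 hK)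
    refine (Nat.totient_le_mul_sub_totient hq hqK).trans ?_
    gcongr
    exact hP q hq hqK
  · simp [numGenerators_of_not_isCyclic h]

theorem numNongenerators_pos [Finite G] {K : Subgroup G} (hK : K ≠ ⊥) :
    0 < K.numNongenerators := by
  have h1 := K.one_lt_card_iff_ne_bot.2 hK
  by_cases h : IsCyclic K
  · rw [numNongenerators_of_isCyclic h]
    have := Nat.totient_lt _ h1
    omega
  · rw [numNongenerators_of_not_isCyclic h]
    omega

end Subgroup

section

open Subgroup

open scoped Classical in
theorem sum_card_subgroup_of_sigma1_eq {G : Type*} [Group G] [Finite G] [Fintype (Subgroup G)]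
    (h : sigma1 G = 2 + 11 / (Nat.card G : ℚ)) :
    ∑ H : Subgroup G, Nat.card H = 2 * Nat.card G + 11 := by
  have h0 : (Nat.card G : ℚ) ≠ 0 := by exact_mod_cast Nat.card_pos.ne'
  unfold sigma1 at h
  rw [finsum_eq_sum_of_fintype] at h
  field_simp at h
  rw [mul_comm] at h
  exact_mod_cast h

open scoped Classical in
theorem sum_numNongenerators_eq {G : Type*} [Group G] [Finite G] [Fintype (Subgroup G)]
    (hnc : ¬IsCyclic G) (h : ∑ H : Subgroup G, Nat.card H = 2 * Nat.card G + 11) :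
    ∑ H : Subgroup G with H ≠ ⊤, H.numNongenerators = 11 := by
  have h1 := sum_numGenerators_le (⊤ : Subgroup G)
  simp only [le_top, Finset.filter_true, Subgroup.card_top] at h1
  simp_rw [← numGenerators_add_numNongenerators, Finset.sum_add_distrib, h1] at h
  have hT : ¬IsCyclic (⊤ : Subgroup G) := mt topEquiv.isCyclic.1 hnc
  rw [← Finset.add_sum_erase _ _ (Finset.mem_univ (⊤ : Subgroup G)),
    numNongenerators_of_not_isCyclic hT, Subgroup.card_top] at h
  have : (Finset.univ.filter fun H : Subgroup G => H ≠ ⊤) = Finset.univ.erase ⊤ := by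
    ext; simp
  rw [this]
  omega

open scoped Classical in
theorem card_le_of_not_isCyclic {G : Type*} [Group G] [Finite G] [Fintype (Subgroup G)]
    {H : Subgroup G} (hH : ¬IsCyclic H) {P : ℕ}
    (hP : ∀ q, q.Prime → q ∣ Nat.card H → q ≤ P) :
    ∃ T, ∑ K : Subgroup G with K ≤ H, K.numNongenerators = Nat.card H + T ∧
      Nat.card H ≤ (P - 1) * T + 1 := by
  have hb : (⊥ : Subgroup G) ≠ H := by
    rintro rfl
    exact hH inferInstance
  have hbc : IsCyclic (⊥ : Subgroup G) := inferInstance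
  set S : Finset (Subgroup G) := Finset.univ.filter fun K => K ≤ H with hS
  have hHS : H ∈ S := by simp [hS]
  have hbS : ⊥ ∈ S.erase H := by simp [hS, hb]
  refine ⟨∑ K ∈ S.erase H, K.numNongenerators, ?_, ?_⟩
  · rw [← Finset.add_sum_erase _ _ hHS, numNongenerators_of_not_isCyclic hH]
  · have h1 := sum_numGenerators_le H
    rw [← hS, ← Finset.add_sum_erase _ _ hHS, ← Finset.add_sum_erase _ _ hbS,
      numGenerators_of_not_isCyclic hH, numGenerators_of_isCyclic hbc] at h1
    simp only [card_bot, Nat.totient_one] at h1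
    rw [← Finset.add_sum_erase _ _ hbS, ← h1, numNongenerators_of_isCyclic hbc]
    simp only [card_bot, Nat.totient_one, Nat.sub_self, zero_add]
    rw [add_comm, Finset.mul_sum]
    gcongr with K hK
    simp only [hS, Finset.mem_erase, Finset.mem_filter, Finset.mem_univ, true_and] at hK
    exact numGenerators_le_mul hK.1 fun q hq hqK => hP q hq (hqK.trans (card_dvd_of_le hK.2.2))

open scoped Classical in
theorem card_eq_four_or_six {G : Type*} [Group G] [Finite G] [Fintype (Subgroup G)]
    {H : Subgroup G} (hH : ¬IsCyclic H)
    (h : ∑ K : Subgroup G with K ≤ H, K.numNongenerators ≤ 11) :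
    (Nat.card H = 4 ∧ 7 ≤ ∑ K : Subgroup G with K ≤ H, K.numNongenerators) ∨
      (Nat.card H = 6 ∧ 9 ≤ ∑ K : Subgroup G with K ≤ H, K.numNongenerators) := by
  have hle : Nat.card H ≤ 11 := by
    obtain ⟨T, hT, -⟩ := card_le_of_not_isCyclic hH (P := Nat.card H)
      (fun q _ hq => Nat.le_of_dvd Nat.card_pos hq)
    omega
  have hnp : ¬(Nat.card H).Prime := fun hp => by
    have := Fact.mk hp
    exact hH (isCyclic_of_prime_card rfl)
  have h1 : Nat.card H ≠ 1 := fun h1 => hH (by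
    rw [card_eq_one.1 h1]; infer_instance)
  have h0 : Nat.card H ≠ 0 := Nat.card_pos.ne'
  have key : ∀ P, (∀ q, q.Prime → q ∣ Nat.card H → q ≤ P) →
    ∃ T, ∑ K : Subgroup G with K ≤ H, K.numNongenerators = Nat.card H + T ∧
      Nat.card H ≤ (P - 1) * T + 1 := fun P hP => card_le_of_not_isCyclic hH hP
  have hq : ∀ q n, q.Prime → q ∣ n → n ∈ [4, 6, 8, 9, 10] →
      q ≤ if n = 4 ∨ n = 8 then 2 else if n = 10 then 5 else 3 := by
    intro q n hq hqn hn
    have hle : q ≤ 10 := by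
      refine (Nat.le_of_dvd ?_ hqn).trans ?_ <;> simp at hn <;> omega
    simp only [List.mem_cons, List.not_mem_nil, or_false] at hn
    rcases hn with rfl | rfl | rfl | rfl | rfl <;> interval_cases q <;> revert hq hqn <;> decide
  generalize (∑ K : Subgroup G with K ≤ H, K.numNongenerators) = S at *
  generalize Nat.card H = n at *
  have hn : n ∈ [4, 6, 8, 9, 10] := by
    interval_cases n <;> first | (exact absurd rfl h0) | (exact absurd rfl h1) | decide |
      (exact absurd (by norm_num) hnp)
  obtain ⟨T, hT, hT'⟩ := key _ (fun q h1 h2 => hq q n h1 h2 hn)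
  simp only [List.mem_cons, List.not_mem_nil, or_false] at hn
  rcases hn with rfl | rfl | rfl | rfl | rfl <;> simp at hT' <;> omega

theorem exists_prime_dvd_and_forall_le {n : ℕ} (hn : 1 < n) :
    ∃ P, P.Prime ∧ P ∣ n ∧ ∀ q, q.Prime → q ∣ n → q ≤ P := by
  have hne : n.primeFactors.Nonempty := Nat.nonempty_primeFactors.2 hn
  obtain ⟨P, hP, hmax⟩ := n.primeFactors.exists_max_image id hne
  rw [Nat.mem_primeFactors] at hP
  exact ⟨P, hP.1, hP.2.1, fun q hq hqn => hmax q (Nat.mem_primeFactors.2 ⟨hq, hqn, hP.2.2⟩)⟩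

open scoped Classical in
theorem structure_of_not_isCyclic_subgroup {G : Type*} [Group G] [Finite G] [Fintype (Subgroup G)]
    (hnc : ¬IsCyclic G) (h : ∑ H : Subgroup G with H ≠ ⊤, H.numNongenerators = 11)
    {H : Subgroup G} (hH : ¬IsCyclic H) (hHT : H ≠ ⊤) :
    Nat.card H = 4 ∧ ∃ P, P.Prime ∧ Nat.card G = 4 * P ∧
      ∑ K : Subgroup G with K ≠ ⊤ ∧ ¬K ≤ H, K.numNongenerators = 4 ∧
      ∀ K : Subgroup G, K ≠ ⊤ → ¬K ≤ H →
        K.numGenerators = (P - 1) * K.numNongenerators := by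
  have hnT : ¬IsCyclic (⊤ : Subgroup G) := mt topEquiv.isCyclic.1 hnc
  set O : Finset (Subgroup G) := Finset.univ.filter fun K => K ≠ ⊤ ∧ ¬K ≤ H with hO
  have hW : ∑ K : Subgroup G with K ≤ H, K.numNongenerators + ∑ K ∈ O, K.numNongenerators = 11 := by
    rw [← h, ← Finset.sum_filter_add_sum_filter_not (Finset.univ.filter fun K : Subgroup G => K ≠ ⊤)
      (fun K => K ≤ H), Finset.filter_filter, Finset.filter_filter]
    congr 2
    ext K
    simp only [Finset.mem_filter, Finset.mem_univ, true_and]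
    refine ⟨fun hK => ⟨?_, hK⟩, And.right⟩
    rintro rfl
    exact hHT (top_le_iff.1 hK)
  have hG : Nat.card H + ∑ K ∈ O, K.numGenerators = Nat.card G := by
    have h1 := sum_numGenerators_le (⊤ : Subgroup G)
    simp only [le_top, Finset.filter_true, Subgroup.card_top] at h1
    rw [← h1, ← sum_numGenerators_le H, ← Finset.sum_filter_add_sum_filter_not Finset.univ
      (fun K => K ≤ H)]
    congr 1
    refine Finset.sum_subset (fun K hK => ?_) fun K hK hK' => ?_
    · simp only [hO, Finset.mem_filter, Finset.mem_univ, true_and] at hK ⊢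
      exact hK.2
    · simp only [hO, Finset.mem_filter, Finset.mem_univ, true_and] at hK hK'
      have : K = ⊤ := by tauto
      rw [this, numGenerators_of_not_isCyclic hnT]
  have hlt : Nat.card H < Nat.card G := by
    refine lt_of_le_of_ne H.card_le_card_group ?_
    exact fun h => hHT ((card_eq_iff_eq_top H).1 h)
  have hdvd := H.card_subgroup_dvd_card
  obtain ⟨P, hPp, hPG, hPmax⟩ := exists_prime_dvd_and_forall_le
    (lt_of_le_of_lt Nat.card_pos hlt)
  have hpt : ∀ K ∈ O, K.numGenerators ≤ (P - 1) * K.numNongenerators := by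
    intro K hK
    simp only [hO, Finset.mem_filter, Finset.mem_univ, true_and] at hK
    refine numGenerators_le_mul (by rintro rfl; exact hK.2 bot_le) fun q hq hqK =>
      hPmax q hq (hqK.trans K.card_subgroup_dvd_card)
  have hsum := Finset.sum_le_sum hpt
  rw [← Finset.mul_sum] at hsum
  have h46 := card_eq_four_or_six hH (by omega)
  have hP2 := hPp.two_le
  rcases h46 with ⟨h4, h7⟩ | ⟨h6, h9⟩
  · refine ⟨h4, P, hPp, ?_⟩
    have hr : ∑ K ∈ O, K.numNongenerators ≤ 4 := by omega
    have h4P : 4 * P ≤ Nat.card G := by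
      rw [h4] at hdvd hlt
      rcases hPp.eq_two_or_odd' with rfl | hodd
      · omega
      · have : Nat.Coprime 4 P := Nat.Coprime.pow_left 2 (Nat.coprime_two_left.2 hodd)
        exact Nat.le_of_dvd Nat.card_pos (this.mul_dvd_of_dvd_of_dvd hdvd hPG)
    generalize hr' : ∑ K ∈ O, K.numNongenerators = r at *
    have hr4 : r = 4 := by
      by_contra hne
      have h3 : r ≤ 3 := by omega
      have := Nat.mul_le_mul_left (P - 1) h3
      omega
    subst hr4
    refine ⟨by omega, rfl, fun K hK1 hK2 => ?_⟩
    refine (Finset.sum_eq_sum_iff_of_le hpt).1 ?_ K (by simp [hO, hK1, hK2])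
    rw [← Finset.mul_sum, hr']
    omega
  · exfalso
    have hr : ∑ K ∈ O, K.numNongenerators ≤ 2 := by omega
    have := Nat.mul_le_mul_left (P - 1) hr
    rw [h6] at hdvd hlt hG
    have h3P : 3 ≤ P := hPmax 3 Nat.prime_three (dvd_trans (by decide) hdvd)
    rcases (show P = 3 ∨ P = 4 ∨ 5 ≤ P by omega) with rfl | rfl | h5
    · omega
    · revert hPp; decide
    · have hc : Nat.Coprime 6 P := by
        have h2 : Nat.Coprime 2 P := (Nat.coprime_primes Nat.prime_two hPp).2 (by omega)
        have h3 : Nat.Coprime 3 P := (Nat.coprime_primes Nat.prime_three hPp).2 (by omega)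
        exact Nat.Coprime.mul_left h2 h3
      have := Nat.le_of_dvd Nat.card_pos (hc.mul_dvd_of_dvd_of_dvd hdvd hPG)
      omega

theorem Subgroup.nonempty_prod_mulEquiv_of_commute {G : Type*} [Group G] [Finite G]
    {A B : Subgroup G} (hcomm : ∀ a ∈ A, ∀ b ∈ B, Commute a b) (hd : Disjoint A B)
    (hcard : Nat.card A * Nat.card B = Nat.card G) : Nonempty (A × B ≃* G) := by
  let f := A.subtype.noncommCoprod B.subtype fun a b => hcomm a a.2 b b.2
  have hf : Function.Injective f := by
    refine (MonoidHom.noncommCoprod_injective _ _ _).2 ?_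
    exact ⟨A.subtype_injective, B.subtype_injective, by simpa using hd⟩
  have hb : Function.Bijective f := by
    rw [Nat.bijective_iff_injective_and_card, Nat.card_prod]
    exact ⟨hf, hcard⟩
  exact ⟨MulEquiv.ofBijective f hb⟩

/-- Two distinct commuting involutions generate a noncyclic group of order four. -/
theorem exists_not_isCyclic_of_commute_involutions {G : Type*} [Group G] {a b : G}
    (hab : Commute a b) (ha2 : a * a = 1) (hb2 : b * b = 1) (ha : a ≠ 1) (hb : b ≠ 1)
    (hne : a ≠ b) : ∃ K : Subgroup G, a ∈ K ∧ b ∈ K ∧ ¬IsCyclic K ∧ Nat.card K ≤ 4 := by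
  classical
  have hba : b * a = a * b := hab.eq.symm
  have h1 : a * (a * b) = b := by rw [← mul_assoc, ha2, one_mul]
  have h2 : b * (a * b) = a := by rw [hab.eq, ← mul_assoc, hb2, one_mul]
  have h3 : a * b * a = b := by rw [mul_assoc, hba, h1]
  have h4 : a * b * b = a := by rw [mul_assoc, hb2, mul_one]
  have h5 : a * b * (a * b) = 1 := by rw [mul_assoc, h2, ha2]
  let K : Subgroup G :=
    { carrier := (({1, a, b, a * b} : Finset G) : Set G)
      mul_mem' := by
        intro x y hx hy
        simp only [Finset.coe_insert, Finset.coe_singleton, Set.mem_insert_iff,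
          Set.mem_singleton_iff] at hx hy ⊢
        rcases hx with rfl | rfl | rfl | rfl <;> rcases hy with rfl | rfl | rfl | rfl <;>
          simp [ha2, hb2, hba, h1, h2, h3, h4, h5]
      one_mem' := by simp
      inv_mem' := by
        intro x hx
        simp only [Finset.coe_insert, Finset.coe_singleton, Set.mem_insert_iff,
          Set.mem_singleton_iff] at hx ⊢
        rcases hx with rfl | rfl | rfl | rfl
        · simp
        · simp [inv_eq_of_mul_eq_one_left ha2]
        · simp [inv_eq_of_mul_eq_one_left hb2]
        · rw [inv_eq_of_mul_eq_one_left h5]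
          simp }
  have hKc : (K : Set G) = (({1, a, b, a * b} : Finset G) : Set G) := rfl
  have haK : a ∈ K := by rw [← SetLike.mem_coe, hKc]; simp
  have hbK : b ∈ K := by rw [← SetLike.mem_coe, hKc]; simp
  have hcard : Nat.card K ≤ 4 := by
    have : Nat.card K = ({1, a, b, a * b} : Finset G).card := by
      rw [← SetLike.coe_sort_coe, hKc, Nat.card_coe_set_eq, Set.ncard_coe_finset]
    rw [this]
    exact Finset.card_le_four
  have hfin : Finite K := Set.Finite.to_subtype (s := (K : Set G)) (by
    rw [hKc]
    exact Finset.finite_toSet _)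
  refine ⟨K, haK, hbK, fun hc => ?_, hcard⟩
  have := Fintype.ofFinite K
  have h6 := IsCyclic.card_pow_eq_one_le (α := K) (n := 2) (by norm_num)
  have h7 : ({1, ⟨a, haK⟩, ⟨b, hbK⟩} : Finset K) ⊆ Finset.univ.filter fun x : K => x ^ 2 = 1 := by
    intro x hx
    simp only [Finset.mem_insert, Finset.mem_singleton] at hx
    simp only [Finset.mem_filter, Finset.mem_univ, true_and]
    rcases hx with rfl | rfl | rfl
    · simp
    · exact Subtype.ext (by simpa [pow_two] using ha2)
    · exact Subtype.ext (by simpa [pow_two] using hb2)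
  have h8 := Finset.card_le_card h7
  have h9 : ({1, ⟨a, haK⟩, ⟨b, hbK⟩} : Finset K).card = 3 := by
    refine Finset.card_eq_three.2 ⟨1, ⟨a, haK⟩, ⟨b, hbK⟩, ?_, ?_, ?_, rfl⟩
    · exact fun h => ha (congrArg Subtype.val h).symm
    · exact fun h => hb (congrArg Subtype.val h).symm
    · exact fun h => hne (congrArg Subtype.val h)
  omega

theorem mul_self_eq_one_of_card_four {G : Type*} [Group G] [Finite G] {H : Subgroup G}
    (hH : ¬IsCyclic H) (h4 : Nat.card H = 4) {x : G} (hx : x ∈ H) : x * x = 1 := by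
  have h1 : orderOf x ∣ 2 ^ 2 := by
    have := H.orderOf_dvd_natCard hx
    rwa [h4] at this
  obtain ⟨k, hk, hk'⟩ := (Nat.dvd_prime_pow Nat.prime_two).1 h1
  have h2 : k ≠ 2 := by
    rintro rfl
    apply hH
    rw [← zpowers_eq_iff_mem_and_orderOf.2 ⟨hx, hk'.trans h4.symm⟩]
    infer_instance
  rw [← pow_two, ← orderOf_dvd_iff_pow_eq_one, hk']
  interval_cases k
  · norm_num
  · norm_num
  · exact absurd rfl h2

theorem mem_of_mul_self_eq_one {G : Type*} [Group G] [Finite G] (h8 : Nat.card G = 8)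
    {H : Subgroup G} (hH : ¬IsCyclic H) (h4 : Nat.card H = 4)
    (hO : ∀ K : Subgroup G, K ≠ ⊤ → ¬K ≤ H → IsCyclic K) {t : G} (ht2 : t * t = 1) : t ∈ H := by
  by_cases ht : t = 1
  · exact ht ▸ one_mem H
  have key : ∀ z, Commute z t → z * z = 1 → z ≠ 1 → z ≠ t → t ∈ H := by
    intro z hzt hz2 hz1 hne
    obtain ⟨K, -, htK, hKc, hK4⟩ :=
      exists_not_isCyclic_of_commute_involutions hzt hz2 ht2 hz1 ht hne
    by_contra htH
    refine hKc (hO K ?_ fun hle => htH (hle htK))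
    rintro rfl
    rw [Subgroup.card_top] at hK4
    omega
  have := Fact.mk Nat.prime_two
  have hp : IsPGroup 2 G := IsPGroup.of_card (n := 3) h8
  have : Nontrivial G := Finite.one_lt_card_iff_nontrivial.1 (by omega)
  have := hp.center_nontrivial
  obtain ⟨z, hz⟩ := exists_prime_orderOf_dvd_card' (G := center G) 2 (by
    obtain ⟨n, hn, hn'⟩ := (hp.to_subgroup (center G)).nontrivial_iff_card.1 this
    rw [hn']
    exact dvd_pow_self 2 hn.ne')
  have hz1 : (z : G) ≠ 1 := fun h => by
    rw [OneMemClass.coe_eq_one.1 h, orderOf_one] at hz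
    omega
  have hz2 : (z : G) * z = 1 := by
    rw [← pow_two, ← orderOf_dvd_iff_pow_eq_one, orderOf_coe, hz]
  have hzc : ∀ g, Commute (z : G) g := fun g => (mem_center_iff.1 z.2 g).symm
  by_cases hzt : (z : G) = t
  · have hHb : H ≠ ⊥ := by
      rintro rfl
      exact hH inferInstance
    obtain ⟨h, hh, hh1⟩ := H.bot_or_exists_ne_one.resolve_left hHb
    by_cases hht : h = t
    · exact hht ▸ hh
    · exact key h (hzt ▸ (hzc h).symm) (mul_self_eq_one_of_card_four hH h4 hh) hh1 hht
  · exact key z (hzc t) hz2 hz1 hzt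

theorem nonempty_mulEquiv_of_card_eight {G : Type*} [Group G] [Finite G] (h8 : Nat.card G = 8)
    {H : Subgroup G} (hH : ¬IsCyclic H) (h4 : Nat.card H = 4)
    (hO : ∀ K : Subgroup G, K ≠ ⊤ → ¬K ≤ H → IsCyclic K) (hnc : ¬IsCyclic G) :
    Nonempty (G ≃* Multiplicative (ZMod 2) × Multiplicative (ZMod 4)) := by
  have hmem : ∀ {t : G}, t * t = 1 → t ∈ H := mem_of_mul_self_eq_one h8 hH h4 hO
  obtain ⟨x, hx⟩ : ∃ x, x ∉ H := by
    by_contra! hall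
    have : H = ⊤ := eq_top_iff.2 fun g _ => hall g
    rw [this, Subgroup.card_top] at h4
    omega
  have hx4 : orderOf x = 4 := by
    have h1 : orderOf x ∣ 2 ^ 3 := by
      have := orderOf_dvd_natCard x
      rwa [h8] at this
    obtain ⟨k, hk, hk'⟩ := (Nat.dvd_prime_pow Nat.prime_two).1 h1
    interval_cases k
    · exact absurd (orderOf_eq_one_iff.1 hk') fun h => hx (h ▸ one_mem H)
    · exact absurd (hmem (by rw [← pow_two, ← pow_one 2, ← hk', pow_orderOf_eq_one])) hx
    · exact hk'
    · exact absurd (isCyclic_of_orderOf_eq_card x (by rw [hk', h8]; norm_num)) hnc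
  have hzc : Nat.card (zpowers x) = 4 := by rw [Nat.card_zpowers, hx4]
  obtain ⟨h, hhH, hhx⟩ : ∃ h ∈ H, h ∉ zpowers x := by
    by_contra! hall
    have : H = zpowers x := eq_of_le_of_card_ge hall (by omega)
    exact hx (this ▸ mem_zpowers x)
  have hh2 : h * h = 1 := mul_self_eq_one_of_card_four hH h4 hhH
  have hho : orderOf h = 2 := orderOf_eq_prime (by rw [pow_two, hh2]) fun h1 => hhx (h1 ▸ one_mem _)
  have hnorm : (zpowers x).Normal := normal_of_index_eq_two (by
    have := (zpowers x).card_mul_index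
    rw [hzc, h8] at this
    omega)
  have hcomm : Commute h x := by
    have hmemx := hnorm.conj_mem x (mem_zpowers x) h
    obtain ⟨k, hk⟩ := mem_zpowers_iff.1 hmemx
    have hcx : h * x * h⁻¹ ∉ H := fun hm => hx (by
      simpa [mul_assoc] using H.mul_mem (H.mul_mem (H.inv_mem hhH) hm) hhH)
    have hx4' : x ^ (4 : ℤ) = 1 := by
      rw [← pow_orderOf_eq_one x, hx4]
      exact zpow_natCast x 4
    rw [← zpow_mod_orderOf, hx4] at hk
    have hr : k % (4 : ℕ) = 0 ∨ k % (4 : ℕ) = 1 ∨ k % (4 : ℕ) = 2 ∨ k % (4 : ℕ) = 3 := by omega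
    rcases hr with hr | hr | hr | hr <;> rw [hr] at hk
    · exact absurd (by rw [← hk, zpow_zero]; exact one_mem H) hcx
    · rw [zpow_one] at hk
      exact (eq_mul_inv_iff_mul_eq.1 hk).symm
    · exact absurd (hmem (by rw [← hk, ← zpow_add]; exact hx4')) hcx
    · have hxh : h * x * (h * x) = 1 := by
        have : h = h⁻¹ := eq_inv_of_mul_eq_one_left hh2
        rw [← mul_assoc]
        nth_rewrite 2 [this]
        rw [← hk, ← zpow_add_one]
        exact hx4'
      exact absurd ((H.mul_mem_cancel_left hhH).1 (hmem hxh)) hx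
  have hAB : ∀ a ∈ zpowers h, ∀ b ∈ zpowers x, Commute a b := by
    rintro _ ⟨i, rfl⟩ _ ⟨j, rfl⟩
    exact (hcomm.zpow_left i).zpow_right j
  have hdis : Disjoint (zpowers h) (zpowers x) := by
    rw [disjoint_iff, ← card_eq_one]
    have h1 := card_dvd_of_le (inf_le_left : zpowers h ⊓ zpowers x ≤ zpowers h)
    rw [Nat.card_zpowers, hho] at h1
    rcases (Nat.dvd_prime Nat.prime_two).1 h1 with h1 | h1
    · exact h1
    · have := eq_of_le_of_card_ge (inf_le_left : zpowers h ⊓ zpowers x ≤ zpowers h)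
        (by rw [h1, Nat.card_zpowers, hho])
      exact absurd (inf_eq_left.1 this (mem_zpowers h)) hhx
  obtain ⟨e⟩ := nonempty_prod_mulEquiv_of_commute (A := zpowers h) (B := zpowers x) hAB hdis
    (by rw [Nat.card_zpowers, hho, hzc, h8])
  have hc2 : Nat.card (zpowers h) = Nat.card (Multiplicative (ZMod 2)) := by
    rw [Nat.card_zpowers, hho]; simp
  have hc4 : Nat.card (zpowers x) = Nat.card (Multiplicative (ZMod 4)) := by
    rw [hzc]; simp
  exact ⟨e.symm.trans (MulEquiv.prodCongr (mulEquivOfCyclicCardEq hc2)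
    (mulEquivOfCyclicCardEq hc4))⟩

theorem Sylow.eq_of_le_normalizer {G : Type*} [Group G] {p : ℕ} {Q R : Sylow p G}
    (h : (Q : Subgroup G) ≤ normalizer (R : Set G)) : Q = R := by
  have h1 := Q.2.inf_normalizer_sylow R
  have h2 : (Q : Subgroup G) ≤ R := by
    rw [← inf_eq_left, ← h1]
    exact inf_eq_left.2 h
  exact Sylow.ext (Q.3 R.2 h2).symm

theorem nonempty_mulEquiv_alternatingGroup {G : Type*} [Group G] [Finite G]
    (h12 : Nat.card G = 12) (hS : Nat.card (Sylow 3 G) = 4) :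
    Nonempty (G ≃* alternatingGroup (Fin 4)) := by
  have := Fact.mk Nat.prime_three
  have hN : ∀ Q : Sylow 3 G, normalizer (Q : Set G) = Q := by
    intro Q
    have h1 := Q.card_eq_index_normalizer
    have h2 := (normalizer (Q : Set G)).card_mul_index
    rw [← h1, hS, h12] at h2
    have h3 := Q.dvd_card_of_dvd_card (p := 3) (by rw [h12]; norm_num)
    have h4 := Nat.le_of_dvd Nat.card_pos h3
    exact (eq_of_le_of_card_ge (K := normalizer (Q : Set G)) le_normalizer (by omega)).symm
  have hQ3 : ∀ Q : Sylow 3 G, Nat.card Q = 3 := by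
    intro Q
    have h1 := Q.card_eq_index_normalizer
    have h2 := (normalizer (Q : Set G)).card_mul_index
    rw [← h1, hS, h12, hN] at h2
    omega
  have hker : ∀ Q : Sylow 3 G, (MulAction.toPermHom G (Sylow 3 G)).ker ≤ Q := by
    intro Q g hg
    rw [← hN Q, ← Sylow.smul_eq_iff_mem_normalizer]
    exact congrArg (fun f => f Q) hg
  have hinj : Function.Injective (MulAction.toPermHom G (Sylow 3 G)) := by
    rw [← MonoidHom.ker_eq_bot_iff]
    by_contra hne
    have heq : ∀ Q : Sylow 3 G, (MulAction.toPermHom G (Sylow 3 G)).ker = Q := by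
      intro Q
      have h1 := card_dvd_of_le (hker Q)
      rw [hQ3 Q] at h1
      have h2 := ((Nat.dvd_prime Nat.prime_three).1 h1).resolve_left (mt card_eq_one.1 hne)
      exact eq_of_le_of_card_ge (hker Q) (by rw [h2, hQ3 Q])
    have : Nontrivial (Sylow 3 G) := Finite.one_lt_card_iff_nontrivial.1 (by omega)
    obtain ⟨Q, R, hQR⟩ := exists_pair_ne (Sylow 3 G)
    exact hQR (Sylow.ext ((heq Q).symm.trans (heq R)))
  obtain ⟨e⟩ : Nonempty (Sylow 3 G ≃ Fin 4) := ⟨Finite.equivFinOfCardEq hS⟩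
  let f : G →* Equiv.Perm (Fin 4) :=
    e.permCongrHom.toMonoidHom.comp (MulAction.toPermHom G (Sylow 3 G))
  have hf : Function.Injective f := e.permCongrHom.injective.comp hinj
  have hr : f.range = alternatingGroup (Fin 4) := by
    apply Equiv.Perm.eq_alternatingGroup_of_index_eq_two
    have h1 := f.range.card_mul_index
    rw [← Nat.card_congr (MonoidHom.ofInjective hf).toEquiv, h12, Nat.card_eq_fintype_card,
      Fintype.card_perm, Fintype.card_fin] at h1
    have : Nat.factorial 4 = 24 := rfl
    omega
  exact ⟨(MonoidHom.ofInjective hf).trans (MulEquiv.subgroupCongr hr)⟩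

open scoped Classical in
theorem card_eq_and_card_sylow_eq {G : Type*} [Group G] [Finite G] [Fintype (Subgroup G)]
    {H : Subgroup G} (h4 : Nat.card H = 4) {P : ℕ} (hP : P.Prime) (hP2 : P ≠ 2)
    (hG : Nat.card G = 4 * P)
    (hsum : ∑ K : Subgroup G with K ≠ ⊤ ∧ ¬K ≤ H, K.numNongenerators = 4)
    (hO : ∀ K : Subgroup G, K ≠ ⊤ → ¬K ≤ H →
      IsCyclic K ∧ K.numGenerators = (P - 1) * K.numNongenerators) :
    Nat.card G = 12 ∧ Nat.card (Sylow 3 G) = 4 := by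
  have := Fact.mk hP
  have hP3 : 3 ≤ P := by have := hP.two_le; omega
  have hP4 : ¬P ∣ 4 := fun h => hP2 ((Nat.prime_dvd_prime_iff_eq hP Nat.prime_two).1
    (hP.dvd_of_dvd_pow (show P ∣ 2 ^ 2 from h)))
  have hcard : ∀ K : Subgroup G, K ≠ ⊤ → ¬K ≤ H → Nat.card K = P := by
    intro K hKT hKH
    obtain ⟨hc, hg⟩ := hO K hKT hKH
    have hKb : K ≠ ⊥ := by
      rintro rfl
      exact hKH bot_le
    have hw := numNongenerators_pos hKb
    have h1 : Nat.card K ≠ 1 := mt card_eq_one.1 hKb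
    have hq := Nat.minFac_prime h1
    have h2 := Nat.totient_le_mul_sub_totient hq (Nat.minFac_dvd (Nat.card K))
    rw [← numNongenerators_of_isCyclic hc, ← numGenerators_of_isCyclic hc, hg] at h2
    have h3 := Nat.le_of_mul_le_mul_right h2 hw
    have hodd : ¬2 ∣ Nat.card K := fun h => by
      have := Nat.minFac_le_of_dvd le_rfl h
      omega
    have h5 : Nat.Coprime (Nat.card K) 4 :=
      Nat.Coprime.pow_right 2 ((Nat.prime_two.coprime_iff_not_dvd.2 hodd).symm)
    have h6 : Nat.card K ∣ P := h5.dvd_of_dvd_mul_left (hG ▸ K.card_subgroup_dvd_card)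
    exact ((Nat.dvd_prime hP).1 h6).resolve_left h1
  have hw1 : ∀ K : Subgroup G, K ≠ ⊤ → ¬K ≤ H → K.numNongenerators = 1 := by
    intro K hKT hKH
    rw [numNongenerators_of_isCyclic (hO K hKT hKH).1, hcard K hKT hKH, Nat.totient_prime hP]
    omega
  set O : Finset (Subgroup G) := Finset.univ.filter fun K => K ≠ ⊤ ∧ ¬K ≤ H with hOdef
  have hO4 : O.card = 4 := by
    rw [← hsum, Finset.card_eq_sum_ones]
    refine Finset.sum_congr rfl fun K hK => ?_
    simp only [hOdef, Finset.mem_filter, Finset.mem_univ, true_and] at hK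
    exact (hw1 K hK.1 hK.2).symm
  have hSO : ∀ Q : Sylow P G, (Q : Subgroup G) ∈ O := by
    intro Q
    have h1 := Q.dvd_card_of_dvd_card (p := P) (by rw [hG]; exact dvd_mul_left _ _)
    simp only [hOdef, Finset.mem_filter, Finset.mem_univ, true_and]
    refine ⟨fun h => ?_, fun h => hP4 (h4 ▸ h1.trans (card_dvd_of_le h))⟩
    obtain ⟨k, hk⟩ := Q.2.exists_card_eq
    rw [h, Subgroup.card_top, hG] at hk
    have h2 : 2 ∣ P ^ k := hk ▸ (Dvd.intro (2 * P) (by ring))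
    exact hP2 ((Nat.prime_dvd_prime_iff_eq Nat.prime_two hP).1
      (Nat.prime_two.dvd_of_dvd_pow h2)).symm
  have hcardS : Nat.card (Sylow P G) = 4 := by
    have := Fintype.ofFinite (Sylow P G)
    rw [Nat.card_eq_fintype_card, ← Finset.card_univ, ← hO4]
    refine Finset.card_bij (fun Q _ => (Q : Subgroup G)) (fun Q _ => hSO Q)
      (fun Q _ R _ h => Sylow.ext h) fun K hK => ?_
    simp only [hOdef, Finset.mem_filter, Finset.mem_univ, true_and] at hK
    have hKc := hcard K hK.1 hK.2
    obtain ⟨Q, hQ⟩ := (IsPGroup.of_card (p := P) (n := 1) (by rw [hKc, pow_one])).exists_le_sylow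
    have h1 := hSO Q
    simp only [hOdef, Finset.mem_filter, Finset.mem_univ, true_and] at h1
    exact ⟨Q, Finset.mem_univ _, (eq_of_le_of_card_ge hQ (by
      rw [hKc]; exact (hcard _ h1.1 h1.2).le)).symm⟩
  have hmod := card_sylow_modEq_one P G
  rw [hcardS] at hmod
  have hP3' : P = 3 := by
    have h1 := (Nat.modEq_iff_dvd' (by norm_num)).1 hmod.symm
    exact (Nat.prime_dvd_prime_iff_eq hP Nat.prime_three).1 h1
  subst hP3'
  exact ⟨hG, hcardS⟩

open scoped Classical in
theorem not_isPGroup_of_isCyclic_of_ne_top {G : Type*} [Group G] [Finite G]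
    [Fintype (Subgroup G)] (hnc : ¬IsCyclic G)
    (h : ∑ H : Subgroup G with H ≠ ⊤, H.numNongenerators = 11)
    (hc : ∀ H : Subgroup G, H ≠ ⊤ → IsCyclic H) {p : ℕ} (hp : p.Prime) : ¬IsPGroup p G := by
  intro hG
  have := Fact.mk hp
  obtain ⟨n, hn⟩ := IsPGroup.iff_card.1 hG
  have hcT : ¬IsCyclic (⊤ : Subgroup G) := fun h => hnc (topEquiv.isCyclic.1 h)
  have hbt : (⊥ : Subgroup G) ≠ ⊤ := by
    intro h
    rw [← h] at hcT
    exact hcT inferInstance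
  have hbg : (⊥ : Subgroup G).numGenerators = 1 := by
    rw [numGenerators_of_isCyclic inferInstance]; simp
  have hbn : (⊥ : Subgroup G).numNongenerators = 0 := by
    rw [numNongenerators_of_isCyclic inferInstance]; simp
  have key : ∀ K : Subgroup G, K ≠ ⊤ →
      K.numGenerators = (if K = ⊥ then 1 else 0) + (p - 1) * K.numNongenerators := by
    intro K hK
    split_ifs with hb
    · simp [hb, hbg, hbn]
    · have hKc := hc K hK
      obtain ⟨k, hk⟩ := IsPGroup.iff_card.1 (hG.to_subgroup K)
      have hk0 : 0 < k := by
        rcases Nat.eq_zero_or_pos k with rfl | h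
        · exact absurd (K.eq_bot_of_card_eq (by simpa using hk)) hb
        · exact h
      rw [numGenerators_of_isCyclic hKc, numNongenerators_of_isCyclic hKc, hk, zero_add]
      exact Nat.totient_prime_pow_eq_mul_sub_totient hp hk0
  have hsum := sum_numGenerators_le (⊤ : Subgroup G)
  have e1 : ∑ K : Subgroup G with K ≤ ⊤, K.numGenerators
      = ∑ K : Subgroup G with K ≠ ⊤, K.numGenerators := by
    symm
    apply Finset.sum_subset
    · intro K; simp
    · intro K _ hK
      have : K = ⊤ := by simpa using hK
      rw [this, numGenerators_of_not_isCyclic hcT]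
  have e2 : ∑ K : Subgroup G with K ≠ ⊤, K.numGenerators = 1 + (p - 1) * 11 := by
    rw [Finset.sum_congr rfl fun K hK => key K (Finset.mem_filter.1 hK).2, Finset.sum_add_distrib,
      ← Finset.mul_sum, h, Finset.sum_ite_eq']
    simp [hbt]
  rw [e1, e2, card_top, hn] at hsum
  obtain ⟨q, rfl⟩ : ∃ q, p = q + 1 := ⟨p - 1, by have := hp.pos; omega⟩
  have hn0 : n ≠ 0 := by
    rintro rfl
    have := hp.two_le
    simp at hsum
    omega
  have hd : (q + 1) ∣ 10 := by
    have h1 : (q + 1) ∣ 1 + (q + 1 - 1) * 11 := hsum ▸ dvd_pow_self _ hn0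
    have h2 : 1 + (q + 1 - 1) * 11 + 10 = (q + 1) * 11 := by simp; ring
    exact (Nat.dvd_add_right h1).1 (h2 ▸ dvd_mul_right _ _)
  have hle := Nat.le_of_dvd (by norm_num) hd
  have hlt : n < 7 := by
    by_contra! h7
    have h1 := Nat.pow_le_pow_left hp.two_le n
    have h2 := Nat.pow_le_pow_right (show 0 < 2 by norm_num) h7
    omega
  have hq9 : q ≠ 9 := by
    rintro rfl
    norm_num at hp
  have hq : q = 1 ∨ q = 4 := by
    have := hp.two_le
    have : q ≤ 9 := by omega
    interval_cases q <;> omega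
  clear * - hsum hlt hq
  rcases hq with rfl | rfl <;> interval_cases n <;> omega

open scoped Classical in
theorem sum_card_ne_normalizer_eq {G : Type*} [Group G] [Finite G] [Fintype (Subgroup G)]
    (h : ∑ H : Subgroup G, Nat.card H = 2 * Nat.card G + 11) {p : ℕ} [Fact p.Prime]
    (hn : Nat.card (Sylow p G) ≠ 1) :
    ∑ K : Subgroup G with K ≠ ⊤ ∧ ∀ Q : Sylow p G, K ≠ normalizer (Q : Set G), Nat.card K = 11 := by
  have := Fintype.ofFinite (Sylow p G)
  let f : Sylow p G → Subgroup G := fun Q => normalizer (Q : Set G)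
  have hf : Function.Injective f := fun Q R hQR =>
    Sylow.eq_of_le_normalizer ((le_normalizer (H := (Q : Subgroup G))).trans_eq hQR)
  have hfT : ∀ Q, f Q ≠ ⊤ := fun Q hQ => by
    have := Q.card_eq_index_normalizer
    exact hn (this.trans (by rw [show normalizer (Q : Set G) = ⊤ from hQ, index_top]))
  have hN : ∑ K ∈ Finset.univ.image f, Nat.card K = Nat.card G := by
    rw [Finset.sum_image fun _ _ _ _ h => hf h]
    obtain ⟨Q₀⟩ : Nonempty (Sylow p G) := inferInstance
    have hc : ∀ Q, Nat.card (f Q) * Nat.card (Sylow p G) = Nat.card G := fun Q => by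
      rw [Q.card_eq_index_normalizer]; exact card_mul_index _
    have hpos : 0 < Nat.card (Sylow p G) := Nat.card_pos
    have hcc : ∀ Q, Nat.card (f Q) = Nat.card (f Q₀) := fun Q =>
      Nat.eq_of_mul_eq_mul_right hpos ((hc Q).trans (hc Q₀).symm)
    simp_rw [hcc]
    rw [Finset.sum_const, Finset.card_univ, ← Nat.card_eq_fintype_card, smul_eq_mul, mul_comm, hc]
  have hT : ⊤ ∉ Finset.univ.image f := by simpa using hfT
  have e : Finset.univ.filter (fun K : Subgroup G => ¬(K ≠ ⊤ ∧ ∀ Q, K ≠ f Q))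
      = insert ⊤ (Finset.univ.image f) := by
    ext K
    simp only [Finset.mem_filter, Finset.mem_univ, true_and, Finset.mem_insert, Finset.mem_image]
    by_cases hK : K = ⊤
    · simp [hK]
    · simp [hK, eq_comm]
  have hs := Finset.sum_filter_add_sum_filter_not Finset.univ
    (fun K : Subgroup G => K ≠ ⊤ ∧ ∀ Q, K ≠ f Q) (fun K => Nat.card K)
  rw [e, Finset.sum_insert hT, hN, card_top, h] at hs
  have h11 : ∑ K : Subgroup G with K ≠ ⊤ ∧ ∀ Q, K ≠ f Q, Nat.card K = 11 := by omega
  convert h11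

theorem Sylow.ne_top_and_ne_normalizer {G : Type*} [Group G] {p : ℕ} (P : Sylow p G)
    [Finite G] [Fact p.Prime] {K : Subgroup G} (hK : ¬Nat.card P ∣ Nat.card K) :
    K ≠ ⊤ ∧ ∀ Q : Sylow p G, K ≠ normalizer (Q : Set G) := by
  constructor
  · rintro rfl
    exact hK (card_dvd_of_le le_top)
  · rintro Q rfl
    apply hK
    rw [P.card_eq_multiplicity, ← Q.card_eq_multiplicity]
    exact card_dvd_of_le (le_normalizer (H := (Q : Subgroup G)))

open scoped Classical in
theorem exists_not_isCyclic_of_ne_top {G : Type*} [Group G] [Finite G]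
    [Fintype (Subgroup G)] (hnc : ¬IsCyclic G)
    (h : ∑ H : Subgroup G, Nat.card H = 2 * Nat.card G + 11) :
    ∃ H : Subgroup G, H ≠ ⊤ ∧ ¬IsCyclic H := by
  by_contra! hc
  have hG1 : Nat.card G ≠ 1 := fun h1 => hnc <| by
    have := (Nat.card_eq_one_iff_unique.1 h1).1
    exact isCyclic_of_subsingleton
  obtain ⟨p, hpG⟩ : ∃ p, (Nat.card G).minFac = p := ⟨_, rfl⟩
  have hp : p.Prime := hpG ▸ Nat.minFac_prime hG1
  have := Fact.mk hp
  have hpd : p ∣ Nat.card G := hpG ▸ Nat.minFac_dvd _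
  have hnp := not_isPGroup_of_isCyclic_of_ne_top hnc (sum_numNongenerators_eq hnc h) hc hp
  obtain ⟨P⟩ : Nonempty (Sylow p G) := inferInstance
  have hPT : (P : Subgroup G) ≠ ⊤ := fun hP => hnp <| by
    have := P.2
    rw [hP] at this
    exact this.of_equiv topEquiv
  have hPc : IsCyclic P := hc _ hPT
  obtain ⟨N, hNn, hNP⟩ : ∃ N : Subgroup G, N.Normal ∧ N.IsComplement' P :=
    ⟨_, MonoidHom.normal_ker _, IsCyclic.isComplement' hpG hPc⟩
  have hmul := hNP.card_mul_card
  obtain ⟨k, hk⟩ : ∃ k, Nat.card P = p ^ k := ⟨_, P.card_eq_multiplicity⟩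
  have hk0 : 0 < k := by
    rcases Nat.eq_zero_or_pos k with rfl | h0
    · have := P.dvd_card_of_dvd_card hpd
      rw [hk] at this
      exact absurd (Nat.dvd_one.1 (by simpa using this)) hp.one_lt.ne'
    · exact h0
  have hidx : N.index = Nat.card P := hNP.symm.index_eq_card
  have hidxP : (P : Subgroup G).index = Nat.card N := hNP.index_eq_card
  have hpm : ¬p ∣ Nat.card N := hidxP ▸ P.not_dvd_index
  have hNT : N ≠ ⊤ := by
    rintro rfl
    rw [card_top] at hpm
    exact hpm hpd
  by_cases hn : Nat.card (Sylow p G) = 1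
  · have := (Nat.card_eq_one_iff_unique.1 hn).1
    have hPn := P.normal_of_subsingleton
    obtain ⟨e⟩ := nonempty_prod_mulEquiv_of_commute
      (fun a ha b hb => commute_of_normal_of_disjoint N P hNn hPn hNP.disjoint a b ha hb)
      hNP.disjoint hmul
    apply hnc
    rw [← e.isCyclic, Group.isCyclic_prod_iff]
    refine ⟨hc N hNT, hPc, ?_⟩
    rw [hk]
    exact Nat.Coprime.pow_right _ ((Nat.Prime.coprime_iff_not_dvd hp).2 hpm).symm
  have hsum := sum_card_ne_normalizer_eq h hn
  have hle : ∀ T : Finset (Subgroup G), (∀ K ∈ T, ¬Nat.card P ∣ Nat.card K) →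
      ∑ K ∈ T, Nat.card K ≤ 11 := fun T hT => hsum ▸ Finset.sum_le_sum_of_subset fun K hK => by
    simpa using P.ne_top_and_ne_normalizer (hT K hK)
  have hnd : Nat.card (Sylow p G) ∣ Nat.card N := hidxP ▸ P.card_dvd_index
  have hm : p + 1 ≤ Nat.card N := by
    refine le_trans ?_ (Nat.le_of_dvd Nat.card_pos hnd)
    have h1 := (card_sylow_modEq_one p G).symm
    have h2 := (Nat.modEq_iff_dvd' Nat.card_pos).1 h1
    have h3 : 0 < Nat.card (Sylow p G) := Nat.card_pos
    have := Nat.le_of_dvd (by omega) h2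
    omega
  have hp2 := hp.two_le
  have hPN : ¬Nat.card P ∣ Nat.card N := fun h => hpm ((dvd_pow_self p hk0.ne').trans (hk ▸ h))
  have hPb : ¬Nat.card P ∣ Nat.card (⊥ : Subgroup G) := fun h =>
    hp.not_dvd_one ((dvd_pow_self p hk0.ne').trans (hk ▸ (by simpa using h)))
  have hcb : Nat.card (⊥ : Subgroup G) = 1 := card_bot
  rcases Nat.lt_or_ge 1 k with hk1 | hk1
  · obtain ⟨A, hA⟩ := Sylow.exists_subgroup_card_pow_prime (G := G) p (n := 1) (by simpa using hpd)
    rw [pow_one] at hA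
    have hQ : Nat.card (G ⧸ N) = p ^ k := by rw [← hk, ← hidx]; rfl
    obtain ⟨B', hB'⟩ := Sylow.exists_subgroup_card_pow_prime (G := G ⧸ N) p (n := 1)
      (by rw [hQ]; exact pow_dvd_pow p hk0)
    rw [pow_one] at hB'
    obtain ⟨B, hB⟩ : ∃ B : Subgroup G, Nat.card B = p * Nat.card N := by
      refine ⟨B'.comap (QuotientGroup.mk' N), ?_⟩
      have h1 := index_comap_of_surjective B' (QuotientGroup.mk'_surjective N)
      have h2 := card_mul_index (B'.comap (QuotientGroup.mk' N))
      have h3 := card_mul_index B'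
      rw [h1, ← hmul, hk, ← hQ, ← h3, hB'] at h2
      have h4 : 0 < B'.index := Nat.pos_of_ne_zero B'.index_ne_zero_of_finite
      apply Nat.eq_of_mul_eq_mul_right h4
      rw [h2]; ring
    have hkp : ¬p ^ k ∣ p := fun h => by
      have := Nat.le_of_dvd hp.pos h
      have := Nat.pow_lt_pow_right hp.one_lt hk1
      rw [pow_one] at this
      omega
    have hPB : ¬Nat.card P ∣ p * Nat.card N := fun h => by
      rw [hk] at h
      have hcop := Nat.Coprime.pow_left k ((Nat.Prime.coprime_iff_not_dvd hp).2 hpm)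
      exact hkp (hcop.dvd_of_dvd_mul_right h)
    have hmm : 2 * Nat.card N ≤ p * Nat.card N := Nat.mul_le_mul_right _ hp2
    have := hle {⊥, A, N, B} (by
      simp only [Finset.mem_insert, Finset.mem_singleton]
      rintro K (rfl | rfl | rfl | rfl)
      · exact hPb
      · rwa [hA, hk]
      · exact hPN
      · rwa [hB])
    rw [Finset.sum_insert, Finset.sum_insert, Finset.sum_insert, Finset.sum_singleton] at this
    · rw [hcb, hA, hB] at this
      omega
    · simp only [Finset.mem_singleton]
      rintro rfl
      omega
    · simp only [Finset.mem_insert, Finset.mem_singleton]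
      rintro (rfl | rfl) <;> omega
    · simp only [Finset.mem_insert, Finset.mem_singleton]
      rintro (rfl | rfl | rfl) <;> omega
  · obtain rfl : k = 1 := by omega
    rw [pow_one] at hk
    have hNb : (⊥ : Subgroup G) ≠ N := by
      rintro rfl
      omega
    have h11 := hle {⊥, N} (by
      simp only [Finset.mem_insert, Finset.mem_singleton]
      rintro K (rfl | rfl)
      · exact hPb
      · exact hPN)
    rw [Finset.sum_insert (by simpa using hNb), Finset.sum_singleton, hcb] at h11
    have hodd : ¬2 ∣ Nat.card N := fun h2 => by
      have h3 : (Nat.card G).minFac ≤ 2 :=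
        Nat.minFac_le_of_dvd le_rfl (h2.trans (card_subgroup_dvd_card N))
      have : p = 2 := by omega
      exact hpm (this ▸ h2)
    have h9 : Nat.card N ≠ 9 := fun h9 => by
      have := Fact.mk Nat.prime_three
      obtain ⟨A, hA⟩ := Sylow.exists_subgroup_card_pow_prime (G := G) 3 (n := 1) (by
        rw [← hmul, h9]; exact Dvd.dvd.mul_right (by norm_num) _)
      have := hle {⊥, A, N} (by
        simp only [Finset.mem_insert, Finset.mem_singleton]
        rintro K (rfl | rfl | rfl)
        · exact hPb
        · rw [hA]
          intro h
          apply hPN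
          rw [h9]
          exact h.trans (by norm_num)
        · exact hPN)
      rw [Finset.sum_insert, Finset.sum_insert, Finset.sum_singleton] at this
      · omega
      · simp only [Finset.mem_singleton]
        rintro rfl
        omega
      · simp only [Finset.mem_insert, Finset.mem_singleton]
        rintro (rfl | rfl) <;> omega
    have hmp : (Nat.card N).Prime := by
      have : Nat.card N = 3 ∨ Nat.card N = 5 ∨ Nat.card N = 7 := by omega
      rcases this with h | h | h <;> rw [h] <;> norm_num
    have hR : (Finset.univ.filter fun K : Subgroup G =>
        K ≠ ⊤ ∧ ∀ Q : Sylow p G, K ≠ normalizer (Q : Set G)) ⊆ {⊥, N} := by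
      intro K hK
      simp only [Finset.mem_filter, Finset.mem_univ, true_and] at hK
      obtain ⟨hKT, hKN⟩ := hK
      simp only [Finset.mem_insert, Finset.mem_singleton]
      have hKd : Nat.card K ∣ Nat.card N * p := hk ▸ hmul ▸ card_subgroup_dvd_card K
      by_cases hpK : p ∣ Nat.card K
      · exfalso
        obtain ⟨c, hc'⟩ := hpK
        rw [hc', mul_comm, Nat.mul_dvd_mul_iff_right hp.pos] at hKd
        rcases (Nat.dvd_prime hmp).1 hKd with rfl | rfl
        · rw [mul_one] at hc'
          have hPK : Nat.card K = p ^ (Nat.card G).factorization p := by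
            rw [← P.card_eq_multiplicity, hk, hc']
          let Q : Sylow p G := Sylow.ofCard K hPK
          have hQ : (Q : Subgroup G) = K := rfl
          apply hKN Q
          have h1 : (normalizer (Q : Set G)).index = Nat.card N := by
            rw [← Q.card_eq_index_normalizer]
            exact ((Nat.dvd_prime hmp).1 hnd).resolve_left hn
          have h2 := card_mul_index (normalizer (Q : Set G))
          rw [h1, ← hmul, mul_comm, hk] at h2
          have h3 := Nat.eq_of_mul_eq_mul_left Nat.card_pos h2
          exact eq_of_le_of_card_ge (le_normalizer (H := K)) (by
            rw [hc']; exact h3.le)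
        · exact hKT (K.eq_top_of_card_eq (by rw [hc', ← hmul, hk, mul_comm]))
      · have hcop : (Nat.card K).Coprime p := ((Nat.Prime.coprime_iff_not_dvd hp).2 hpK).symm
        have hKN' : K ≤ N := by
          intro x hx
          rw [← QuotientGroup.eq_one_iff, ← orderOf_eq_one_iff]
          have h1 : orderOf (x : G ⧸ N) ∣ Nat.card K :=
            (orderOf_map_dvd (QuotientGroup.mk' N) x).trans (K.orderOf_dvd_natCard hx)
          have h2 : orderOf (x : G ⧸ N) ∣ p := by
            have := orderOf_dvd_natCard (x : G ⧸ N)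
            rwa [show Nat.card (G ⧸ N) = p by rw [← hk, ← hidx]; rfl] at this
          exact Nat.eq_one_of_dvd_coprimes hcop h1 h2
        rcases (Nat.dvd_prime hmp).1 (hcop.dvd_of_dvd_mul_right hKd) with h1 | h1
        · exact Or.inl (K.eq_bot_of_card_eq h1)
        · exact Or.inr (eq_of_le_of_card_ge hKN' h1.ge)
    have := Finset.sum_le_sum_of_subset (f := fun K : Subgroup G => Nat.card K) hR
    rw [hsum, Finset.sum_insert (by simpa using hNb), Finset.sum_singleton, hcb] at this
    omega

end

theorem stmt_1 (G : Type*) [Group G] [Finite G] (hnc : ¬IsCyclic G)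
    (h : sigma1 G = 2 + 11 / (Nat.card G : ℚ)) :
    Nonempty (G ≃* Multiplicative (ZMod 2) × Multiplicative (ZMod 4)) ∨
      Nonempty (G ≃* alternatingGroup (Fin 4)) := by
  classical
  have := Fintype.ofFinite (Subgroup G)
  have hs := sum_card_subgroup_of_sigma1_eq h
  have h11 := sum_numNongenerators_eq hnc hs
  obtain ⟨H, hHT, hH⟩ := exists_not_isCyclic_of_ne_top hnc hs
  obtain ⟨h4, P, hP, hG, hsum, hO⟩ := structure_of_not_isCyclic_subgroup hnc h11 hH hHT
  have hOc : ∀ K : Subgroup G, K ≠ ⊤ → ¬K ≤ H → IsCyclic K := fun K hK hKH => by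
    by_contra hKc
    have hb : K ≠ ⊥ := by
      rintro rfl
      exact hKH bot_le
    have h1 := hO K hK hKH
    rw [Subgroup.numGenerators_of_not_isCyclic hKc] at h1
    have := hP.two_le
    have := Nat.mul_pos (show 0 < P - 1 by omega) (Subgroup.numNongenerators_pos hb)
    omega
  by_cases hP2 : P = 2
  · exact Or.inl (nonempty_mulEquiv_of_card_eight (by omega) hH h4 hOc hnc)
  · obtain ⟨h12, hS⟩ := card_eq_and_card_sylow_eq h4 hP hP2 hG hsum
      fun K hK hKH => ⟨hOc K hK hKH, hO K hK hKH⟩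
    exact Or.inr (nonempty_mulEquiv_alternatingGroup h12 hS)
end

section
/- A finite non-cyclic nilpotent group G satisfies σ₁(G) = 2 + 11/|G| if and only if G is isomorphic to ℤ/2 × ℤ/4. -/
/-- The number of subgroups of `G` of order `k`. -/
noncomputable def numSubgroups (G : Type*) [Group G] (k : ℕ) : ℕ :=
  Nat.card {H : Subgroup G // Nat.card H = k}

theorem numSubgroups_one {G : Type*} [Group G] : numSubgroups G 1 = 1 := by
  rw [numSubgroups, Nat.card_eq_one_iff_unique]
  refine ⟨⟨?_⟩, ⟨⟨⊥, by simp⟩⟩⟩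
  rintro ⟨H, hH⟩ ⟨K, hK⟩
  rw [Subgroup.card_eq_one] at hH hK
  simp [hH, hK]

section Counting

variable {G : Type*} [Group G] [Finite G]

theorem finsum_card_subgroup_eq_sum_divisors :
    ∑ᶠ H : Subgroup G, (Nat.card H : ℚ) =
      ((∑ k ∈ (Nat.card G).divisors, k * numSubgroups G k : ℕ) : ℚ) := by
  classical
  have := Fintype.ofFinite (Subgroup G)
  rw [finsum_eq_sum_of_fintype, ← Nat.cast_sum, Nat.cast_inj,
    ← Finset.sum_fiberwise_of_maps_to (t := (Nat.card G).divisors)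
      (g := fun H : Subgroup G => Nat.card H)
      (fun H _ => Nat.mem_divisors.2 ⟨Subgroup.card_subgroup_dvd_card H, Nat.card_pos.ne'⟩)]
  refine Finset.sum_congr rfl fun k _ => ?_
  rw [Finset.sum_congr rfl (fun H hH => (Finset.mem_filter.1 hH).2), Finset.sum_const,
    smul_eq_mul, mul_comm, numSubgroups, Nat.card_eq_fintype_card, Fintype.card_subtype]

theorem one_le_numSubgroups_of_subgroup (H : Subgroup G) : 1 ≤ numSubgroups G (Nat.card H) :=
  Nat.card_pos_iff.2 ⟨⟨⟨H, rfl⟩⟩, inferInstance⟩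

theorem one_le_numSubgroups_one : 1 ≤ numSubgroups G 1 := by
  simpa using one_le_numSubgroups_of_subgroup (⊥ : Subgroup G)

theorem numSubgroups_card : numSubgroups G (Nat.card G) = 1 := by
  rw [numSubgroups, Nat.card_eq_one_iff_unique]
  refine ⟨⟨?_⟩, ⟨⟨⊤, by simp⟩⟩⟩
  rintro ⟨H, hH⟩ ⟨K, hK⟩
  rw [Subgroup.card_eq_iff_eq_top] at hH hK
  simp [hH, hK]

/-- If all subgroups of order `k` are cyclic, each contains `φ k` of the elements of order `k`. -/
theorem numSubgroups_mul_totient {k : ℕ}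
    (hk : ∀ H : Subgroup G, Nat.card H = k → IsCyclic H) :
    numSubgroups G k * k.totient = Nat.card {g : G // orderOf g = k} := by
  classical
  have := Fintype.ofFinite G
  have := Fintype.ofFinite (Subgroup G)
  rw [Nat.card_eq_fintype_card, Fintype.card_subtype, numSubgroups, Nat.card_eq_fintype_card,
    Fintype.card_subtype, Finset.card_eq_sum_card_fiberwise (f := Subgroup.zpowers)
      (t := Finset.univ.filter fun H : Subgroup G => Nat.card H = k)]
  · rw [Finset.sum_congr rfl (g := fun _ => k.totient), Finset.sum_const, smul_eq_mul]
    intro H hH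
    have hH : Nat.card H = k := (Finset.mem_filter.1 hH).2
    have := hk H hH
    have := Fintype.ofFinite H
    rw [← IsCyclic.card_orderOf_eq_totient (α := H) (d := k)
      (by rw [← Nat.card_eq_fintype_card, hH]),
      ← Finset.card_map (Function.Embedding.subtype fun g => g ∈ H)]
    congr 1
    ext g
    simp only [Finset.mem_filter, Finset.mem_univ, true_and, Finset.mem_map,
      Function.Embedding.subtype_apply, Subtype.exists, exists_and_right, exists_eq_right,
      Subgroup.orderOf_mk]
    constructor
    · rintro ⟨h1, rfl⟩
      exact ⟨Subgroup.mem_zpowers g, h1⟩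
    · rintro ⟨h1, h2⟩
      refine ⟨h2, Subgroup.eq_of_le_of_card_ge (Subgroup.zpowers_le.2 h1) ?_⟩
      rw [Nat.card_zpowers, h2, hH]
  · intro g hg
    simp only [Finset.coe_filter, Finset.mem_univ, true_and, Set.mem_ofPred_eq,
      Nat.card_zpowers] at hg ⊢
    exact hg

theorem numSubgroups_prime_mul_totient {p : ℕ} (hp : p.Prime) :
    numSubgroups G p * (p - 1) = Nat.card {g : G // orderOf g = p} := by
  have := Fact.mk hp
  rw [← Nat.totient_prime hp]
  exact numSubgroups_mul_totient fun H hH => isCyclic_of_prime_card hH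

theorem numSubgroups_prime_of_pow_eq_one {p : ℕ} (hp : p.Prime) (h : ∀ g : G, g ^ p = 1) :
    numSubgroups G p * (p - 1) = Nat.card G - 1 := by
  have := Fact.mk hp
  classical
  have := Fintype.ofFinite G
  rw [numSubgroups_prime_mul_totient hp, Nat.card_eq_fintype_card, Fintype.card_subtype,
    Nat.card_eq_fintype_card, ← Finset.card_univ, ← Finset.card_erase_of_mem (Finset.mem_univ (1 : G))]
  congr 1
  ext g
  simp only [Finset.mem_filter, Finset.mem_univ, true_and, Finset.mem_erase, and_true]
  refine ⟨?_, fun hg => orderOf_eq_prime (h g) hg⟩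
  rintro hg rfl
  exact hp.one_lt.ne (by simpa using hg)

theorem numSubgroups_prime_of_card_eq_sq {p : ℕ} (hp : p.Prime) (hG : Nat.card G = p ^ 2)
    (h : ∀ g : G, g ^ p = 1) : numSubgroups G p = p + 1 := by
  have h1 := numSubgroups_prime_of_pow_eq_one hp h
  obtain ⟨q, rfl⟩ : ∃ q, p = q + 1 := ⟨p - 1, by have := hp.one_lt; omega⟩
  have h2 := hp.one_lt
  refine Nat.eq_of_mul_eq_mul_right (show 0 < q by omega) ?_
  rw [hG] at h1
  simp only [Nat.add_sub_cancel] at h1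
  rw [h1]
  exact Nat.sub_eq_of_eq_add (by ring)

end Counting

theorem numSubgroups_quotient_le {G : Type*} [Group G] [Finite G] (K : Subgroup G) [K.Normal]
    (k : ℕ) : numSubgroups (G ⧸ K) k ≤ numSubgroups G (k * Nat.card K) := by
  have hs := QuotientGroup.mk'_surjective K
  refine Nat.card_le_card_of_injective (fun H => ⟨H.1.comap (QuotientGroup.mk' K), ?_⟩) ?_
  · have h1 := Subgroup.card_mul_index (H.1.comap (QuotientGroup.mk' K))
    rw [Subgroup.index_comap_of_surjective _ hs, Subgroup.card_eq_card_quotient_mul_card_subgroup K,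
      ← Subgroup.card_mul_index H.1, H.2] at h1
    refine Nat.eq_of_mul_eq_mul_right (Nat.pos_of_ne_zero H.1.index_ne_zero_of_finite) ?_
    rw [h1]
    ring
  · intro H H' h
    exact Subtype.ext (Subgroup.comap_injective hs (Subtype.ext_iff.1 h))

theorem IsPGroup.index_eq_of_isCoatom {P : Type*} [Group P] [Finite P] {p : ℕ} (hp : p.Prime)
    (hP : IsPGroup p P) {M : Subgroup P} (hM : IsCoatom M) : M.index = p := by
  have := Fact.mk hp
  obtain ⟨n, hn⟩ := IsPGroup.iff_card.1 (hP.to_subgroup M)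
  obtain ⟨k, hk⟩ := hP.index M
  have hk0 : k ≠ 0 := by
    rintro rfl
    exact hM.1 (Subgroup.index_eq_one.1 (by simpa using hk))
  have hc := M.card_mul_index
  rw [hn, hk, ← pow_add] at hc
  obtain ⟨K, hK, hMK⟩ := Sylow.exists_subgroup_card_pow_succ (p := p) (n := n)
    (by rw [← hc]; exact pow_dvd_pow p (by omega)) hn
  have hlt : M < K := by
    refine lt_of_le_of_ne hMK ?_
    rintro rfl
    have := Nat.pow_right_injective hp.two_le (hn.symm.trans hK)
    omega
  have hK' := hM.2 K hlt
  subst hK'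
  rw [Subgroup.card_top, ← hc] at hK
  have := Nat.pow_right_injective hp.two_le hK
  rw [hk, show k = 1 by omega, pow_one]

theorem IsPGroup.exists_normal_index_eq_of_not_isCyclic {P : Type*} [Group P] [Finite P] {p : ℕ}
    (hp : p.Prime) (hP : IsPGroup p P) (hc : ¬ IsCyclic P) :
    ∃ M N : Subgroup P, M.Normal ∧ N.Normal ∧ M.index = p ∧ N.index = p ∧ M ≠ N := by
  have := Fact.mk hp
  have hnorm : ∀ H : Subgroup P, IsCoatom H → H.Normal :=
    (Group.isNilpotent_of_finite_tfae.out 0 2).1 hP.isNilpotent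
  have hz : ∀ g : P, ∃ M, IsCoatom M ∧ g ∈ M := fun g => by
    rcases eq_top_or_exists_le_coatom (Subgroup.zpowers g) with h | ⟨M, hM, hg⟩
    · exact absurd (isCyclic_iff_exists_zpowers_eq_top.2 ⟨g, h⟩) hc
    · exact ⟨M, hM, hg (Subgroup.mem_zpowers g)⟩
  obtain ⟨M, hM, -⟩ := hz 1
  obtain ⟨g, hg⟩ : ∃ g, g ∉ M := by
    by_contra! h
    exact hM.1 ((Subgroup.eq_top_iff' M).2 h)
  obtain ⟨N, hN, hgN⟩ := hz g
  refine ⟨M, N, hnorm M hM, hnorm N hN, hP.index_eq_of_isCoatom hp hM,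
    hP.index_eq_of_isCoatom hp hN, ?_⟩
  rintro rfl
  exact hg hgN

theorem pow_index_mem_inf {G : Type*} [Group G] {M N : Subgroup G} [M.Normal] [N.Normal]
    (h : M.index = N.index) (g : G) :
    g ^ M.index ∈ M ⊓ N :=
  ⟨M.pow_index_mem g, h ▸ N.pow_index_mem g⟩

section Nilpotent

variable {G : Type*} [Group G] [Finite G]

theorem exists_normal_index_eq_of_not_isCyclic (hnc : ¬ IsCyclic G) (hnil : Group.IsNilpotent G) :
    ∃ p : ℕ, p.Prime ∧
      ∃ M N : Subgroup G, M.Normal ∧ N.Normal ∧ M.index = p ∧ N.index = p ∧ M ≠ N := by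
  have hZ : ¬ IsZGroup G := fun h => hnc inferInstance
  rw [isZGroup_iff] at hZ
  push Not at hZ
  obtain ⟨p, hp, P, hP⟩ := hZ
  have := Fact.mk hp
  have hn : ∀ (p : ℕ), Fact (Nat.Prime p) → ∀ (P : Sylow p G), (P : Subgroup G).Normal :=
    (Group.isNilpotent_of_finite_tfae.out 0 3).1 hnil
  have e := Sylow.directProductOfNormal (G := G) (fun {p} _ P => hn p ‹_› P)
  have hmem : p ∈ (Nat.card G).primeFactors := by
    refine Nat.mem_primeFactors.2 ⟨hp, ?_, Nat.card_pos.ne'⟩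
    refine dvd_trans ?_ P.card_subgroup_dvd_card
    rcases P.2.card_eq_or_dvd with h | h
    · have := (Nat.card_eq_one_iff_unique.1 h).1
      exact absurd (isCyclic_of_subsingleton (α := P)) hP
    · exact h
  let f₁ := Pi.evalMonoidHom (fun q : (Nat.card G).primeFactors => ∀ P : Sylow (q : ℕ) G, P)
    ⟨p, hmem⟩
  let f₂ := Pi.evalMonoidHom (fun P : Sylow p G => P) P
  have hf₁ : Function.Surjective f₁ :=
    Function.surjective_eval (β := fun q : (Nat.card G).primeFactors => ∀ P : Sylow (q : ℕ) G, P) _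
  have hf₂ : Function.Surjective f₂ := Function.surjective_eval (β := fun P : Sylow p G => P) P
  let f : G →* P := (f₂.comp f₁).comp e.symm.toMonoidHom
  have hf : Function.Surjective f :=
    (hf₂.comp hf₁).comp e.symm.surjective
  obtain ⟨M, N, hM, hN, hMi, hNi, hne⟩ :=
    IsPGroup.exists_normal_index_eq_of_not_isCyclic hp P.2 hP
  refine ⟨p, hp, M.comap f, N.comap f, hM.comap f, hN.comap f, ?_, ?_, ?_⟩
  · rw [Subgroup.index_comap_of_surjective _ hf, hMi]
  · rw [Subgroup.index_comap_of_surjective _ hf, hNi]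
  · exact fun h => hne (Subgroup.comap_injective hf h)

theorem index_inf_eq_sq {p : ℕ} (hp : p.Prime) {M N : Subgroup G} [M.Normal] [N.Normal]
    (hM : M.index = p) (hN : N.index = p) (hne : M ≠ N) : (M ⊓ N).index = p ^ 2 := by
  have h1 : N.relIndex M * p = (M ⊓ N).index := by
    rw [← hM, ← Subgroup.relIndex_mul_index (inf_le_left : M ⊓ N ≤ M), Subgroup.inf_relIndex_left]
  have hle : ¬ M ≤ N := fun h => hne <| Subgroup.eq_of_le_of_card_ge h <| by
    have h2 := M.card_mul_index
    have h3 := N.card_mul_index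
    rw [hM] at h2
    rw [hN] at h3
    exact (Nat.eq_of_mul_eq_mul_right hp.pos (h3.trans h2.symm)).le
  have h2 : N.relIndex M ∣ p := hN ▸ Subgroup.relIndex_dvd_index_of_normal N M
  rcases (Nat.dvd_prime hp).1 h2 with h | h
  · exact absurd (Subgroup.relIndex_eq_one.1 h) hle
  · rw [← h1, h, sq]

/-- A non-cyclic finite nilpotent group has a quotient that is elementary abelian of rank two. -/
theorem exists_numSubgroups_ge_of_not_isCyclic (hnc : ¬ IsCyclic G) (hnil : Group.IsNilpotent G) :
    ∃ p m : ℕ, p.Prime ∧ Nat.card G = p ^ 2 * m ∧ p + 1 ≤ numSubgroups G (p * m) ∧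
      1 ≤ numSubgroups G m := by
  obtain ⟨p, hp, M, N, hM, hN, hMi, hNi, hne⟩ := exists_normal_index_eq_of_not_isCyclic hnc hnil
  have hK := index_inf_eq_sq hp hMi hNi hne
  refine ⟨p, Nat.card (M ⊓ N : Subgroup G), hp, ?_, ?_, one_le_numSubgroups_of_subgroup _⟩
  · rw [← hK, mul_comm, Subgroup.card_mul_index]
  · rw [← numSubgroups_prime_of_card_eq_sq (G := G ⧸ (M ⊓ N)) hp hK]
    · exact numSubgroups_quotient_le _ _
    · intro g
      induction g using QuotientGroup.induction_on with
      | H g =>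
        rw [← QuotientGroup.mk_pow, QuotientGroup.eq_one_iff, ← hMi]
        exact pow_index_mem_inf (hMi.trans hNi.symm) g

end Nilpotent

section OrderEight

variable {G : Type*} [Group G] [Finite G]

theorem nonempty_mulEquiv_of_commute (hG : Nat.card G = 8) {x y : G} (hx : orderOf x = 4)
    (hy : orderOf y = 2) (hyx : y ∉ Subgroup.zpowers x) (h : Commute y x) :
    Nonempty (G ≃* Multiplicative (ZMod 2) × Multiplicative (ZMod 4)) := by
  have hdisj : Disjoint (Subgroup.zpowers y) (Subgroup.zpowers x) := by
    have := Fact.mk Nat.prime_two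
    rw [disjoint_iff, ← Subgroup.card_eq_one]
    have h1 := Subgroup.card_dvd_of_le
      (inf_le_left : Subgroup.zpowers y ⊓ Subgroup.zpowers x ≤ Subgroup.zpowers y)
    rw [Nat.card_zpowers, hy] at h1
    refine ((Nat.dvd_prime Nat.prime_two).1 h1).resolve_right fun h2 => hyx ?_
    have h3 := Subgroup.eq_of_le_of_card_ge
      (inf_le_left : Subgroup.zpowers y ⊓ Subgroup.zpowers x ≤ Subgroup.zpowers y)
      (by rw [Nat.card_zpowers, hy, h2])
    exact inf_eq_left.1 h3 (Subgroup.mem_zpowers y)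
  let f := (Subgroup.zpowers y).subtype.noncommCoprod (Subgroup.zpowers x).subtype (by
    rintro ⟨_, m, rfl⟩ ⟨_, n, rfl⟩
    exact h.zpow_zpow m n)
  have hf : Function.Injective f := by
    rw [MonoidHom.noncommCoprod_injective]
    exact ⟨Subtype.val_injective, Subtype.val_injective, by simpa using hdisj⟩
  have hb : Function.Bijective f := (Nat.bijective_iff_injective_and_card f).2
    ⟨hf, by rw [Nat.card_prod, Nat.card_zpowers, Nat.card_zpowers, hx, hy, hG]⟩
  exact ⟨(MulEquiv.ofBijective f hb).symm.trans
    ((mulEquivOfCyclicCardEq (by simp [hy])).prodCongr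
      (mulEquivOfCyclicCardEq (by simp [hx])))⟩

theorem card_eq_sum_card_orderOf :
    Nat.card G = ∑ k ∈ (Nat.card G).divisors, Nat.card {g : G // orderOf g = k} := by
  classical
  have := Fintype.ofFinite G
  conv_lhs => rw [Nat.card_eq_fintype_card, ← Finset.card_univ]
  rw [Finset.card_eq_sum_card_fiberwise (f := orderOf) (t := (Nat.card G).divisors)
    (fun g _ => Nat.mem_divisors.2 ⟨orderOf_dvd_natCard g, Nat.card_pos.ne'⟩)]
  refine Finset.sum_congr rfl fun k _ => ?_
  rw [Nat.card_eq_fintype_card, Fintype.card_subtype]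

theorem card_orderOf_of_card_eq_eight (hG : Nat.card G = 8) (hnc : ¬ IsCyclic G) :
    1 + Nat.card {g : G // orderOf g = 2} + Nat.card {g : G // orderOf g = 4} = 8 := by
  have h := card_eq_sum_card_orderOf (G := G)
  have h8 : Nat.card {g : G // orderOf g = 8} = 0 := by
    rw [Nat.card_eq_zero]
    exact .inl ⟨fun g => hnc (isCyclic_of_orderOf_eq_card g.1 (g.2.trans hG.symm))⟩
  have h1 : Nat.card {g : G // orderOf g = 1} = 1 := by
    simp [orderOf_eq_one_iff]
  rw [hG, show Nat.divisors 8 = {1, 2, 4, 8} by decide] at h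
  simp [h8] at h
  omega

theorem isCyclic_of_card_eq_four (hu : Nat.card {g : G // orderOf g = 2} = 1) (H : Subgroup G)
    (hH : Nat.card H = 4) : IsCyclic H := by
  by_contra hc
  have hsq : ∀ g : H, g ≠ 1 → orderOf g = 2 := fun g hg => by
    have h1 : orderOf g ∣ 2 ^ 2 := by simpa [hH] using orderOf_dvd_natCard g
    obtain ⟨k, hk, hk'⟩ := (Nat.dvd_prime_pow Nat.prime_two).1 h1
    interval_cases k
    · exact absurd (orderOf_eq_one_iff.1 (by simpa using hk')) hg
    · simpa using hk'
    · exact absurd (isCyclic_of_orderOf_eq_card g (by rw [hk', hH]; rfl)) hc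
  have := (Nat.card_eq_one_iff_unique.1 hu).1
  have h3 : Nat.card H ≤ Nat.card Bool := by
    classical
    refine Nat.card_le_card_of_injective (fun g : H => decide (g = 1)) fun a b hab => ?_
    by_cases ha : a = 1
    · simp_all
    · have hb : b ≠ 1 := by simpa [ha] using hab
      have := Subsingleton.elim (α := {g : G // orderOf g = 2})
        ⟨a, (Subgroup.orderOf_coe a).trans (hsq a ha)⟩
        ⟨b, (Subgroup.orderOf_coe b).trans (hsq b hb)⟩
      exact Subtype.ext (congrArg (fun z : {g : G // orderOf g = 2} => (z : G)) this)
  simp [hH] at h3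

theorem five_le_card_orderOf_eq_two {x y : G} (hx : orderOf x = 4)
    (hy : orderOf y = 2) (hyx : y ∉ Subgroup.zpowers x) (h : y * x * y⁻¹ = x⁻¹) :
    5 ≤ Nat.card {g : G // orderOf g = 2} := by
  have := Fact.mk Nat.prime_two
  have hy2 : y * y = 1 := by rw [← sq, ← hy, pow_orderOf_eq_one]
  have hyi : y⁻¹ = y := inv_eq_of_mul_eq_one_left hy2
  have hconj : ∀ n : ℕ, y * x ^ n * y = (x ^ n)⁻¹ := fun n => by
    have := conj_pow (i := n) (a := y) (b := x)
    rw [h, inv_pow, hyi] at this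
    exact this.symm
  have hx2 : orderOf (x ^ 2) = 2 := by rw [orderOf_pow, hx]; rfl
  have hout : ∀ n : ℕ, x ^ n * y ≠ x ^ 2 ∧ x ^ n * y ≠ 1 := fun n => by
    have hm : ∀ m : ℕ, x ^ n * y ≠ x ^ m := fun m hm => hyx <| by
      rw [show y = (x ^ n)⁻¹ * x ^ m by rw [← hm]; group]
      exact mul_mem (inv_mem (Subgroup.npow_mem_zpowers x n)) (Subgroup.npow_mem_zpowers x m)
    exact ⟨hm 2, by simpa using hm 0⟩
  have hord : ∀ n : ℕ, orderOf (x ^ n * y) = 2 := fun n => by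
    refine orderOf_eq_prime ?_ (hout n).2
    rw [sq, mul_assoc, ← mul_assoc y, hconj, mul_inv_cancel]
  have hc : Nat.card (Option (Fin 4)) = 5 := by simp
  rw [← hc]
  refine Nat.card_le_card_of_injective
    (fun o => o.elim ⟨x ^ 2, hx2⟩ fun i => ⟨x ^ (i : ℕ) * y, hord i⟩) ?_
  rintro (_ | i) (_ | j) hij
  · rfl
  · exact absurd (Subtype.ext_iff.1 hij).symm (hout j).1
  · exact absurd (Subtype.ext_iff.1 hij) (hout i).1
  · have h1 : x ^ (i : ℕ) = x ^ (j : ℕ) := mul_right_cancel (Subtype.ext_iff.1 hij)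
    have h2 := pow_injOn_Iio_orderOf (x := x) (by simp [hx]) (by simp [hx]) h1
    exact congrArg some (Fin.ext h2)

theorem nonempty_mulEquiv_of_card_eq_eight (hG : Nat.card G = 8) (hnc : ¬ IsCyclic G)
    (h4 : 3 ≤ numSubgroups G 4) (hsum : 4 * numSubgroups G 4 + 2 * numSubgroups G 2 = 18) :
    Nonempty (G ≃* Multiplicative (ZMod 2) × Multiplicative (ZMod 4)) := by
  classical
  have h2 := numSubgroups_prime_mul_totient (G := G) Nat.prime_two
  have hcard := card_orderOf_of_card_eq_eight hG hnc
  obtain ⟨x, hx⟩ : ∃ x : G, orderOf x = 4 := by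
    by_contra! hx
    have : Nat.card {g : G // orderOf g = 4} = 0 := by
      rw [Nat.card_eq_zero]
      exact .inl ⟨fun g => hx _ g.2⟩
    omega
  have hx2 : orderOf (x ^ 2) = 2 := by rw [orderOf_pow, hx]; rfl
  have hne1 : Nat.card {g : G // orderOf g = 2} ≠ 1 := fun hu => by
    have h := numSubgroups_mul_totient (isCyclic_of_card_eq_four hu)
    rw [show Nat.totient 4 = 2 by decide] at h
    omega
  obtain ⟨y, hy, hyx⟩ : ∃ y : G, orderOf y = 2 ∧ y ∉ Subgroup.zpowers x := by
    by_contra! hy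
    refine hne1 (Nat.card_eq_one_iff_unique.2 ⟨⟨?_⟩, ⟨⟨x ^ 2, hx2⟩⟩⟩)
    have key : ∀ g : G, orderOf g = 2 → g = x ^ 2 := fun g hg => by
      obtain ⟨n, hn, rfl⟩ :=
        Finset.mem_image.1 (mem_zpowers_iff_mem_range_orderOf.1 (hy g hg))
      rw [hx, Finset.mem_range] at hn
      rw [orderOf_pow, hx] at hg
      interval_cases n <;> simp_all
    rintro ⟨a, ha⟩ ⟨b, hb⟩
    exact Subtype.ext ((key a ha).trans (key b hb).symm)
  have hidx : (Subgroup.zpowers x).index = 2 := by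
    have := (Subgroup.zpowers x).card_mul_index
    rw [Nat.card_zpowers, hx, hG] at this
    omega
  have hnorm := Subgroup.normal_of_index_eq_two hidx
  obtain ⟨n, hn, hxn⟩ := Finset.mem_image.1 (mem_zpowers_iff_mem_range_orderOf.1
    (hnorm.conj_mem x (Subgroup.mem_zpowers x) y))
  have ho : orderOf (y * x * y⁻¹) = 4 := by
    rw [← hx]
    exact (MulAut.conj y).orderOf_eq x
  rw [hx, Finset.mem_range] at hn
  rw [← hxn, orderOf_pow, hx] at ho
  have h13 : n = 1 ∨ n = 3 := by
    interval_cases n <;> simp_all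
  rcases h13 with rfl | rfl
  · refine nonempty_mulEquiv_of_commute hG hx hy hyx ?_
    rw [pow_one] at hxn
    exact (eq_mul_inv_iff_mul_eq.1 hxn).symm
  · have hx4 : x ^ 4 = 1 := by rw [← hx, pow_orderOf_eq_one]
    have := five_le_card_orderOf_eq_two hx hy hyx
      (by rw [← hxn]; exact eq_inv_of_mul_eq_one_left (by rw [← pow_succ, hx4]))
    omega

end OrderEight

theorem sum_card_mul_closed :
    ∑ s ∈ (Finset.univ : Finset (Finset (Multiplicative (ZMod 2) × Multiplicative (ZMod 4)))) with
      (1 ∈ s ∧ ∀ a ∈ s, ∀ b ∈ s, a * b ∈ s), s.card = 27 := by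
  decide +kernel

theorem finsum_card_subgroup_eq_sum_mul_closed {G : Type*} [Group G] [Fintype G] [DecidableEq G] :
    ∑ᶠ H : Subgroup G, (Nat.card H : ℚ) =
      ((∑ s ∈ (Finset.univ : Finset (Finset G)) with
        (1 ∈ s ∧ ∀ a ∈ s, ∀ b ∈ s, a * b ∈ s), s.card : ℕ) : ℚ) := by
  classical
  have := Fintype.ofFinite (Subgroup G)
  rw [finsum_eq_sum_of_fintype, ← Nat.cast_sum, Nat.cast_inj]
  refine Finset.sum_bij (fun H _ => (H : Set G).toFinset) ?_ ?_ ?_ ?_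
  · intro H _
    simp only [Finset.mem_filter, Finset.mem_univ, true_and, Set.mem_toFinset, SetLike.mem_coe]
    exact ⟨H.one_mem, fun a ha b hb => H.mul_mem ha hb⟩
  · intro H _ K _ h
    exact SetLike.coe_injective (Set.toFinset_inj.1 h)
  · intro s hs
    obtain ⟨-, h1, hm⟩ := Finset.mem_filter.1 hs
    refine ⟨{ carrier := s, one_mem' := h1, mul_mem' := fun {a b} ha hb => hm a ha b hb,
              inv_mem' := fun {a} ha => ?_ }, Finset.mem_univ _, by ext; simp⟩
    have hpow : ∀ n : ℕ, a ^ n ∈ s := fun n => by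
      induction n with
      | zero => simpa using h1
      | succ n ih => rw [pow_succ]; exact hm _ ih _ ha
    have h2 := hpow (orderOf a - 1)
    rw [← inv_eq_of_mul_eq_one_left (a := a ^ (orderOf a - 1)) (b := a)
      (by rw [← pow_succ, Nat.sub_add_cancel (orderOf_pos a), pow_orderOf_eq_one])] at h2
    simpa using h2
  · intro H _
    rw [Set.toFinset_card, Nat.card_eq_fintype_card]
    rfl

theorem finsum_card_subgroup_congr {G G' : Type*} [Group G] [Group G'] (e : G ≃* G') :
    ∑ᶠ H : Subgroup G, (Nat.card H : ℚ) = ∑ᶠ H : Subgroup G', (Nat.card H : ℚ) := by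
  refine finsum_eq_of_bijective e.mapSubgroup e.mapSubgroup.bijective fun H => ?_
  rw [Nat.card_congr (e.subgroupMap H).toEquiv]
  rfl

theorem card_eq_eight_of_sum_eq {G : Type*} [Group G] [Finite G] (hnc : ¬ IsCyclic G)
    (hnil : Group.IsNilpotent G)
    (hS : ∑ k ∈ (Nat.card G).divisors, k * numSubgroups G k = 2 * Nat.card G + 11) :
    Nat.card G = 8 ∧ 3 ≤ numSubgroups G 4 := by
  obtain ⟨p, m, hp, hG, hpm, hm⟩ := exists_numSubgroups_ge_of_not_isCyclic hnc hnil
  have h1 := one_le_numSubgroups_one (G := G)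
  have hG1 := numSubgroups_card (G := G)
  have hp2 := hp.two_le
  have hmpos : 0 < m := Nat.pos_of_ne_zero (by
    rintro rfl
    exact Nat.card_pos.ne' (hG.trans (mul_zero _)))
  have hsub : ∀ T : Finset ℕ, T ⊆ (Nat.card G).divisors →
      ∑ k ∈ T, k * numSubgroups G k ≤ 2 * Nat.card G + 11 := fun T hT =>
    hS ▸ Finset.sum_le_sum_of_subset hT
  rcases Nat.lt_or_ge 1 m with hm1 | hm1
  · have hlt : m < p * m := by nlinarith
    have hlt' : p * m < p ^ 2 * m := by nlinarith
    have hT := hsub {1, m, p * m, p ^ 2 * m} (by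
      intro k hk
      simp only [Finset.mem_insert, Finset.mem_singleton] at hk
      refine Nat.mem_divisors.2 ⟨?_, Nat.card_pos.ne'⟩
      rw [hG]
      rcases hk with rfl | rfl | rfl | rfl
      · exact one_dvd _
      · exact dvd_mul_left _ _
      · exact ⟨p, by ring⟩
      · exact dvd_rfl)
    rw [Finset.sum_insert (by simp only [Finset.mem_insert, Finset.mem_singleton]; omega),
      Finset.sum_insert (by simp only [Finset.mem_insert, Finset.mem_singleton]; omega),
      Finset.sum_insert (by simp only [Finset.mem_singleton]; omega), Finset.sum_singleton, ← hG, hG1, hG] at hT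
    have hb : m * (p + 1) ≤ 10 := by
      have h2 := Nat.mul_le_mul_left (p * m) hpm
      have h3 := Nat.mul_le_mul_left m hm
      nlinarith
    have hp3 : p ≤ 4 := by nlinarith
    have hm3 : m ≤ 3 := by nlinarith
    have hsyl : ∃ H : Subgroup G, Nat.card H = p ^ 2 := by
      have := Fact.mk hp
      exact Sylow.exists_subgroup_card_pow_prime p (hG ▸ dvd_mul_right _ _)
    obtain ⟨H, hH⟩ := hsyl
    have hHc := one_le_numSubgroups_of_subgroup H
    rw [hH] at hHc
    have hdiv : Nat.divisors 12 = {1, 2, 3, 4, 6, 12} := by decide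
    have hdiv' : Nat.divisors 18 = {1, 2, 3, 6, 9, 18} := by decide
    interval_cases p
    · interval_cases m
      · exact ⟨hG, hpm⟩
      · norm_num at hG hpm hHc
        rw [hG, hdiv] at hS
        rw [hG] at hG1
        simp at hS
        omega
    · interval_cases m
      · norm_num at hG hpm hHc
        rw [hG, hdiv'] at hS
        rw [hG] at hG1
        simp at hS
        omega
      · omega
    · exact absurd hp (by decide)
  · obtain rfl : m = 1 := by omega
    rw [mul_one] at hG
    exfalso
    have hpow : ∀ g : G, g ^ p = 1 := fun g => by
      rw [← orderOf_dvd_iff_pow_eq_one]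
      obtain ⟨k, hk, hk'⟩ := (Nat.dvd_prime_pow hp).1 (hG ▸ orderOf_dvd_natCard g)
      interval_cases k
      · simp [hk']
      · simp [hk']
      · exact absurd (isCyclic_of_orderOf_eq_card g (hk'.trans hG.symm)) hnc
    have hn := numSubgroups_prime_of_card_eq_sq hp hG hpow
    rw [hG] at hG1
    rw [hG, Nat.sum_divisors_prime_pow hp] at hS
    simp [Finset.sum_range_succ, hn, hG1, numSubgroups_one] at hS
    have : p = 10 := by nlinarith
    subst this
    exact absurd hp (by decide)

theorem stmt_2 (G : Type*) [Group G] [Finite G] (hnc : ¬IsCyclic G)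
    (hnil : Group.IsNilpotent G) :
    sigma1 G = 2 + 11 / (Nat.card G : ℚ) ↔
      Nonempty (G ≃* Multiplicative (ZMod 2) × Multiplicative (ZMod 4)) := by
  have hpos : (Nat.card G : ℚ) ≠ 0 := Nat.cast_ne_zero.2 Nat.card_pos.ne'
  constructor
  · intro h
    rw [sigma1, finsum_card_subgroup_eq_sum_divisors] at h
    have hS : ∑ k ∈ (Nat.card G).divisors, k * numSubgroups G k = 2 * Nat.card G + 11 := by
      field_simp at h
      rw [mul_comm 2]
      exact_mod_cast h
    obtain ⟨hG, h4⟩ := card_eq_eight_of_sum_eq hnc hnil hS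
    refine nonempty_mulEquiv_of_card_eq_eight hG hnc h4 ?_
    have hG1 := numSubgroups_card (G := G)
    rw [hG] at hG1
    rw [hG, show Nat.divisors 8 = {1, 2, 4, 8} by decide] at hS
    simp [hG1, numSubgroups_one] at hS
    omega
  · rintro ⟨e⟩
    have h27 : ∑ᶠ H : Subgroup (Multiplicative (ZMod 2) × Multiplicative (ZMod 4)),
        (Nat.card H : ℚ) = (27 : ℕ) := by
      rw [finsum_card_subgroup_eq_sum_mul_closed]
      convert congrArg (Nat.cast : ℕ → ℚ) sum_card_mul_closed
    rw [sigma1, finsum_card_subgroup_congr e, h27, Nat.card_congr e.toEquiv]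
    norm_num
end

section
/- A finite non-nilpotent group G satisfies σ₁(G) = 2 + 11/|G| if and only if G is isomorphic to the alternating group A₄. -/
namespace Subgroup

open scoped Pointwise

variable {G : Type*} [Group G]

/-- The set of all conjugates of a subgroup. -/
def conjugates (M : Subgroup G) : Set (Subgroup G) :=
  Set.range fun g : G => M.map (MulAut.conj g).toMonoidHom

theorem card_eq_of_mem_conjugates {M H : Subgroup G} (h : H ∈ M.conjugates) :
    Nat.card H = Nat.card M := by
  obtain ⟨g, rfl⟩ := h
  exact (Nat.card_congr (M.equivMapOfInjective _ (MulAut.conj g).injective).toEquiv).symm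

theorem eq_of_mem_conjugates_of_normal {M H : Subgroup G} (h : H ∈ M.conjugates) [H.Normal] :
    H = M := by
  obtain ⟨g, hg⟩ := h
  have hn : H.map (MulAut.conj g⁻¹).toMonoidHom = H :=
    mem_normalizer_iff_map_conj_eq.mp (by simp [normalizer_eq_top])
  rw [← hn, ← hg, map_map]
  ext
  simp [mul_assoc]

theorem ncard_conjugates (M : Subgroup G) :
    M.conjugates.ncard = (normalizer (M : Set G)).index := by
  let _ := MulAction.compHom (Subgroup G) (MulAut.conj : G →* MulAut G)
  have h := MulAction.index_stabilizer G M
  have hs : MulAction.stabilizer G M = normalizer (M : Set G) := by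
    ext g
    rw [mem_normalizer_iff_map_conj_eq]
    rfl
  rw [← hs, h]
  rfl

theorem normalizer_eq_self_of_isCoatom {M : Subgroup G} (hM : IsCoatom M) (hn : ¬M.Normal) :
    normalizer (M : Set G) = M :=
  (hM.le_iff.mp le_normalizer).resolve_left fun h => hn (normalizer_eq_top_iff.mp h)

theorem isCoatom_of_mem_conjugates {M H : Subgroup G} (hM : IsCoatom M)
    (h : H ∈ M.conjugates) : IsCoatom H := by
  obtain ⟨g, rfl⟩ := h
  exact ((MulAut.conj g).mapSubgroup.isCoatom_iff M).mpr hM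

/-- The proper subgroups that are not conjugate to `M`. -/
def outsiders (M : Subgroup G) : Set (Subgroup G) := {H | H ≠ ⊤ ∧ H ∉ M.conjugates}

theorem mem_outsiders_of_normal {M H : Subgroup G} (hn : ¬M.Normal) [hH : H.Normal] (h : H ≠ ⊤) :
    H ∈ M.outsiders :=
  ⟨h, fun hc => hn (eq_of_mem_conjugates_of_normal hc ▸ hH)⟩

theorem mem_outsiders_of_card_ne {M H : Subgroup G} (h : H ≠ ⊤) (hc : Nat.card H ≠ Nat.card M) :
    H ∈ M.outsiders :=
  ⟨h, fun hm => hc (card_eq_of_mem_conjugates hm)⟩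

theorem finsum_card_eq [Finite G] {M : Subgroup G} (hM : IsCoatom M) (hn : ¬M.Normal) :
    ∑ᶠ H : Subgroup G, Nat.card H =
      2 * Nat.card G + ∑ᶠ H ∈ M.outsiders, Nat.card H := by
  have htop : (⊤ : Subgroup G) ∉ M.conjugates := fun h =>
    (isCoatom_of_mem_conjugates hM h).1 rfl
  have hdisj : Disjoint (insert ⊤ M.conjugates) M.outsiders := by
    rw [Set.disjoint_left]
    rintro H (rfl | h) ⟨h1, h2⟩
    exacts [h1 rfl, h2 h]
  have hunion : insert ⊤ M.conjugates ∪ M.outsiders = Set.univ := by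
    ext H
    simp only [outsiders, Set.mem_union, Set.mem_insert_iff, Set.mem_ofPred_eq, Set.mem_univ]
    tauto
  rw [← finsum_mem_univ, ← hunion, finsum_mem_union hdisj (Set.toFinite _) (Set.toFinite _),
    finsum_mem_insert _ htop (Set.toFinite _)]
  have hc : ∑ᶠ H ∈ M.conjugates, Nat.card H = Nat.card G := by
    have h : ∑ᶠ H ∈ M.conjugates, Nat.card H = ∑ᶠ H ∈ M.conjugates, Nat.card M :=
      finsum_mem_congr rfl fun H hH => card_eq_of_mem_conjugates hH
    rw [h, finsum_mem_eq_finite_toFinset_sum _ (Set.toFinite _), Finset.sum_const,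
      ← Set.ncard_eq_toFinset_card, ncard_conjugates, normalizer_eq_self_of_isCoatom hM hn,
      smul_eq_mul, index_mul_card]
  rw [hc, card_top]
  ring

theorem sum_card_le_finsum_outsiders [Finite G] {M : Subgroup G} (T : Finset (Subgroup G))
    (hT : ∀ H ∈ T, H ∈ M.outsiders) :
    ∑ H ∈ T, Nat.card H ≤ ∑ᶠ H ∈ M.outsiders, Nat.card H := by
  rw [finsum_mem_eq_finite_toFinset_sum _ (Set.toFinite _)]
  exact Finset.sum_le_sum_of_subset fun H hH => by simpa using hT H hH

theorem card_mul_relIndex_of_le {H K : Subgroup G} (h : H ≤ K) :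
    Nat.card H * H.relIndex K = Nat.card K := by
  simpa only [relIndex_bot_left] using relIndex_mul_relIndex ⊥ H K bot_le h

theorem card_sup_mul_card_inf (N H : Subgroup G) [N.Normal] :
    Nat.card ↥(N ⊔ H) * Nat.card ↥(N ⊓ H) = Nat.card N * Nat.card H := by
  have h1 := card_mul_relIndex_of_le (le_sup_left : N ≤ N ⊔ H)
  have h2 := card_mul_relIndex_of_le (inf_le_right : N ⊓ H ≤ H)
  rw [relIndex_sup_left] at h1
  rw [inf_relIndex_right] at h2
  rw [← h1, ← h2]
  ring

theorem bot_mem_outsiders {M : Subgroup G} (hM : IsCoatom M) (hn : ¬M.Normal) :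
    ⊥ ∈ M.outsiders :=
  mem_outsiders_of_normal hn fun h => hM.1 (top_le_iff.mp (h ▸ bot_le))

theorem sum_card_four_le_finsum_outsiders [Finite G] {M A B C D : Subgroup G}
    (hA : A ∈ M.outsiders) (hB : B ∈ M.outsiders) (hC : C ∈ M.outsiders) (hD : D ∈ M.outsiders)
    (hAB : Nat.card A ≠ Nat.card B) (hAC : Nat.card A ≠ Nat.card C)
    (hAD : Nat.card A ≠ Nat.card D) (hBC : Nat.card B ≠ Nat.card C)
    (hBD : Nat.card B ≠ Nat.card D) (hCD : Nat.card C ≠ Nat.card D) :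
    Nat.card A + Nat.card B + Nat.card C + Nat.card D ≤ ∑ᶠ H ∈ M.outsiders, Nat.card H := by
  classical
  have h := sum_card_le_finsum_outsiders (M := M) {A, B, C, D} (by simp [hA, hB, hC, hD])
  have ne {X Y : Subgroup G} (h : Nat.card X ≠ Nat.card Y) : X ≠ Y := fun e => h (e ▸ rfl)
  rw [Finset.sum_insert (by simp [ne hAB, ne hAC, ne hAD]),
    Finset.sum_insert (by simp [ne hBC, ne hBD]), Finset.sum_insert (by simp [ne hCD]),
    Finset.sum_singleton] at h
  omega

theorem index_ne_two_of_not_normal {M : Subgroup G} (hn : ¬M.Normal) : M.index ≠ 2 :=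
  fun h => hn (normal_of_index_eq_two h)

theorem not_card_sylow_dvd_card [Finite G] {M : Subgroup G} {p : ℕ} [Fact p.Prime]
    (hp : p ∣ M.index) (P : Sylow p G) : ¬Nat.card P ∣ Nat.card M := by
  intro h
  have h1 := mul_dvd_mul h hp
  rw [card_mul_index, ← card_mul_index (P : Subgroup G)] at h1
  exact P.not_dvd_index (Nat.dvd_of_mul_dvd_mul_left Nat.card_pos h1)

theorem sylow_mem_outsiders [Finite G] {M : Subgroup G} {p : ℕ} [Fact p.Prime]
    (hG : ¬IsPGroup p G) (hp : p ∣ M.index) (P : Sylow p G) : (P : Subgroup G) ∈ M.outsiders := by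
  refine mem_outsiders_of_card_ne (fun h => hG ?_) fun h =>
    not_card_sylow_dvd_card hp P h.dvd
  have := P.isPGroup'
  rw [h] at this
  exact this.of_equiv topEquiv

theorem sylow_normal_of_finsum_outsiders [Finite G] {M : Subgroup G} {p : ℕ} [Fact p.Prime]
    (hM : IsCoatom M) (hn : ¬M.Normal) (hG : ¬IsPGroup p G) (hp : p ∣ M.index)
    (hS : ∑ᶠ H ∈ M.outsiders, Nat.card H = 11) (P : Sylow p G) : (P : Subgroup G).Normal := by
  classical
  by_contra hPn
  let _ := Fintype.ofFinite (Sylow p G)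
  have hp2 := (Fact.out : p.Prime).two_le
  let T : Finset (Subgroup G) :=
    Finset.univ.image fun Q : Sylow p G => (Q : Subgroup G)
  have hTout : ∀ H ∈ T, H ∈ M.outsiders := by
    simp only [T, Finset.mem_image, Finset.mem_univ, true_and]
    rintro _ ⟨Q, rfl⟩
    exact sylow_mem_outsiders hG hp Q
  have hTcard : ∀ H ∈ T, Nat.card H = Nat.card P := by
    simp only [T, Finset.mem_image, Finset.mem_univ, true_and]
    rintro _ ⟨Q, rfl⟩
    rw [Q.card_eq_multiplicity, P.card_eq_multiplicity]
  have hTsum : ∑ H ∈ T, Nat.card H = Nat.card (Sylow p G) * Nat.card P := by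
    rw [Finset.sum_congr rfl hTcard, Finset.sum_const,
      Finset.card_image_of_injective _ fun _ _ h => Sylow.ext h, Finset.card_univ,
      ← Nat.card_eq_fintype_card, smul_eq_mul]
  have hP1 : Nat.card P ≠ 1 := fun h => hPn (by
    rw [card_eq_one.mp h]
    infer_instance)
  have hbT : ⊥ ∉ T := fun h => hP1 (by rw [← hTcard _ h, card_bot])
  have h1 := sum_card_le_finsum_outsiders (M := M) (insert ⊥ T) fun H hH => by
    rcases Finset.mem_insert.mp hH with rfl | hH
    exacts [bot_mem_outsiders hM hn, hTout H hH]
  rw [Finset.sum_insert hbT, hTsum, card_bot, hS] at h1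
  obtain ⟨a, ha⟩ := P.isPGroup'.exists_card_eq
  have ha0 : a ≠ 0 := by
    rintro rfl
    exact hP1 (by simpa using ha)
  have hpP : p ∣ Nat.card P := ha ▸ dvd_pow_self p ha0
  have hmod := card_sylow_modEq_one p G
  have hcard1 : Nat.card (Sylow p G) ≠ 1 := fun h => hPn (by
    rw [P.card_eq_index_normalizer, index_eq_one] at h
    exact normalizer_eq_top_iff.mp h)
  have hcardp : p + 1 ≤ Nat.card (Sylow p G) := by
    have h0 : 0 < Nat.card (Sylow p G) := Nat.card_pos
    have := Nat.le_of_dvd (by omega) ((Nat.modEq_iff_dvd' h0).mp hmod.symm)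
    omega
  have hP2 : Nat.card P = 2 ∧ p = 2 := by
    have hle := Nat.le_of_dvd Nat.card_pos hpP
    have hpp : p = 2 := by nlinarith
    subst hpp
    exact ⟨by have : Nat.card P < 4 := by nlinarith
              omega, rfl⟩
  obtain ⟨hP2, rfl⟩ := hP2
  have hmin : (Nat.card G).minFac = 2 :=
    (Nat.minFac_eq_two_iff _).mpr (hP2 ▸ card_subgroup_dvd_card (P : Subgroup G))
  have hcyc : IsCyclic P := isCyclic_of_prime_card (p := 2) hP2
  have hcompl := IsCyclic.isComplement' hmin hcyc
  set N := (MonoidHom.transferSylow P (hcyc.normalizer_le_centralizer hmin)).ker with hN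
  have hNodd : ¬2 ∣ Nat.card N := MonoidHom.not_dvd_card_ker_transferSylow P _
  have hNcard := hcompl.card_mul_card
  rw [hP2] at hNcard
  have hNtop : N ≠ ⊤ := fun h => by
    rw [h, card_top] at hNcard
    have : 0 < Nat.card G := Nat.card_pos
    omega
  have hNT : N ∉ insert ⊥ T := fun h => by
    rcases Finset.mem_insert.mp h with h | h
    · refine hG (IsPGroup.of_card (n := 1) ?_)
      rw [← hNcard, h, card_bot, one_mul, pow_one]
    · exact hNodd (by rw [hTcard _ h, hP2])
  have h2 := sum_card_le_finsum_outsiders (M := M) (insert N (insert ⊥ T)) fun H hH => by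
    rcases Finset.mem_insert.mp hH with rfl | hH
    · exact mem_outsiders_of_normal hn hNtop
    rcases Finset.mem_insert.mp hH with rfl | hH
    exacts [bot_mem_outsiders hM hn, hTout H hH]
  rw [Finset.sum_insert hNT, Finset.sum_insert hbT, hTsum, card_bot, hS, hP2] at h2
  have hG6 : Nat.card G = 6 := by
    have hN1 : Nat.card N ≠ 1 := fun h =>
      hNT (Finset.mem_insert.mpr (Or.inl (card_eq_one.mp h)))
    have : Nat.card N = 3 := by omega
    omega
  have hMi := M.card_mul_index
  obtain ⟨k, hk⟩ := hp
  have hk3 : k * Nat.card M = 3 := by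
    rw [hk, hG6] at hMi
    linarith
  rcases (Nat.dvd_prime Nat.prime_three).mp ⟨_, hk3.symm⟩ with rfl | rfl
  · exact index_ne_two_of_not_normal hn hk
  · have : M = ⊥ := card_eq_one.mp (by omega)
    exact hn (this ▸ inferInstance)

theorem sup_eq_top_of_finsum_outsiders [Finite G] {M N R : Subgroup G} [N.Normal]
    (hM : IsCoatom M) (hn : ¬M.Normal) (hS : ∑ᶠ H ∈ M.outsiders, Nat.card H ≤ 11)
    (hN : N ∈ M.outsiders) (hsup : N ⊔ M = ⊤) (hNM : ¬Nat.card N ∣ Nat.card M)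
    (hcop : (Nat.card N).Coprime (Nat.card R)) (hR1 : Nat.card R ≠ 1) : N ⊔ R = ⊤ := by
  have hN1 : Nat.card N ≠ 1 := fun h => hNM (h ▸ one_dvd _)
  have hNR : Nat.card N ≠ Nat.card R := fun h => by
    rw [h, Nat.coprime_self] at hcop
    exact hR1 hcop
  have hcardNR := card_sup_mul_card_inf N R
  rw [(disjoint_of_coprime_natCard hcop).eq_bot, card_bot, mul_one] at hcardNR
  have hcardNM := card_sup_mul_card_inf N M
  rw [hsup, card_top] at hcardNM
  by_contra hNRt
  have hR : R ∈ M.outsiders := by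
    refine mem_outsiders_of_card_ne (fun h => hNRt (by rw [h, sup_top_eq])) fun h => hNRt ?_
    refine eq_top_of_le_card _ ?_
    rw [hcardNR, h, ← hcardNM]
    exact Nat.le_mul_of_pos_right _ Nat.card_pos
  have hNRo : N ⊔ R ∈ M.outsiders := mem_outsiders_of_card_ne hNRt fun h =>
    hNM (h ▸ hcardNR ▸ dvd_mul_right _ _)
  have hNpos : 0 < Nat.card N := Nat.card_pos
  have hRpos : 0 < Nat.card R := Nat.card_pos
  have h4 := sum_card_four_le_finsum_outsiders (bot_mem_outsiders hM hn) hN hR hNRo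
    (by rw [card_bot]; exact hN1.symm) (by rw [card_bot]; exact hR1.symm)
    (by rw [card_bot, hcardNR]; exact fun h => hN1 (Nat.eq_one_of_mul_eq_one_right h.symm))
    hNR (by rw [hcardNR]; exact fun h => hR1 ((Nat.mul_eq_left hNpos.ne').mp h.symm))
    (by rw [hcardNR]; exact fun h => hN1 ((Nat.mul_eq_right hRpos.ne').mp h.symm))
  rw [card_bot, hcardNR] at h4
  have h11 : (Nat.card N + 1) * (Nat.card R + 1) ≤ 11 := by linarith
  rcases Nat.lt_or_ge (Nat.card N) 3 with h | h
  · have : 3 ≤ Nat.card R := by omega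
    have : 2 ≤ Nat.card N := by omega
    nlinarith
  · have : 2 ≤ Nat.card R := by omega
    nlinarith

theorem exists_sylow_of_finsum_outsiders [Finite G] {M : Subgroup G}
    (hnil : ¬Group.IsNilpotent G) (hM : IsCoatom M) (hn : ¬M.Normal)
    (hS : ∑ᶠ H ∈ M.outsiders, Nat.card H = 11) :
    ∃ (p q : ℕ) (_ : Fact p.Prime) (P : Sylow p G), q.Prime ∧ q ≠ p ∧ (P : Subgroup G).Normal ∧
      Nat.card G = Nat.card P * q ∧ Nat.card M = q := by
  have hi1 : M.index ≠ 1 := fun h => hM.1 (index_eq_one.mp h)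
  obtain ⟨p, hp, hpi⟩ := Nat.exists_prime_and_dvd hi1
  have : Fact p.Prime := ⟨hp⟩
  have hG : ¬IsPGroup p G := fun h => hnil h.isNilpotent
  obtain ⟨P⟩ : Nonempty (Sylow p G) := inferInstance
  have hPn := sylow_normal_of_finsum_outsiders hM hn hG hpi hS P
  have hPo := sylow_mem_outsiders hG hpi P
  obtain ⟨q, hq, hqi⟩ := Nat.exists_prime_and_dvd (mt index_eq_one.mp hPo.1)
  have hqp : q ≠ p := fun h => P.not_dvd_index (h ▸ hqi)
  have hPM := not_card_sylow_dvd_card hpi P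
  have hnPM : ¬(P : Subgroup G) ≤ M := fun h => hPM (card_dvd_of_le h)
  have hsup : (P : Subgroup G) ⊔ M = ⊤ := by
    rw [sup_comm]
    exact hM.2 _ (left_lt_sup.mpr hnPM)
  have hcardPM := card_sup_mul_card_inf (P : Subgroup G) M
  rw [hsup, card_top] at hcardPM
  have : Fact q.Prime := ⟨hq⟩
  obtain ⟨x, hx⟩ := exists_prime_orderOf_dvd_card' q (hqi.trans (P : Subgroup G).index_dvd_card)
  set R := zpowers x
  have hR : Nat.card R = q := by rw [Nat.card_zpowers, hx]
  obtain ⟨a, ha⟩ := P.isPGroup'.exists_card_eq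
  have hcop : (Nat.card P).Coprime q := by
    rw [ha]
    exact Nat.Coprime.pow_left _ ((Nat.coprime_primes hp hq).mpr hqp.symm)
  have hcardPR := card_sup_mul_card_inf (P : Subgroup G) R
  have hinf : (P : Subgroup G) ⊓ R = ⊥ :=
    (disjoint_of_coprime_natCard (by rwa [hR])).eq_bot
  rw [hinf, card_bot, mul_one, hR] at hcardPR
  have hP1 : Nat.card P ≠ 1 := fun h => hPM (h ▸ one_dvd _)
  have hp2 := hp.two_le
  have hq2 := hq.two_le
  have hPq : Nat.card P ≠ q := fun h => by
    rw [h, Nat.coprime_self] at hcop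
    omega
  have hdpos : 0 < Nat.card ↥((P : Subgroup G) ⊓ M) := Nat.card_pos
  have hPR : (P : Subgroup G) ⊔ R = ⊤ :=
    sup_eq_top_of_finsum_outsiders hM hn hS.le hPo hsup hPM (by rwa [hR]) (by rw [hR]; omega)
  rw [hPR, card_top] at hcardPR
  refine ⟨p, q, ‹_›, P, hq, hqp, hPn, hcardPR, ?_⟩
  set D := (P : Subgroup G) ⊓ M
  have hMD : Nat.card M = q * Nat.card D := by
    rw [hcardPR, mul_assoc] at hcardPM
    exact (Nat.eq_of_mul_eq_mul_left Nat.card_pos hcardPM).symm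
  have hk : M.index * Nat.card D = Nat.card P := by
    have h := M.index_mul_card
    rw [hMD, hcardPR] at h
    refine Nat.eq_of_mul_eq_mul_right hq.pos ?_
    rw [← h]
    ring
  by_cases hd : Nat.card D = 1
  · rw [hMD, hd, mul_one]
  exfalso
  have hk2 := index_ne_two_of_not_normal hn
  obtain ⟨b, -, hb⟩ := (Nat.dvd_prime_pow hp).mp (ha ▸ Dvd.intro_left _ hk)
  have hpD : p ∣ Nat.card D := by
    rw [hb]
    refine dvd_pow_self p ?_
    rintro rfl
    exact hd (by simpa using hb)
  have hDq : Nat.card D ≠ q := fun h => by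
    rw [h, Nat.prime_dvd_prime_iff_eq hp hq] at hpD
    exact hqp hpD.symm
  have hpDle := Nat.le_of_dvd hdpos hpD
  obtain ⟨k, hk'⟩ := hpi
  have hk0 : k ≠ 0 := by
    rintro rfl
    exact index_ne_zero_of_finite hk'
  have hindex3 : 3 ≤ M.index := by
    have : 0 < M.index := Nat.pos_of_ne_zero index_ne_zero_of_finite
    omega
  have hP8 : 8 ≤ Nat.card P := by
    rcases hp.eq_two_or_odd with rfl | hodd
    · have : 4 ≤ M.index := by omega
      nlinarith
    · have : 3 ≤ Nat.card D := by omega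
      nlinarith
  have hDP : Nat.card D < Nat.card P := by nlinarith
  have hDt : D ≠ ⊤ := fun h => hnPM (le_top.trans (h.symm.le.trans inf_le_right))
  have hPq' : Nat.card P * q ≠ q := fun h =>
    hP1 ((Nat.mul_eq_right hq.ne_zero).mp h)
  have hDo : D ∈ M.outsiders := mem_outsiders_of_card_ne hDt fun h =>
    hq.ne_one ((Nat.mul_eq_right hdpos.ne').mp (hMD ▸ h.symm))
  have hRo : R ∈ M.outsiders := mem_outsiders_of_card_ne
    (fun h => hPq' (by rw [← hcardPR, ← card_top, ← h, hR]))
    fun h =>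
      hd ((Nat.mul_eq_left hq.ne_zero).mp (hMD ▸ h.symm.trans hR))
  have h4 := sum_card_four_le_finsum_outsiders (bot_mem_outsiders hM hn) hDo hPo hRo
    (by rw [card_bot]; omega) (by rw [card_bot]; omega) (by rw [card_bot, hR]; omega)
    (by omega) (by rwa [hR]) (by rwa [hR])
  rw [hS, card_bot, hR] at h4
  omega

theorem outsiders_eq_Iic [Finite G] {M : Subgroup G} {p q : ℕ} [Fact p.Prime] (P : Sylow p G)
    [hPn : (P : Subgroup G).Normal] (hM : IsCoatom M) (hq : q.Prime) (hqp : q ≠ p)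
    (hG : Nat.card G = Nat.card P * q) (hMq : Nat.card M = q) :
    M.outsiders = Set.Iic (P : Subgroup G) := by
  have hp : p.Prime := Fact.out
  have : Fact q.Prime := ⟨hq⟩
  have hPpos : 0 < Nat.card P := Nat.card_pos
  obtain ⟨a, ha⟩ := P.isPGroup'.exists_card_eq
  have hqpa : ¬q ∣ p ^ a := fun h => hqp ((Nat.prime_dvd_prime_iff_eq hq hp).mp
    (hq.dvd_of_dvd_pow h))
  have hsylow (K : Subgroup G) (hK : Nat.card K = q) : ∃ S : Sylow q G, (S : Subgroup G) = K := by
    refine ⟨(IsPGroup.of_card (n := 1) (by rw [hK, pow_one])).toSylow fun h => hqpa ?_, rfl⟩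
    have hKi := K.index_mul_card
    rw [hK, hG] at hKi
    rwa [← ha, ← Nat.eq_of_mul_eq_mul_right hq.pos hKi]
  ext H
  rw [Set.mem_Iic]
  constructor
  · rintro ⟨h1, h2⟩
    have hqH : ¬q ∣ Nat.card H := fun hqH => by
      obtain ⟨x, hx⟩ := exists_prime_orderOf_dvd_card' q hqH
      have hK : Nat.card (zpowers (x : G)) = q := by rw [Nat.card_zpowers, orderOf_coe, hx]
      obtain ⟨S, hS⟩ := hsylow M hMq
      obtain ⟨T, hT⟩ := hsylow _ hK
      obtain ⟨g, hg⟩ := MulAction.exists_smul_eq G S T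
      have hc : zpowers (x : G) ∈ M.conjugates := ⟨g, by rw [← hS, ← hT, ← hg]; rfl⟩
      rcases (isCoatom_of_mem_conjugates hM hc).le_iff.mp
        (zpowers_le.mpr x.2) with h | h
      · exact h1 h
      · exact h2 (h ▸ hc)
    have hdvd : Nat.card H ∣ p ^ a := by
      have h := card_subgroup_dvd_card H
      rw [hG, ha] at h
      exact (Nat.Coprime.dvd_mul_right ((hq.coprime_iff_not_dvd.mpr hqH).symm)).mp h
    obtain ⟨b, -, hb⟩ := (Nat.dvd_prime_pow hp).mp hdvd
    obtain ⟨Q, hQ⟩ := (IsPGroup.of_card hb).exists_le_sylow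
    have := Sylow.unique_of_normal P hPn
    exact Subsingleton.elim Q P ▸ hQ
  · intro h
    have hd := card_dvd_of_le h
    have hle := Nat.le_of_dvd hPpos hd
    have hq2 := hq.two_le
    refine mem_outsiders_of_card_ne (fun ht => ?_) fun hc => hqpa ?_
    · rw [ht, card_top, hG] at hle
      nlinarith
    · rw [← ha, ← hMq, ← hc]
      exact hd

theorem card_eq_of_finsum_outsiders [Finite G] {M : Subgroup G}
    (hnil : ¬Group.IsNilpotent G) (hM : IsCoatom M) (hn : ¬M.Normal)
    (hS : ∑ᶠ H ∈ M.outsiders, Nat.card H = 11) : Nat.card G = 12 ∧ Nat.card M = 3 := by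
  classical
  obtain ⟨p, q, hpf, P, hq, hqp, hPn, hG, hMq⟩ := exists_sylow_of_finsum_outsiders hnil hM hn hS
  have hp : p.Prime := hpf.out
  have : Fact q.Prime := ⟨hq⟩
  rw [outsiders_eq_Iic P hM hq hqp hG hMq] at hS
  obtain ⟨a, ha⟩ := P.isPGroup'.exists_card_eq
  have hMi : M.index = Nat.card P := by
    have h := M.index_mul_card
    rw [hMq, hG] at h
    exact Nat.eq_of_mul_eq_mul_right hq.pos h
  have hP4 : Nat.card P = 4 := by
    rw [finsum_mem_eq_finite_toFinset_sum _ (Set.toFinite _)] at hS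
    rcases a with _ | _ | b
    · exact absurd (index_eq_one.mp (hMi.trans ha)) hM.1
    · rw [zero_add, pow_one] at ha
      have hT : (Set.toFinite (Set.Iic (P : Subgroup G))).toFinset = {⊥, (P : Subgroup G)} := by
        ext H
        simp only [Set.Finite.mem_toFinset, Set.mem_Iic, Finset.mem_insert, Finset.mem_singleton]
        refine ⟨fun h => ?_, by rintro (rfl | rfl); exacts [bot_le, le_rfl]⟩
        rcases (Nat.dvd_prime hp).mp (ha ▸ card_dvd_of_le h) with h1 | h1
        · exact Or.inl (card_eq_one.mp h1)
        · exact Or.inr (eq_of_le_of_card_ge h (by rw [h1, ha]))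
      have hne : (⊥ : Subgroup G) ≠ P := fun h => hp.one_lt.ne (by rw [← ha, ← h, card_bot])
      rw [hT, Finset.sum_pair hne, card_bot, ha] at hS
      have : p = 10 := by omega
      subst this
      norm_num at hp
    · obtain ⟨L, hL⟩ := Sylow.exists_subgroup_card_pow_prime_of_le_card (n := b + 1) hp
        P.isPGroup' (by rw [ha]; exact Nat.pow_le_pow_right hp.pos (Nat.le_succ _))
      obtain ⟨K, hKP, hK⟩ : ∃ K ≤ (P : Subgroup G), Nat.card K = p ^ (b + 1) :=
        ⟨L.map (P : Subgroup G).subtype, map_subtype_le _,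
          (card_map_of_injective (subtype_injective _)).trans hL⟩
      have h1 := hp.one_lt
      have hb0 : 0 < p ^ b := Nat.pow_pos hp.pos
      have hlt : p ^ (b + 1) < p ^ (b + 2) := Nat.pow_lt_pow_right h1 (Nat.lt_succ_self _)
      have hlt1 : 1 < p ^ (b + 1) := Nat.one_lt_pow (Nat.succ_ne_zero _) h1
      have hsub : ({⊥, K, (P : Subgroup G)} : Finset (Subgroup G)) ⊆
          (Set.toFinite (Set.Iic (P : Subgroup G))).toFinset := by
        intro H hH
        simp only [Finset.mem_insert, Finset.mem_singleton] at hH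
        rw [Set.Finite.mem_toFinset, Set.mem_Iic]
        rcases hH with rfl | rfl | rfl
        exacts [bot_le, hKP, le_rfl]
      have hKP' : K ≠ P := fun h => hlt.ne (by rw [← hK, h, ha])
      have hbK : ⊥ ≠ K := fun h => hlt1.ne (by rw [← hK, ← h, card_bot])
      have hbP : (⊥ : Subgroup G) ≠ P := fun h => (hlt1.trans hlt).ne (by rw [← ha, ← h, card_bot])
      have hle := Finset.sum_le_sum_of_subset (f := fun H : Subgroup G => Nat.card H) hsub
      rw [hS, Finset.sum_insert (by simp [hbK, hbP]), Finset.sum_pair hKP', card_bot, hK, ha] at hle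
      have h10 : p ^ b * (p + p ^ 2) ≤ 10 := by
        simp only [pow_succ] at hle ⊢
        linarith
      have hp2 : p = 2 := by
        by_contra h2
        have : 3 ≤ p := by omega
        nlinarith
      subst hp2
      have : 2 ^ b = 1 := by omega
      rw [ha, pow_succ, pow_succ, this, one_mul]
      norm_num
  have hq3 : q = 3 := by
    have hfac : ¬q ∣ M.index := by
      rw [hMi, ha]
      exact fun h => hqp ((Nat.prime_dvd_prime_iff_eq hq hp).mp (hq.dvd_of_dvd_pow h))
    let S : Sylow q G := (IsPGroup.of_card (n := 1) (by rw [hMq, pow_one])).toSylow hfac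
    have hmod := card_sylow_modEq_one q G
    have hN : normalizer ((S : Subgroup G) : Set G) = M := normalizer_eq_self_of_isCoatom hM hn
    have hc := S.card_eq_index_normalizer
    have hc' : Nat.card (Sylow q G) = M.index := hc.trans (congrArg index hN)
    rw [hc', hMi, hP4] at hmod
    have := (Nat.modEq_iff_dvd' (by norm_num)).mp hmod.symm
    exact (Nat.prime_dvd_prime_iff_eq hq Nat.prime_three).mp this
  exact ⟨by rw [hG, hP4, hq3], by rw [hMq, hq3]⟩

theorem finsum_card_of_isKleinFour (V : Type*) [Group V] [IsKleinFour V] :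
    ∑ᶠ H : Subgroup V, Nat.card H = 11 := by
  classical
  have : Finite V := IsKleinFour.instFinite
  let _ := Fintype.ofFinite V
  let _ := Fintype.ofFinite (Subgroup V)
  have hV : Nat.card V = 4 := IsKleinFour.card_four
  have hord (x : V) (hx : x ≠ 1) : Nat.card (zpowers x) = 2 := by
    rw [Nat.card_zpowers]
    exact orderOf_eq_prime (by rw [pow_two, IsKleinFour.mul_self]) hx
  let S : Finset (Subgroup V) := (Finset.univ.erase (1 : V)).image zpowers
  have hScard : ∀ H ∈ S, Nat.card H = 2 := by
    intro H hH
    obtain ⟨x, hx, rfl⟩ := Finset.mem_image.mp hH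
    exact hord x (Finset.ne_of_mem_erase hx)
  have hinj : Set.InjOn zpowers ((Finset.univ.erase (1 : V) : Finset V) : Set V) := by
    intro x hx y hy hxy
    have hx1 : x ≠ 1 := by simpa using hx
    have hy1 : y ≠ 1 := by simpa using hy
    have hmem : x ∈ zpowers y := hxy ▸ mem_zpowers x
    rw [mem_zpowers_iff_mem_range_orderOf, ← Nat.card_zpowers, hord y hy1] at hmem
    simp only [Finset.mem_image, Finset.mem_range] at hmem
    obtain ⟨k, hk, rfl⟩ := hmem
    interval_cases k
    · exact absurd (pow_zero y) hx1
    · exact pow_one y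
  have huniv : (Finset.univ : Finset (Subgroup V)) = insert ⊥ (insert ⊤ S) := by
    refine (Finset.eq_univ_of_forall fun H => ?_).symm
    simp only [Finset.mem_insert]
    have hd : Nat.card H ∣ 2 ^ 2 := (card_subgroup_dvd_card H).trans hV.dvd
    obtain ⟨k, hk, hH⟩ := (Nat.dvd_prime_pow Nat.prime_two).mp hd
    interval_cases k
    · exact Or.inl (card_eq_one.mp hH)
    · have : Nontrivial H := Finite.one_lt_card_iff_nontrivial.mp (by rw [hH]; norm_num)
      obtain ⟨x, hx⟩ := exists_ne (1 : H)
      have hx1 : (x : V) ≠ 1 := fun h => hx (Subtype.ext h)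
      refine Or.inr (Or.inr (Finset.mem_image.mpr ⟨x, by simpa using hx1, ?_⟩))
      exact eq_of_le_of_card_ge (zpowers_le.mpr x.2) (by rw [hH, hord _ hx1]; norm_num)
    · exact Or.inr (Or.inl (eq_top_of_le_card _ (by rw [hV, hH]; norm_num)))
  have hT : ⊤ ∉ S := fun h => by simpa [hV] using hScard _ h
  have hB : ⊥ ∉ insert ⊤ S := by
    rw [Finset.mem_insert]
    rintro (h | h)
    · have := congrArg (fun K : Subgroup V => Nat.card K) h
      simp at this
    · simpa using hScard _ h
  rw [finsum_eq_sum_of_fintype, huniv, Finset.sum_insert hB, Finset.sum_insert hT,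
    Finset.sum_congr rfl hScard, Finset.sum_const, Finset.card_image_of_injOn hinj,
    Finset.card_erase_of_mem (Finset.mem_univ _), Finset.card_univ, ← Nat.card_eq_fintype_card,
    card_bot, card_top, hV]
  rfl

theorem finsum_mem_Iic_card (K : Subgroup G) :
    ∑ᶠ H ∈ Set.Iic K, Nat.card H = ∑ᶠ H : Subgroup K, Nat.card H := by
  rw [← finsum_set_coe_eq_finsum_mem]
  refine (finsum_eq_of_bijective _ (MapSubtype.orderIso K).bijective fun _ => ?_).symm
  exact (card_map_of_injective K.subtype_injective).symm

theorem finsum_card_congr {G' : Type*} [Group G'] (e : G ≃* G') :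
    ∑ᶠ H : Subgroup G, Nat.card H = ∑ᶠ H : Subgroup G', Nat.card H :=
  finsum_eq_of_bijective _ e.mapSubgroup.bijective fun _ =>
    (card_map_of_injective (f := e.toMonoidHom) e.injective).symm

theorem exists_isCoatom_not_normal [Finite G] (hnil : ¬Group.IsNilpotent G) :
    ∃ M : Subgroup G, IsCoatom M ∧ ¬M.Normal := by
  by_contra! h
  exact hnil (((Group.isNilpotent_of_finite_tfae (G := G)).out 0 2).mpr h)

theorem nonempty_mulEquiv_alternatingGroup [Finite G] {M : Subgroup G} (hn : ¬M.Normal)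
    (hG : Nat.card G = 12) (hM : Nat.card M = 3) :
    Nonempty (G ≃* alternatingGroup (Fin 4)) := by
  have hi : Nat.card (G ⧸ M) = 4 := by
    have h := M.card_mul_index
    rw [hM, hG] at h
    exact Nat.eq_of_mul_eq_mul_left (by norm_num) h
  let e := Finite.equivFinOfCardEq hi
  let f : G →* Equiv.Perm (Fin 4) := e.permCongrHom.toMonoidHom.comp (MulAction.toPermHom G (G ⧸ M))
  have hcore : M.normalCore = ⊥ := by
    have hd := card_dvd_of_le M.normalCore_le
    rw [hM] at hd
    rcases (Nat.dvd_prime Nat.prime_three).mp hd with h | h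
    · exact card_eq_one.mp h
    · have : M.normalCore = M := eq_of_le_of_card_ge M.normalCore_le (by rw [hM, h])
      exact absurd (this ▸ M.normalCore_normal) hn
  have hf : Function.Injective f := by
    refine e.permCongrHom.injective.comp ?_
    rw [← MonoidHom.ker_eq_bot_iff, ← normalCore_eq_ker, hcore]
  have hr : f.range.index = 2 := by
    have h := f.range.card_mul_index
    rw [← Nat.card_congr (MonoidHom.ofInjective hf).toEquiv, hG, Nat.card_perm, Nat.card_fin] at h
    have : Nat.factorial 4 = 12 * 2 := rfl
    rw [this] at h
    exact Nat.eq_of_mul_eq_mul_left (by norm_num) h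
  exact ⟨(MonoidHom.ofInjective hf).trans
    (MulEquiv.subgroupCongr (Equiv.Perm.eq_alternatingGroup_of_index_eq_two hr))⟩

theorem finsum_card_alternatingGroup_four
    (hnil : ¬Group.IsNilpotent (alternatingGroup (Fin 4))) :
    ∑ᶠ H : Subgroup (alternatingGroup (Fin 4)), Nat.card H = 35 := by
  have h4 : Nat.card (Fin 4) = 4 := Nat.card_fin 4
  have hcard := alternatingGroup.card_of_card_eq_four h4
  obtain ⟨M, hM, hn⟩ := exists_isCoatom_not_normal hnil
  obtain ⟨P⟩ : Nonempty (Sylow 2 (alternatingGroup (Fin 4))) := inferInstance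
  have hPk := alternatingGroup.two_sylow_eq_kleinFour_of_card_eq_four h4 P
  have hPn : (P : Subgroup (alternatingGroup (Fin 4))).Normal :=
    hPk ▸ alternatingGroup.normal_kleinFour h4
  have hPc := alternatingGroup.card_two_sylow_of_card_eq_four h4 P
  have hle (K : Subgroup (alternatingGroup (Fin 4))) (n : ℕ) (hK : Nat.card K = 2 ^ n) :
      K ≤ P := by
    obtain ⟨Q, hQ⟩ := (IsPGroup.of_card hK).exists_le_sylow
    have := alternatingGroup.subsingleton_two_sylow h4
    exact Subsingleton.elim Q P ▸ hQ
  have hPt : (P : Subgroup (alternatingGroup (Fin 4))) ≠ ⊤ := fun h => by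
    rw [h, card_top, hcard] at hPc
    norm_num at hPc
  have hpow (n : ℕ) (hK : Nat.card M = 2 ^ n) : False := by
    rcases hM.le_iff.mp (hle M n hK) with h | h
    · exact hPt h
    · exact hn (h ▸ hPn)
  have hMi := M.card_mul_index
  rw [hcard] at hMi
  have hi2 := index_ne_two_of_not_normal hn
  have hi1 : M.index ≠ 1 := fun h => hM.1 (index_eq_one.mp h)
  have hM3 : Nat.card M = 3 := by
    have hd : Nat.card M ∣ 12 := ⟨_, hMi.symm⟩
    have hle := Nat.le_of_dvd (by norm_num) hd
    have h1 : Nat.card M ≠ 1 := fun h => hpow 0 h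
    have h2 : Nat.card M ≠ 2 := fun h => hpow 1 h
    have h4 : Nat.card M ≠ 4 := fun h => hpow 2 h
    generalize Nat.card M = m at *
    interval_cases m <;> omega
  have : IsKleinFour P := hPk ▸ alternatingGroup.kleinFour_isKleinFour h4
  rw [finsum_card_eq hM hn, outsiders_eq_Iic P hM Nat.prime_three (by norm_num)
    (by rw [hcard, hPc]) hM3, finsum_mem_Iic_card, finsum_card_of_isKleinFour, hcard]

end Subgroup

theorem sigma1_eq_iff (G : Type*) [Group G] [Finite G] :
    sigma1 G = 2 + 11 / (Nat.card G : ℚ) ↔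
      ∑ᶠ H : Subgroup G, Nat.card H = 2 * Nat.card G + 11 := by
  have hG : (Nat.card G : ℚ) ≠ 0 := Nat.cast_ne_zero.mpr Nat.card_pos.ne'
  have hcast : ∑ᶠ H : Subgroup G, (Nat.card H : ℚ) = ((∑ᶠ H : Subgroup G, Nat.card H : ℕ) : ℚ) :=
    (map_finsum (Nat.castRingHom ℚ) (Set.toFinite _)).symm
  rw [sigma1, hcast, div_eq_iff hG, add_mul, div_mul_cancel₀ _ hG]
  norm_cast

theorem stmt_3 (G : Type*) [Group G] [Finite G] (hnil : ¬Group.IsNilpotent G) :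
    sigma1 G = 2 + 11 / (Nat.card G : ℚ) ↔
      Nonempty (G ≃* alternatingGroup (Fin 4)) := by
  rw [sigma1_eq_iff]
  constructor
  · intro h
    obtain ⟨M, hM, hn⟩ := Subgroup.exists_isCoatom_not_normal hnil
    rw [Subgroup.finsum_card_eq hM hn] at h
    obtain ⟨hG, hMc⟩ := Subgroup.card_eq_of_finsum_outsiders hnil hM hn (Nat.add_left_cancel h)
    exact Subgroup.nonempty_mulEquiv_alternatingGroup hn hG hMc
  · rintro ⟨e⟩
    rw [Subgroup.finsum_card_congr e, Subgroup.finsum_card_alternatingGroup_four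
      fun h => hnil (Group.nilpotent_of_mulEquiv e.symm), Nat.card_congr e.toEquiv,
      alternatingGroup.card_of_card_eq_four (Nat.card_fin 4)]
end

section
/- There exists a sequence (Gₙ) of finite groups, none of which is supersolvable, such that σ₁(Gₙ) > 2 for every n, the sequence (σ₁(Gₙ)) is strictly decreasing, and σ₁(Gₙ) tends to 2 as n tends to infinity. -/
theorem IsSupersolvable.exists_normal_isCyclic {G : Type*} [Group G] [Nontrivial G]
    (h : IsSupersolvable G) : ∃ N : Subgroup G, N.Normal ∧ N ≠ ⊥ ∧ IsCyclic N := by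
  obtain ⟨n, H, hnorm, h0, hlast, hstep⟩ := h
  by_contra! hcon
  have hbot : ∀ i, H i = ⊥ := by
    intro i
    induction i using Fin.induction with
    | zero => exact h0
    | succ i ih =>
      by_contra hne
      refine hcon _ (hnorm i.succ) hne ?_
      have := hnorm i.castSucc
      have : IsCyclic ((H i.succ).map (QuotientGroup.mk' (H i.castSucc))) := (hstep i).2
      have hinj : Function.Injective (QuotientGroup.mk' (H i.castSucc)) := by
        rw [← MonoidHom.ker_eq_bot_iff, QuotientGroup.ker_mk', ih]
      exact isCyclic_of_injective
        ((H i.succ).equivMapOfInjective _ hinj).toMonoidHom (MulEquiv.injective _)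
  exact bot_ne_top ((hbot (Fin.last n)).symm.trans hlast)

/-- `G` is a Frobenius group with kernel `V`, elementary abelian of order `p ^ 2`, whose
complements have odd prime order `r ∣ p + 1`. -/
structure IsSquareFrobenius (p r : ℕ) {G : Type*} [Group G] (V : Subgroup G) : Prop where
  prime_left : p.Prime
  prime_right : r.Prime
  ne_two : r ≠ 2
  dvd : r ∣ p + 1
  normal : V.Normal
  card_kernel : Nat.card V = p ^ 2
  index_kernel : V.index = r
  pow_eq_one : ∀ v ∈ V, v ^ p = 1
  mul_comm : ∀ v ∈ V, ∀ w ∈ V, v * w = w * v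
  eq_one_of_commute : ∀ g ∉ V, ∀ v ∈ V, g * v = v * g → v = 1

namespace IsSquareFrobenius

variable {p r : ℕ} {G : Type*} [Group G] {V : Subgroup G}

theorem card_eq (h : IsSquareFrobenius p r V) : Nat.card G = p ^ 2 * r := by
  rw [← V.card_mul_index, h.card_kernel, h.index_kernel]

theorem finite (h : IsSquareFrobenius p r V) : Finite G := by
  refine Nat.finite_of_card_ne_zero ?_
  rw [h.card_eq]
  exact mul_ne_zero (pow_ne_zero _ h.prime_left.ne_zero) h.prime_right.ne_zero

theorem not_dvd_sub_one (h : IsSquareFrobenius p r V) : ¬ r ∣ p - 1 := by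
  intro hd
  have h2 : r ∣ (p + 1) - (p - 1) := Nat.dvd_sub h.dvd hd
  have hp := h.prime_left.two_le
  rw [show (p + 1) - (p - 1) = 2 by omega] at h2
  exact h.ne_two ((Nat.prime_dvd_prime_iff_eq h.prime_right Nat.prime_two).1 h2)

theorem right_ne_left (h : IsSquareFrobenius p r V) : r ≠ p := by
  intro he
  have h1 := h.dvd
  rw [he, Nat.dvd_add_right (dvd_refl p)] at h1
  exact h.prime_left.one_lt.ne' (Nat.dvd_one.1 h1)

theorem notMem_normalizer (h : IsSquareFrobenius p r V) {W : Subgroup G} (hWV : W ≤ V)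
    (hW : Nat.card W = p) {g : G} (hg : g ∉ V) : g ∉ Subgroup.normalizer (W : Set G) := by
  intro hgn
  have := h.finite
  have := h.normal
  have : Fact p.Prime := ⟨h.prime_left⟩
  have : IsCyclic W := isCyclic_of_prime_card hW
  set σ : MulAut W := W.normalizerMonoidHom ⟨g, hgn⟩ with hσ
  have hσr : σ ^ r = 1 := by
    rw [hσ, ← map_pow]
    ext w
    have hgr : g ^ r ∈ V := h.index_kernel ▸ V.pow_index_mem g
    rw [Subgroup.normalizerMonoidHom_apply_apply_coe]
    simp only [SubmonoidClass.mk_pow, MulAut.one_apply]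
    rw [h.mul_comm _ hgr _ (hWV w.2), mul_inv_cancel_right]
  have hσp : orderOf σ ∣ p - 1 := by
    have := orderOf_dvd_natCard σ
    rwa [IsCyclic.card_mulAut, hW, Nat.totient_prime h.prime_left] at this
  have hσ1 : σ = 1 := by
    rcases (Nat.dvd_prime h.prime_right).1 (orderOf_dvd_of_pow_eq_one hσr) with h1 | h1
    · exact orderOf_eq_one_iff.1 h1
    · exact absurd (h1 ▸ hσp) h.not_dvd_sub_one
  have hbot : W = ⊥ := by
    rw [Subgroup.eq_bot_iff_forall]
    intro w hw
    refine h.eq_one_of_commute g hg w (hWV hw) ?_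
    have h1 : ((σ ⟨w, hw⟩ : W) : G) = w := by rw [hσ1]; rfl
    rw [hσ, Subgroup.normalizerMonoidHom_apply_apply_coe] at h1
    exact mul_inv_eq_iff_eq_mul.1 h1
  rw [hbot, Subgroup.card_bot] at hW
  exact h.prime_left.one_lt.ne hW

theorem card_of_le (h : IsSquareFrobenius p r V) {W : Subgroup G} (hWV : W ≤ V) :
    W = ⊥ ∨ Nat.card W = p ∨ W = V := by
  have := h.finite
  have hd := Subgroup.card_dvd_of_le hWV
  rw [h.card_kernel, Nat.dvd_prime_pow h.prime_left] at hd
  obtain ⟨k, hk, hc⟩ := hd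
  interval_cases k
  · exact Or.inl (Subgroup.card_eq_one.1 (by simpa using hc))
  · exact Or.inr (Or.inl (by simpa using hc))
  · exact Or.inr (Or.inr (Subgroup.eq_of_le_of_card_ge hWV (by rw [hc, h.card_kernel])))

theorem card_of_not_le (h : IsSquareFrobenius p r V) {H : Subgroup G} (hHV : ¬ H ≤ V) :
    Nat.card H = r ∨ H = ⊤ := by
  have := h.finite
  have := h.normal
  have hrel : V.relIndex H = r := by
    have hd := V.relIndex_dvd_index_of_normal H
    rw [h.index_kernel, Nat.dvd_prime h.prime_right] at hd
    exact hd.resolve_left fun h1 => hHV (Subgroup.relIndex_eq_one.1 h1)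
  have hcard : Nat.card (V ⊓ H : Subgroup G) * r = Nat.card H := by
    rw [← hrel, ← Subgroup.inf_relIndex_right, ← Subgroup.relIndex_bot_left,
      ← Subgroup.relIndex_bot_left]
    exact Subgroup.relIndex_mul_relIndex _ _ _ bot_le inf_le_right
  rcases h.card_of_le (inf_le_left : V ⊓ H ≤ V) with h1 | h1 | h1
  · left
    rw [← hcard, h1, Subgroup.card_bot, one_mul]
  · exfalso
    obtain ⟨g, hgH, hgV⟩ := SetLike.not_le_iff_exists.1 hHV
    refine h.notMem_normalizer inf_le_left h1 hgV ?_
    rw [Subgroup.mem_normalizer_iff]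
    intro x
    rw [Subgroup.mem_inf, Subgroup.mem_inf, ← h.normal.mem_comm_iff, inv_mul_cancel_left]
    refine and_congr Iff.rfl ?_
    rw [H.mul_mem_cancel_right (H.inv_mem hgH), H.mul_mem_cancel_left hgH]
  · right
    refine Subgroup.eq_top_of_card_eq _ ?_
    rw [← hcard, h1, h.card_kernel, h.card_eq]

theorem disjoint_of_card_eq (h : IsSquareFrobenius p r V) {H : Subgroup G}
    (hH : Nat.card H = r) : Disjoint H V := by
  have := h.finite
  refine Subgroup.disjoint_of_coprime_natCard ?_
  rw [hH, h.card_kernel]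
  exact ((Nat.coprime_primes h.prime_right h.prime_left).2 h.right_ne_left).pow_right 2

theorem not_normal_of_card_eq (h : IsSquareFrobenius p r V) {H : Subgroup G}
    (hH : Nat.card H = r) : ¬ H.Normal := by
  intro hn
  have := h.finite
  have hdisj := h.disjoint_of_card_eq hH
  have hbotH : H ≠ ⊥ := by
    rintro rfl
    rw [Subgroup.card_bot] at hH
    exact h.prime_right.one_lt.ne hH
  obtain ⟨g, hg, hg1⟩ := H.bot_or_exists_ne_one.resolve_left hbotH
  have hgV : g ∉ V := fun hgV =>
    hg1 (Subgroup.disjoint_def.1 hdisj hg hgV)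
  have hbot : V = ⊥ := by
    rw [Subgroup.eq_bot_iff_forall]
    intro v hv
    exact h.eq_one_of_commute g hgV v hv
      (Subgroup.commute_of_normal_of_disjoint H V hn h.normal hdisj g v hg hv)
  have hc := h.card_kernel
  rw [hbot, Subgroup.card_bot] at hc
  exact (Nat.one_lt_pow two_ne_zero h.prime_left.one_lt).ne hc

theorem not_isSupersolvable (h : IsSquareFrobenius p r V) : ¬ IsSupersolvable G := by
  intro hs
  have := h.finite
  have hp2 : 1 < p ^ 2 := Nat.one_lt_pow two_ne_zero h.prime_left.one_lt
  have : Nontrivial V := (Finite.one_lt_card_iff_nontrivial).1 (h.card_kernel ▸ hp2)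
  have : Nontrivial G := Subtype.val_injective.nontrivial (α := V)
  have hVtop : ∃ g, g ∉ V := by
    by_contra! hV
    have := h.index_kernel
    rw [(Subgroup.eq_top_iff' V).2 hV, Subgroup.index_top] at this
    exact h.prime_right.one_lt.ne this
  obtain ⟨g, hg⟩ := hVtop
  obtain ⟨N, hN, hbot, hcyc⟩ := hs.exists_normal_isCyclic
  by_cases hNV : N ≤ V
  · rcases h.card_of_le hNV with h1 | h1 | rfl
    · exact hbot h1
    · refine h.notMem_normalizer hNV h1 hg ?_
      rw [Subgroup.normalizer_eq_top]
      trivial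
    · have he : Monoid.exponent N ∣ p :=
        Monoid.exponent_dvd_of_forall_pow_eq_one fun v => Subtype.ext (h.pow_eq_one v v.2)
      rw [IsCyclic.exponent_eq_card, h.card_kernel] at he
      have := Nat.le_of_dvd h.prime_left.pos he
      nlinarith [h.prime_left.one_lt]
  · rcases h.card_of_not_le hNV with h1 | rfl
    · exact h.not_normal_of_card_eq h1 hN
    · obtain ⟨v, hv⟩ := exists_ne (1 : V)
      refine hv (Subtype.ext (h.eq_one_of_commute g hg v v.2 ?_))
      have hc := (IsCyclic.isMulCommutative (α := (⊤ : Subgroup G))).is_comm.comm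
        (⟨g, trivial⟩ : (⊤ : Subgroup G)) ⟨v, trivial⟩
      exact congrArg Subtype.val hc

theorem factorization_card (h : IsSquareFrobenius p r V) :
    r ^ (Nat.card G).factorization r = r := by
  have : (Nat.card G).factorization r = 1 := by
    rw [h.card_eq, Nat.factorization_mul (pow_ne_zero _ h.prime_left.ne_zero)
      h.prime_right.ne_zero, h.prime_left.factorization_pow, Finsupp.add_apply,
      h.prime_right.factorization_self, Finsupp.single_eq_of_ne h.right_ne_left]
  rw [this, pow_one]

theorem card_sylow (h : IsSquareFrobenius p r V) : Nat.card (Sylow r G) = p ^ 2 := by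
  have := h.finite
  have : Fact r.Prime := ⟨h.prime_right⟩
  obtain ⟨P⟩ : Nonempty (Sylow r G) := inferInstance
  have hP : Nat.card P = r := P.card_eq_multiplicity.trans h.factorization_card
  have hidx : P.index = p ^ 2 := by
    refine Nat.eq_of_mul_eq_mul_left h.prime_right.pos ?_
    have := (P : Subgroup G).card_mul_index
    rw [h.card_eq, _root_.mul_comm (p ^ 2)] at this
    rw [← this]
    exact congrArg (· * _) hP.symm
  have hd := P.card_dvd_index
  have hmod := card_sylow_modEq_one r G
  rw [hidx, Nat.dvd_prime_pow h.prime_left] at hd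
  obtain ⟨k, hk, hc⟩ := hd
  interval_cases k
  · exfalso
    have : Subsingleton (Sylow r G) :=
      (Nat.card_eq_one_iff_unique.1 (by simpa using hc)).1
    exact h.not_normal_of_card_eq hP P.normal_of_subsingleton
  · exfalso
    rw [hc, pow_one] at hmod
    exact h.not_dvd_sub_one ((Nat.modEq_iff_dvd' h.prime_left.one_le).1 hmod.symm)
  · exact hc

section Sum

open Classical in
theorem card_filter_card_eq (h : IsSquareFrobenius p r V) [Fintype (Subgroup G)] :
    (Finset.univ.filter fun H : Subgroup G => Nat.card H = r).card = p ^ 2 := by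
  have := h.finite
  have : Fact r.Prime := ⟨h.prime_right⟩
  rw [← h.card_sylow, ← Nat.subtype_card (p := fun H : Subgroup G => Nat.card H = r) _
    (fun H => by simp)]
  refine Nat.card_congr ⟨fun H => Sylow.ofCard H.1 (H.2.trans h.factorization_card.symm),
    fun P => ⟨P, P.card_eq_multiplicity.trans h.factorization_card⟩, fun _ => rfl,
    fun _ => Sylow.ext rfl⟩

open Classical in
theorem sum_card_not_le (h : IsSquareFrobenius p r V) [Fintype (Subgroup G)] :
    (∑ H : Subgroup G with ¬ H ≤ V, Nat.card H) = 2 * (p ^ 2 * r) := by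
  have := h.finite
  have hp2 : 1 < p ^ 2 := Nat.one_lt_pow two_ne_zero h.prime_left.one_lt
  have htop : Nat.card (⊤ : Subgroup G) ≠ r := by
    rw [Subgroup.card_top, h.card_eq]
    nlinarith [h.prime_right.pos]
  have hset : (Finset.univ.filter fun H : Subgroup G => ¬ H ≤ V) =
      insert ⊤ (Finset.univ.filter fun H : Subgroup G => Nat.card H = r) := by
    ext H
    simp only [Finset.mem_filter, Finset.mem_univ, true_and, Finset.mem_insert]
    refine ⟨fun hH => (h.card_of_not_le hH).symm, ?_⟩
    rintro (rfl | hH) hle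
    · have := h.index_kernel
      rw [top_le_iff.1 hle, Subgroup.index_top] at this
      exact h.prime_right.one_lt.ne this
    · have := (h.disjoint_of_card_eq hH).eq_bot_of_le hle
      rw [this, Subgroup.card_bot] at hH
      exact h.prime_right.one_lt.ne hH
  rw [hset, Finset.sum_insert (by simpa using htop), Subgroup.card_top, h.card_eq,
    Finset.sum_congr rfl (fun H hH => (Finset.mem_filter.1 hH).2), Finset.sum_const,
    h.card_filter_card_eq, smul_eq_mul]
  ring

theorem disjoint_of_card_eq_left (h : IsSquareFrobenius p r V) {H K : Subgroup G}
    (hH : Nat.card H = p) (hK : Nat.card K = p) (hne : H ≠ K) : Disjoint H K := by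
  have := h.finite
  rw [disjoint_iff]
  have hd := Subgroup.card_dvd_of_le (inf_le_left : H ⊓ K ≤ H)
  rw [hH, Nat.dvd_prime h.prime_left] at hd
  refine hd.elim Subgroup.card_eq_one.1 fun hc => absurd ?_ hne
  exact (Subgroup.eq_of_le_of_card_ge inf_le_left (by rw [hc, hH])).symm.trans
    (Subgroup.eq_of_le_of_card_ge inf_le_right (by rw [hc, hK]))

open Classical in
theorem sum_card_of_card_eq_left_le (h : IsSquareFrobenius p r V) [Fintype (Subgroup G)] :
    (∑ H : Subgroup G with H ≤ V ∧ Nat.card H = p, Nat.card H) ≤ 2 * (p ^ 2 - 1) := by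
  have := h.finite
  have := Fintype.ofFinite G
  set A := Finset.univ.filter fun H : Subgroup G => H ≤ V ∧ Nat.card H = p with hA
  let f : Subgroup G → Finset G := fun H => (Finset.univ.filter fun x => x ∈ H).erase 1
  have hf : ∀ H, (f H).card = Nat.card H - 1 := by
    intro H
    rw [Finset.card_erase_of_mem (by simp only [Finset.mem_filter, Finset.mem_univ, true_and, H.one_mem]),
      Nat.subtype_card (p := fun x => x ∈ H) (Finset.univ.filter fun x => x ∈ H)
        (fun x => by simp)]
  calc ∑ H ∈ A, Nat.card H ≤ ∑ H ∈ A, 2 * (f H).card := by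
        refine Finset.sum_le_sum fun H hH => ?_
        rw [hf, (Finset.mem_filter.1 hH).2.2]
        have := h.prime_left.two_le
        omega
    _ = 2 * (A.biUnion f).card := by
        rw [← Finset.mul_sum, Finset.card_biUnion]
        intro H hH K hK hne
        have hd := h.disjoint_of_card_eq_left (Finset.mem_filter.1 hH).2.2
          (Finset.mem_filter.1 hK).2.2 hne
        refine Finset.disjoint_left.2 ?_
        intro x hx hx'
        simp only [f, Finset.mem_erase, Finset.mem_filter, Finset.mem_univ, true_and] at hx hx'
        exact hx.1 (Subgroup.disjoint_def.1 hd hx.2 hx'.2)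
    _ ≤ 2 * (f V).card := by
        refine Nat.mul_le_mul_left _ (Finset.card_le_card ?_)
        intro x hx
        obtain ⟨H, hH, hx⟩ := Finset.mem_biUnion.1 hx
        simp only [f, Finset.mem_erase, Finset.mem_filter, Finset.mem_univ, true_and] at hx ⊢
        exact ⟨hx.1, (Finset.mem_filter.1 hH).2.1 hx.2⟩
    _ = 2 * (p ^ 2 - 1) := by rw [hf, h.card_kernel]

open Classical in
theorem sum_card_le_le (h : IsSquareFrobenius p r V) [Fintype (Subgroup G)] :
    (∑ H : Subgroup G with H ≤ V, Nat.card H) ≤ 3 * p ^ 2 := by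
  have := h.finite
  have hp2 : 1 < p ^ 2 := Nat.one_lt_pow two_ne_zero h.prime_left.one_lt
  have hsub : (Finset.univ.filter fun H : Subgroup G => H ≤ V) ⊆
      insert ⊥ (insert V (Finset.univ.filter fun H : Subgroup G => H ≤ V ∧ Nat.card H = p)) := by
    intro H hH
    have hH := (Finset.mem_filter.1 hH).2
    have := h.card_of_le hH
    simp only [Finset.mem_filter, Finset.mem_univ, true_and, Finset.mem_insert]
    tauto
  have hVbot : V ≠ ⊥ := by
    intro hV
    have hc := h.card_kernel
    rw [hV, Subgroup.card_bot] at hc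
    omega
  refine (Finset.sum_le_sum_of_subset hsub).trans ?_
  have h1 := h.prime_left.one_lt
  rw [Finset.sum_insert, Finset.sum_insert, Subgroup.card_bot, h.card_kernel]
  · have := h.sum_card_of_card_eq_left_le
    omega
  · simp only [Finset.mem_filter, not_and, h.card_kernel]
    intro _ _ hc
    nlinarith
  · simp only [Finset.mem_insert, Finset.mem_filter, not_or, not_and, Subgroup.card_bot]
    exact ⟨hVbot.symm, fun _ _ => h1.ne⟩

end Sum

theorem sigma1_bounds (h : IsSquareFrobenius p r V) :
    2 < sigma1 G ∧ sigma1 G ≤ 2 + 3 / r := by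
  classical
  have := h.finite
  have := Fintype.ofFinite (Subgroup G)
  have hsplit := Finset.sum_filter_add_sum_filter_not Finset.univ
    (fun H : Subgroup G => H ≤ V) (fun H => Nat.card H)
  have hle := h.sum_card_le_le
  have hpos : 1 ≤ ∑ H : Subgroup G with H ≤ V, Nat.card H := by
    refine le_trans ?_ (Finset.single_le_sum (f := fun H : Subgroup G => Nat.card H)
      (fun _ _ => Nat.zero_le _) (Finset.mem_filter.2 ⟨Finset.mem_univ ⊥, bot_le⟩))
    simp
  rw [h.sum_card_not_le] at hsplit
  set S := ∑ H : Subgroup G with H ≤ V, Nat.card H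
  have hp : (0 : ℚ) < p := Nat.cast_pos.2 h.prime_left.pos
  have hr : (0 : ℚ) < r := Nat.cast_pos.2 h.prime_right.pos
  have hpr : (0 : ℚ) < (p : ℚ) ^ 2 * r := by positivity
  have hsigma : sigma1 G = 2 + (S : ℚ) / ((p : ℚ) ^ 2 * r) := by
    rw [sigma1, finsum_eq_sum_of_fintype, ← Nat.cast_sum, ← hsplit, h.card_eq]
    push_cast
    field_simp
    ring
  rw [hsigma]
  have hS1 : (1 : ℚ) ≤ S := by exact_mod_cast hpos
  have hS2 : (S : ℚ) ≤ 3 * (p : ℚ) ^ 2 := by exact_mod_cast hle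
  refine ⟨lt_add_of_pos_right _ (by positivity), add_le_add_right ?_ _⟩
  rw [div_le_div_iff₀ hpr hr]
  nlinarith

end IsSquareFrobenius

theorem exists_isSquareFrobenius {p r : ℕ} (hp : p.Prime) (hr : r.Prime) (h2 : r ≠ 2)
    (hd : r ∣ p + 1) :
    ∃ (G : Type) (_ : Group G) (V : Subgroup G), IsSquareFrobenius p r V := by
  have : Fact p.Prime := ⟨hp⟩
  have : Fact r.Prime := ⟨hr⟩
  let K := GaloisField p 2
  have hK : Nat.card K = p ^ 2 := GaloisField.card p 2 two_ne_zero
  have : Finite K := Nat.finite_of_card_ne_zero (by rw [hK]; exact pow_ne_zero _ hp.ne_zero)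
  have hunits : r ∣ Nat.card Kˣ := by
    rw [Nat.card_units, hK]
    exact hd.trans ⟨p - 1, by simpa using Nat.sq_sub_sq p 1⟩
  obtain ⟨ζ, hζ⟩ := exists_prime_orderOf_dvd_card' r hunits
  let φ : Subgroup.zpowers ζ →* MulAut (Multiplicative K) :=
    ((MulAutMultiplicative K).symm.toMonoidHom.comp AddAut.mulLeft).comp
      (Subgroup.zpowers ζ).subtype
  have hφ : ∀ a x, φ a x = Multiplicative.ofAdd (((a : Kˣ) : K) * x.toAdd) := fun _ _ => rfl
  let G := Multiplicative K ⋊[φ] Subgroup.zpowers ζ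
  have hmem : ∀ g : G, g ∈ (SemidirectProduct.rightHom : G →* _).ker ↔
      g.right = 1 := fun _ => Iff.rfl
  have hcardG : Nat.card G = p ^ 2 * r := by
    rw [SemidirectProduct.card, Nat.card_zpowers, hζ, ← hK]
    rfl
  have hidx : (SemidirectProduct.rightHom : G →* _).ker.index = r := by
    rw [Subgroup.index_ker, MonoidHom.range_eq_top.2 SemidirectProduct.rightHom_surjective,
      Subgroup.card_top, Nat.card_zpowers, hζ]
  refine ⟨G, inferInstance, (SemidirectProduct.rightHom : G →* _).ker, hp, hr, h2, hd,
    inferInstance, ?_, hidx, ?_, ?_, ?_⟩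
  · have := (SemidirectProduct.rightHom : G →* _).ker.card_mul_index
    rw [hidx, hcardG] at this
    exact Nat.eq_of_mul_eq_mul_right hr.pos this
  · rintro v hv
    rw [← SemidirectProduct.range_inl_eq_ker_rightHom] at hv
    obtain ⟨x, rfl⟩ := hv
    rw [← map_pow]
    have : x ^ p = 1 := by
      apply Multiplicative.toAdd.injective
      rw [toAdd_pow, toAdd_one]
      exact by rw [nsmul_eq_mul, CharP.cast_eq_zero, zero_mul]
    rw [this, map_one]
  · intro v hv w hw
    rw [← SemidirectProduct.range_inl_eq_ker_rightHom] at hv hw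
    obtain ⟨x, rfl⟩ := hv
    obtain ⟨y, rfl⟩ := hw
    rw [← map_mul, ← map_mul, mul_comm]
  · intro g hg v hv hgv
    rw [hmem] at hg
    rw [← SemidirectProduct.range_inl_eq_ker_rightHom] at hv
    obtain ⟨x, rfl⟩ := hv
    have h1 := congrArg SemidirectProduct.left hgv
    rw [SemidirectProduct.mul_left, SemidirectProduct.mul_left, SemidirectProduct.left_inl,
      SemidirectProduct.right_inl, map_one, MulAut.one_apply, mul_comm, mul_left_inj, hφ] at h1
    have h3 : ((g.right : Kˣ) : K) * x.toAdd = x.toAdd := congrArg Multiplicative.toAdd h1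
    have h4 : x.toAdd = 0 := by
      by_contra hx
      exact hg (Subtype.ext (Units.ext ((mul_eq_right₀ hx).1 h3)))
    have h5 : x = 1 := h4
    rw [h5, map_one]

theorem exists_not_isSupersolvable_sigma1 (n : ℕ) :
    ∃ (G : Type) (_ : Group G) (_ : Finite G),
      ¬ IsSupersolvable G ∧ 2 < sigma1 G ∧ sigma1 G ≤ 2 + 3 / (n + 1) := by
  obtain ⟨r, hnr, hr⟩ := Nat.exists_infinite_primes (n + 3)
  have : NeZero r := ⟨hr.ne_zero⟩
  obtain ⟨p, -, hp, hpr⟩ := Nat.forall_exists_prime_gt_and_eq_mod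
    (q := r) (a := -1) isUnit_one.neg 0
  have hd : r ∣ p + 1 := by
    rw [← ZMod.natCast_eq_zero_iff]
    push_cast
    rw [hpr, neg_add_cancel]
  obtain ⟨G, _, V, hV⟩ := exists_isSquareFrobenius hp hr (by omega) hd
  refine ⟨G, inferInstance, hV.finite, hV.not_isSupersolvable, hV.sigma1_bounds.1,
    hV.sigma1_bounds.2.trans ?_⟩
  have : (n : ℚ) + 1 ≤ r := by exact_mod_cast (by omega : n + 1 ≤ r)
  gcongr

theorem exists_strictMono_strictAnti_comp {f : ℕ → ℚ} {a : ℚ} (hlt : ∀ n, a < f n)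
    (hf : Filter.Tendsto f Filter.atTop (nhds a)) :
    ∃ φ : ℕ → ℕ, StrictMono φ ∧ StrictAnti (f ∘ φ) := by
  have h0 : Filter.Tendsto (fun n => f n - a) Filter.atTop (nhdsWithin 0 (Set.Ioi 0)) := by
    refine tendsto_nhdsWithin_iff.2 ⟨?_, Filter.Eventually.of_forall fun n => sub_pos.2 (hlt n)⟩
    simpa using hf.sub_const a
  obtain ⟨φ, hφ, hmono⟩ :=
    Filter.strictMono_subseq_of_tendsto_atTop (tendsto_inv_nhdsGT_zero.comp h0)
  refine ⟨φ, hφ, fun m n hmn => ?_⟩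
  have := hmono hmn
  simp only [Function.comp_apply] at this ⊢
  rw [inv_lt_inv₀ (sub_pos.2 (hlt _)) (sub_pos.2 (hlt _))] at this
  linarith

theorem stmt_4 :
    ∃ (G : ℕ → Type) (_ : ∀ n, Group (G n)) (_ : ∀ n, Finite (G n)),
      (∀ n, ¬IsSupersolvable (G n)) ∧
      (∀ n, 2 < sigma1 (G n)) ∧
      StrictAnti (fun n => sigma1 (G n)) ∧
      Filter.Tendsto (fun n => sigma1 (G n)) Filter.atTop (nhds 2) := by
  choose G hG hfin hns hlt hle using exists_not_isSupersolvable_sigma1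
  have htends : Filter.Tendsto (fun n => sigma1 (G n)) Filter.atTop (nhds 2) := by
    refine tendsto_of_tendsto_of_tendsto_of_le_of_le tendsto_const_nhds ?_
      (fun n => (hlt n).le) hle
    have h1 : Filter.Tendsto (fun n : ℕ => 3 * (1 / ((n : ℚ) + 1))) Filter.atTop (nhds (3 * 0)) :=
      tendsto_one_div_add_atTop_nhds_zero_nat.const_mul 3
    simpa [div_eq_mul_inv] using h1.const_add 2
  obtain ⟨φ, hφ, hanti⟩ := exists_strictMono_strictAnti_comp hlt htends
  exact ⟨fun n => G (φ n), fun n => hG (φ n), fun n => hfin (φ n), fun n => hns (φ n),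
    fun n => hlt (φ n), hanti, htends.comp hφ.tendsto_atTop⟩
end

section
/- For every real constant c > 2 there exists a finite group G that is not supersolvable and satisfies σ₁(G) < c. In particular, no constant c ∈ (2, ∞) has the property that σ₁(G) < c implies the supersolvability of G. -/
theorem card_mul_pred_le_of_subgroups_prime_card {G : Type*} [Group G] [Finite G] {r : ℕ}
    (hr : r.Prime) (S : Finset (Subgroup G)) (T : Finset G)
    (hcard : ∀ H ∈ S, Nat.card H = r) (hT : ∀ H ∈ S, ∀ x ∈ H, x ≠ 1 → x ∈ T) :
    S.card * (r - 1) ≤ T.card := by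
  classical
  have := Fintype.ofFinite G
  have := Fact.mk hr
  let t : Subgroup G → Finset G := fun H => (Finset.univ.filter (· ∈ H)).erase 1
  have ht : ∀ H ∈ S, (t H).card = r - 1 := by
    intro H hH
    rw [Finset.card_erase_of_mem (by simp [H.one_mem]), ← hcard H hH, Nat.card_eq_fintype_card,
      Fintype.card_subtype]
  have hgen : ∀ H ∈ S, ∀ x ∈ H, x ≠ 1 → H = Subgroup.zpowers x := by
    intro H hH x hx hx1
    refine le_antisymm (fun y hy => ?_) (by simpa using hx)
    have hx' : (⟨x, hx⟩ : H) ≠ 1 := by simpa [Subtype.ext_iff] using hx1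
    obtain ⟨k, hk⟩ := mem_zpowers_of_prime_card (hcard H hH) hx' (g' := ⟨y, hy⟩)
    exact ⟨k, by simpa [Subtype.ext_iff] using hk⟩
  have hdisj : (S : Set (Subgroup G)).PairwiseDisjoint t := by
    intro H hH K hK hne
    refine Finset.disjoint_left.2 fun x hx hx' => hne ?_
    simp only [t, Finset.mem_erase, Finset.mem_filter, Finset.mem_univ, true_and] at hx hx'
    rw [hgen H hH x hx.2 hx.1, ← hgen K hK x hx'.2 hx.1]
  rw [← Finset.sum_const_nat ht, ← Finset.card_biUnion hdisj]
  refine Finset.card_le_card fun x hx => ?_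
  simp only [t, Finset.mem_biUnion, Finset.mem_erase, Finset.mem_filter, Finset.mem_univ,
    true_and] at hx
  obtain ⟨H, hH, hx1, hx⟩ := hx
  exact hT H hH x hx hx1

theorem not_isSupersolvable_of_conj_notMem_zpowers {G : Type*} [Group G] (V : Subgroup G)
    [V.Normal] (hbot : V ≠ ⊥) (htop : V ≠ ⊤)
    (hV : ∀ g ∉ V, ∀ v ∈ V, v ≠ 1 → g * v * g⁻¹ ∉ Subgroup.zpowers v) :
    ¬IsSupersolvable G := by
  obtain ⟨v₀, hv₀, hv₀1⟩ := V.bot_or_exists_ne_one.resolve_left hbot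
  obtain ⟨g₀, hg₀⟩ : ∃ g, g ∉ V := by
    by_contra! h
    exact htop ((Subgroup.eq_top_iff' V).2 h)
  have key : ∀ N : Subgroup G, N.Normal → IsCyclic N → N = ⊥ := by
    intro N hN hcyc
    by_cases hle : N ≤ V
    · obtain ⟨⟨n, hn⟩, hgen⟩ := hcyc.exists_generator
      have hNz : ∀ y ∈ N, y ∈ Subgroup.zpowers n := by
        intro y hy
        obtain ⟨k, hk⟩ := hgen ⟨y, hy⟩
        exact ⟨k, by simpa [Subtype.ext_iff] using hk⟩
      by_cases hn1 : n = 1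
      · subst hn1
        exact (Subgroup.eq_bot_iff_forall N).2 fun y hy => by simpa using hNz y hy
      · exact absurd (hNz _ (hN.conj_mem n hn g₀)) (hV g₀ hg₀ n (hle hn) hn1)
    · exfalso
      obtain ⟨g, hgN, hgV⟩ := SetLike.not_le_iff_exists.1 hle
      have hcomm : ∀ y ∈ N, g * y * g⁻¹ = y := by
        intro y hy
        have := hcyc.isMulCommutative.is_comm.comm ⟨g, hgN⟩ ⟨y, hy⟩
        have h2 : g * y = y * g := by simpa [Subtype.ext_iff] using this
        rw [h2, mul_inv_cancel_right]
      set w := g * v₀ * g⁻¹ * v₀⁻¹ with hw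
      have hwV : w ∈ V := V.mul_mem (‹V.Normal›.conj_mem _ hv₀ g) (V.inv_mem hv₀)
      have hwN : w ∈ N := by
        have : w = g * (v₀ * g⁻¹ * v₀⁻¹) := by rw [hw]; group
        rw [this]
        exact N.mul_mem hgN (hN.conj_mem _ (N.inv_mem hgN) _)
      by_cases hw1 : w = 1
      · apply hV g hgV v₀ hv₀ hv₀1
        rw [mul_inv_eq_one.1 hw1]
        exact Subgroup.mem_zpowers _
      · apply hV g hgV w hwV hw1
        rw [hcomm w hwN]
        exact Subgroup.mem_zpowers _
  rintro ⟨n, H, hnorm, h0, hlast, hstep⟩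
  have hall : ∀ i, H i = ⊥ := by
    intro i
    induction i using Fin.induction with
    | zero => exact h0
    | succ i ih =>
      have hc := (hstep i).2
      apply key _ (hnorm _)
      have := hnorm i.castSucc
      have hinj : Function.Injective (QuotientGroup.mk' (H i.castSucc)) := by
        rw [← MonoidHom.ker_eq_bot_iff, QuotientGroup.ker_mk', ih]
      exact ((H i.succ).equivMapOfInjective _ hinj).isCyclic.2 hc
  refine htop (eq_top_iff.2 ?_)
  rw [← hlast, hall]
  exact bot_le

theorem card_eq_prime_or_eq_top_of_not_le {G : Type*} [Group G] [Finite G] (V : Subgroup G)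
    [V.Normal] {p q : ℕ} (hp : p.Prime) (hq : q.Prime) (hcard : Nat.card V = p ^ 2)
    (hindex : V.index = q)
    (hV : ∀ g ∉ V, ∀ v ∈ V, v ≠ 1 → g * v * g⁻¹ ∉ Subgroup.zpowers v)
    (H : Subgroup G) (hH : ¬H ≤ V) : Nat.card H = q ∨ H = ⊤ := by
  have := Fact.mk hp
  have hrel : V.relIndex H = q := by
    have h := Subgroup.relIndex_dvd_index_of_normal V H
    rw [hindex] at h
    refine ((Nat.dvd_prime hq).1 h).resolve_left fun h1 => hH (Subgroup.relIndex_eq_one.1 h1)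
  have hmul : Nat.card (V ⊓ H : Subgroup G) * q = Nat.card H := by
    have := Subgroup.card_mul_index ((V ⊓ H).subgroupOf H)
    rw [← hrel, ← Subgroup.inf_relIndex_right, Subgroup.relIndex, ← this]
    congr 1
    exact (Nat.card_congr (Subgroup.subgroupOfEquivOfLe inf_le_right).toEquiv).symm
  have hdvd : Nat.card (V ⊓ H : Subgroup G) ∣ p ^ 2 :=
    hcard ▸ Subgroup.card_dvd_of_le inf_le_left
  obtain ⟨k, hk, hk'⟩ := (Nat.dvd_prime_pow hp).1 hdvd
  interval_cases k
  · left; rw [← hmul, hk']; simp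
  · exfalso
    obtain ⟨g, hgH, hgV⟩ := SetLike.not_le_iff_exists.1 hH
    rw [pow_one] at hk'
    have hne : V ⊓ H ≠ ⊥ := by
      intro h
      rw [h, Subgroup.card_bot] at hk'
      exact hp.one_lt.ne hk'
    obtain ⟨⟨v, hv⟩, hv1⟩ := Subgroup.ne_bot_iff_exists_ne_one.1 hne
    have hmem : g * v * g⁻¹ ∈ V ⊓ H :=
      ⟨‹V.Normal›.conj_mem _ hv.1 g, H.mul_mem (H.mul_mem hgH hv.2) (H.inv_mem hgH)⟩
    obtain ⟨k, hk⟩ := mem_zpowers_of_prime_card hk' hv1 (g' := ⟨_, hmem⟩)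
    exact hV g hgV v hv.1 (by simpa [Subtype.ext_iff] using hv1)
      ⟨k, by simpa [Subtype.ext_iff] using hk⟩
  · right
    refine Subgroup.eq_top_of_card_eq H ?_
    rw [← hmul, hk', ← hcard, ← hindex, Subgroup.card_mul_index]

theorem sigma1_le_of_conj_notMem_zpowers {G : Type*} [Group G] [Finite G] (V : Subgroup G)
    [V.Normal] {p q : ℕ} (hp : p.Prime) (hq : q.Prime) (hpq : p ≠ q)
    (hcard : Nat.card V = p ^ 2) (hindex : V.index = q)
    (hV : ∀ g ∉ V, ∀ v ∈ V, v ≠ 1 → g * v * g⁻¹ ∉ Subgroup.zpowers v) :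
    sigma1 G ≤ 2 + 4 / q := by
  classical
  have := Fintype.ofFinite G
  have hG : Nat.card G = p ^ 2 * q := by rw [← hcard, ← hindex, Subgroup.card_mul_index]
  have hclass := card_eq_prime_or_eq_top_of_not_le V hp hq hcard hindex hV
  have hp2 := hp.two_le
  have hq2 := hq.two_le
  let Sp : Finset (Subgroup G) := Finset.univ.filter fun H => H ≤ V ∧ Nat.card H = p
  let Sq : Finset (Subgroup G) := Finset.univ.filter fun H => Nat.card H = q
  let TV : Finset G := Finset.univ.filter (· ∈ V)
  have hTV : TV.card = p ^ 2 := by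
    rw [← hcard, Nat.card_eq_fintype_card, Fintype.card_subtype]
  have hSp : Sp.card ≤ p + 1 := by
    have h := card_mul_pred_le_of_subgroups_prime_card hp Sp (TV.erase 1)
      (fun H hH => (Finset.mem_filter.1 hH).2.2)
      (fun H hH x hx hx1 => by simpa [TV, hx1] using (Finset.mem_filter.1 hH).2.1 hx)
    rw [Finset.card_erase_of_mem (by simp [TV, V.one_mem]), hTV] at h
    refine Nat.le_of_mul_le_mul_right (h.trans_eq ?_) (show 0 < p - 1 by omega)
    simpa using Nat.sq_sub_sq p 1
  have hSq : Sq.card ≤ p ^ 2 := by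
    have h := card_mul_pred_le_of_subgroups_prime_card hq Sq TVᶜ
      (fun H hH => (Finset.mem_filter.1 hH).2) (fun H hH x hx hx1 => by
        have hHq : Nat.card H = q := (Finset.mem_filter.1 hH).2
        simp only [TV, Finset.mem_compl, Finset.mem_filter, Finset.mem_univ, true_and]
        intro hxV
        have := Fact.mk hq
        have h1 : orderOf x ∣ q := hHq ▸ Subgroup.orderOf_dvd_natCard H hx
        have h2 : orderOf x ∣ p ^ 2 := hcard ▸ Subgroup.orderOf_dvd_natCard V hxV
        have hcop : Nat.Coprime q (p ^ 2) :=
          Nat.Coprime.pow_right 2 ((Nat.coprime_primes hq hp).2 hpq.symm)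
        exact hx1 (orderOf_eq_one_iff.1 (Nat.eq_one_of_dvd_coprimes hcop h1 h2)))
    rw [Finset.card_compl, hTV, ← Nat.card_eq_fintype_card, hG] at h
    refine Nat.le_of_mul_le_mul_right (h.trans_eq ?_) (show 0 < q - 1 by omega)
    rw [Nat.mul_sub, mul_one]
  have hcover : (Finset.univ : Finset (Subgroup G)) ⊆ {⊥} ∪ ({V} ∪ ({⊤} ∪ (Sp ∪ Sq))) := by
    intro H _
    by_cases hH : H ≤ V
    · obtain ⟨k, hk, hk'⟩ := (Nat.dvd_prime_pow hp).1 (hcard ▸ Subgroup.card_dvd_of_le hH)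
      interval_cases k
      · simp [Subgroup.card_eq_one.1 (hk'.trans (pow_zero p))]
      · have : H ∈ Sp := Finset.mem_filter.2 ⟨Finset.mem_univ _, hH, hk'.trans (pow_one p)⟩
        simp [this]
      · simp [Subgroup.eq_of_le_of_card_ge hH (by rw [hk', hcard])]
    · rcases hclass H hH with h | h
      · have : H ∈ Sq := Finset.mem_filter.2 ⟨Finset.mem_univ _, h⟩
        simp [this]
      · simp [h]
  have hunion : ∀ A B : Finset (Subgroup G),
      ∑ H ∈ A ∪ B, Nat.card H ≤ ∑ H ∈ A, Nat.card H + ∑ H ∈ B, Nat.card H := fun A B => by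
    rw [← Finset.sum_union_inter]
    exact Nat.le_add_right _ _
  have hsum : ∑ H : Subgroup G, Nat.card H ≤
      1 + (p ^ 2 + (p ^ 2 * q + ((p + 1) * p + p ^ 2 * q))) := by
    refine (Finset.sum_le_sum_of_subset hcover).trans ((hunion _ _).trans ?_)
    refine add_le_add (by simp) ((hunion _ _).trans ?_)
    refine add_le_add (by rw [Finset.sum_singleton, hcard]) ((hunion _ _).trans ?_)
    refine add_le_add (by simp [← hG]) ((hunion _ _).trans ?_)
    refine add_le_add ?_ ?_
    · rw [Finset.sum_const_nat fun H hH => (Finset.mem_filter.1 hH).2.2]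
      gcongr
    · rw [Finset.sum_const_nat fun H hH => (Finset.mem_filter.1 hH).2]
      gcongr
  have hbound : ∑ H : Subgroup G, Nat.card H ≤ 2 * (p ^ 2 * q) + 4 * p ^ 2 := by nlinarith
  have hp0 : (0 : ℚ) < p := by exact_mod_cast hp.pos
  have hq0 : (0 : ℚ) < q := by exact_mod_cast hq.pos
  have hboundQ : (∑ H : Subgroup G, (Nat.card H : ℚ)) ≤ 2 * (p ^ 2 * q) + 4 * p ^ 2 := by
    exact_mod_cast hbound
  rw [sigma1, finsum_eq_sum_of_fintype, hG, div_le_iff₀ (by positivity)]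
  refine hboundQ.trans_eq ?_
  push_cast
  field_simp

/-- The action of a group of units of a ring on its additive group by multiplication. -/
def unitsMulAut {K : Type*} [Ring K] (A : Subgroup Kˣ) : A →* MulAut (Multiplicative K) where
  toFun a := AddEquiv.toMultiplicative (AddAut.mulLeft (a : Kˣ))
  map_one' := by ext x; exact one_mul x.toAdd
  map_mul' a b := by ext x; exact mul_assoc ((a : Kˣ) : K) (b : Kˣ) x.toAdd

theorem eq_one_of_coe_eq_intCast {K : Type*} [Field K] {p q : ℕ} [Fact p.Prime] [CharP K p]
    (hq : q.Coprime (p - 1)) (b : Kˣ) (hb : b ^ q = 1) (n : ℤ) (hn : (b : K) = n) : b = 1 := by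
  have hfrob : b ^ p = b := by
    ext
    rw [Units.val_pow_eq_pow_val, hn, ← frobenius_def, map_intCast]
  have hpred : b ^ (p - 1) = 1 := by
    have h : b ^ (p - 1) * b = 1 * b := by
      rw [← pow_succ, Nat.sub_add_cancel (Fact.out : p.Prime).one_le, hfrob, one_mul]
    exact mul_right_cancel h
  simpa [hq.gcd_eq_one] using pow_gcd_eq_one.2 ⟨hb, hpred⟩

theorem left_mul_inl_mul_inv {N H : Type*} [CommGroup N] [Group H] {φ : H →* MulAut N}
    (g : N ⋊[φ] H) (x : N) : (g * SemidirectProduct.inl x * g⁻¹).left = φ g.right x := by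
  simp [mul_comm, mul_assoc]

theorem exists_not_isSupersolvable_sigma1_le {q : ℕ} (hq : q.Prime) (hq2 : 2 < q) :
    ∃ (G : Type) (_ : Group G), Finite G ∧ ¬IsSupersolvable G ∧ sigma1 G ≤ 2 + 4 / q := by
  have : NeZero q := ⟨hq.ne_zero⟩
  have := Fact.mk hq
  obtain ⟨p, -, hp, hpq⟩ :=
    Nat.forall_exists_prime_gt_and_eq_mod (q := q) (a := -1) isUnit_one.neg 0
  have := Fact.mk hp
  have hdvd : q ∣ p + 1 := by
    rw [← ZMod.natCast_eq_zero_iff]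
    push_cast
    rw [hpq]
    ring
  have hp1 := hp.one_le
  have hcop : q.Coprime (p - 1) := by
    refine (Nat.Prime.coprime_iff_not_dvd hq).2 fun h => ?_
    have h2 : q ∣ 2 := by
      have := Nat.dvd_sub hdvd h
      rwa [show p + 1 - (p - 1) = 2 by omega] at this
    exact absurd (Nat.le_of_dvd two_pos h2) (by omega)
  have hne : p ≠ q := by
    rintro rfl
    have := (Nat.dvd_add_right (dvd_refl p)).1 hdvd
    exact hp.one_lt.ne' (Nat.dvd_one.1 this)
  let K := GaloisField p 2
  have hK : Nat.card K = p ^ 2 := GaloisField.card p 2 two_ne_zero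
  have : Finite K := Nat.finite_of_card_ne_zero (by rw [hK]; exact pow_ne_zero _ hp.ne_zero)
  obtain ⟨a, ha⟩ : ∃ a : Kˣ, orderOf a = q := by
    refine exists_prime_orderOf_dvd_card' q ?_
    rw [Nat.card_units, hK]
    have h := Nat.sq_sub_sq p 1
    rw [one_pow] at h
    exact h ▸ hdvd.mul_right _
  let A := Subgroup.zpowers a
  have hA : Nat.card A = q := by rw [← ha]; exact Nat.card_zpowers a
  let G := Multiplicative K ⋊[unitsMulAut A] A
  have hG : Nat.card G = p ^ 2 * q := by
    rw [SemidirectProduct.card, hA, ← hK]; rfl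
  have hfin : Finite G := Nat.finite_of_card_ne_zero
    (by rw [hG]; exact mul_ne_zero (pow_ne_zero _ hp.ne_zero) hq.ne_zero)
  let V : Subgroup G := SemidirectProduct.rightHom.ker
  have hindex : V.index = q := by
    rw [Subgroup.index_ker, MonoidHom.range_eq_top.2 SemidirectProduct.rightHom_surjective,
      Subgroup.card_top, hA]
  have hcard : Nat.card V = p ^ 2 := by
    have h := Subgroup.card_mul_index V
    rw [hindex, hG] at h
    exact Nat.eq_of_mul_eq_mul_right hq.pos h
  have hV : ∀ g ∉ V, ∀ v ∈ V, v ≠ 1 → g * v * g⁻¹ ∉ Subgroup.zpowers v := by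
    rintro g hg v hv hv1 ⟨n, hn⟩
    apply hg
    obtain ⟨x, rfl⟩ := SemidirectProduct.range_inl_eq_ker_rightHom.ge hv
    have hx : x.toAdd ≠ 0 := by
      intro h
      exact hv1 (by rw [show x = 1 from h, map_one])
    have hleft : (g.right : Kˣ) * x.toAdd = (n : K) * x.toAdd := by
      have h : x ^ n = unitsMulAut A g.right x := by
        rw [← left_mul_inl_mul_inv, ← hn]
        exact congrArg SemidirectProduct.left (map_zpow SemidirectProduct.inl x n)
      have h' : n • x.toAdd = (g.right : Kˣ) * x.toAdd := h
      rw [← h', zsmul_eq_mul]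
    have hright := mul_right_cancel₀ hx hleft
    have hpow : (g.right : Kˣ) ^ q = 1 := by
      have h : g.right ^ q = 1 := hA ▸ pow_card_eq_one'
      exact_mod_cast congrArg Subtype.val h
    exact Subtype.ext (eq_one_of_coe_eq_intCast hcop _ hpow n hright)
  refine ⟨G, inferInstance, hfin, not_isSupersolvable_of_conj_notMem_zpowers V ?_ ?_ hV,
    sigma1_le_of_conj_notMem_zpowers V hp hq hne hcard hindex hV⟩
  · intro h
    rw [h, Subgroup.card_bot] at hcard
    exact (Nat.one_lt_pow two_ne_zero hp.one_lt).ne hcard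
  · intro h
    rw [h, Subgroup.index_top] at hindex
    exact hq.one_lt.ne hindex

theorem stmt_5 (c : ℝ) (hc : 2 < c) :
    ∃ (G : Type) (_ : Group G), Finite G ∧ ¬IsSupersolvable G ∧
      (sigma1 G : ℝ) < c := by
  obtain ⟨n, hn⟩ := exists_nat_gt (4 / (c - 2))
  obtain ⟨q, hqn, hq⟩ := Nat.exists_infinite_primes (n + 3)
  obtain ⟨G, hG, hfin, hns, hle⟩ := exists_not_isSupersolvable_sigma1_le hq (by omega)
  refine ⟨G, hG, hfin, hns, ?_⟩
  have hleR : (sigma1 G : ℝ) ≤ ((2 + 4 / q : ℚ) : ℝ) := by exact_mod_cast hle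
  push_cast at hleR
  have hnq : (n : ℝ) ≤ q := by exact_mod_cast (by omega : n ≤ q)
  have hq0 : (0 : ℝ) < q := by exact_mod_cast hq.pos
  have : 4 / (q : ℝ) < c - 2 := by
    rw [div_lt_comm₀ hq0 (by linarith)]
    linarith
  linarith
end
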